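/- arXiv:2108.05745 — 6 statements merged into one kernel-verified Lean document; each statement's English description precedes it below -/
import Mathlib

section
/- Let d ≥ 1, let λ > 0 and let Q ⊂ ℝ^d be a convex polytope (the convex hull of a finite set of points) such that Q ⊆ -λQ (i.e., every point of Q is of the form -λq for some q ∈ Q). Then there exists a set of at most 2d vertices of Q whose convex hull Q' satisfies Q ⊆ -(λ+2)d · Q'. -/
open Set MeasureTheory Pointwise

lemma aux_auerbach {E : Type*} [AddCommGroup E] [Module ℝ E] [FiniteDimensional ℝ E]
    (X : Set E) (hX : X.Finite) :
    ∃ (k : ℕ) (v : Fin k → E), (∀ i, v i ∈ X) ∧ LinearIndependent ℝ v ∧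
      k = Module.finrank ℝ (Submodule.span ℝ X) ∧
      ∀ x ∈ X, ∃ β : Fin k → ℝ, (∀ i, |β i| ≤ 1) ∧ x = ∑ i, β i • v i := by
  classical
  set S := Submodule.span ℝ X with hS
  obtain ⟨b, hbX, hbS, hbl⟩ := exists_linearIndependent ℝ X
  have hbf : b.Finite := hX.subset hbX
  have : Fintype b := hbf.fintype
  have hSb : Submodule.span ℝ (Set.range (Subtype.val : b → E)) = S := by
    rw [Subtype.range_coe, hbS]
  set k := Module.finrank ℝ S with hk
  have hcard : Fintype.card b = k := by
    rw [← finrank_span_eq_card hbl, hSb]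
  let eq := Fintype.equivFinOfCardEq hcard
  let u : Fin k → E := fun i => (eq.symm i : E)
  have hul : LinearIndependent ℝ u := hbl.comp _ eq.symm.injective
  let e := Module.Basis.span hul
  obtain ⟨p, hp⟩ := LinearMap.exists_leftInverse_of_injective
    (Submodule.span ℝ (Set.range u)).subtype (Submodule.ker_subtype _)
  let D : E [⋀^Fin k]→ₗ[ℝ] ℝ := e.det.compLinearMap p
  have hDu : D u = 1 := by
    have : (fun i => p (u i)) = e := by
      funext i
      have h1 := LinearMap.congr_fun hp (e i)
      simp only [LinearMap.comp_apply, Submodule.subtype_apply, LinearMap.id_apply] at h1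
      rw [← h1]
      congr 1
      exact (congrArg Subtype.val (Module.Basis.span_apply hul i)).symm
    change e.det (fun i => p (u i)) = 1
    rw [this]; exact e.det_self
  have : Finite X := hX
  have : Nonempty (Fin k → X) := ⟨fun i => ⟨u i, hbX (eq.symm i).2⟩⟩
  obtain ⟨v, hv⟩ := Finite.exists_max (fun v : Fin k → X => |D (fun i => (v i : E))|)
  have hv0 : 1 ≤ |D (fun i => (v i : E))| := by
    have := hv (fun i => ⟨u i, hbX (eq.symm i).2⟩)
    simpa [hDu] using this
  have hvne : D (fun i => (v i : E)) ≠ 0 := by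
    intro h; rw [h] at hv0; simp at hv0; linarith
  have hvl : LinearIndependent ℝ (fun i => (v i : E)) := by
    by_contra h
    exact hvne (D.map_linearDependent _ h)
  have hspan : Submodule.span ℝ (Set.range (fun i => (v i : E))) = S := by
    apply Submodule.eq_of_le_of_finrank_eq
    · apply Submodule.span_mono
      rintro _ ⟨i, rfl⟩
      exact (v i).2
    · rw [finrank_span_eq_card hvl]; simp [hk]
  refine ⟨k, fun i => v i, fun i => (v i).2, hvl, rfl, fun x hx => ?_⟩
  have hxS : x ∈ Submodule.span ℝ (Set.range (fun i => (v i : E))) := by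
    rw [hspan]; exact Submodule.subset_span hx
  obtain ⟨β, hβ⟩ := (Submodule.mem_span_range_iff_exists_fun ℝ).1 hxS
  refine ⟨β, fun i => ?_, hβ.symm⟩
  have h1 : D (Function.update (fun i => (v i : E)) i x) = β i * D (fun i => (v i : E)) := by
    rw [← hβ, AlternatingMap.map_update_sum]
    rw [Finset.sum_eq_single i]
    · rw [AlternatingMap.map_update_smul]; simp
    · intro j _ hj
      rw [AlternatingMap.map_update_smul, AlternatingMap.map_update_self _ _ hj.symm, smul_zero]
    · simp
  have h2 := hv (Function.update v i ⟨x, hx⟩)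
  have h3 : (fun j => ((Function.update v i ⟨x, hx⟩ : Fin k → X) j : E)) =
      Function.update (fun i => (v i : E)) i x := by
    funext j
    by_cases h : j = i
    · subst h; simp
    · simp [h]
  simp only [h3, h1, abs_mul] at h2
  nlinarith [abs_nonneg (β i)]

lemma aux_sum_mem {E : Type*} [AddCommGroup E] [Module ℝ E] {C : Set E} (hC : Convex ℝ C)
    (h0 : (0 : E) ∈ C) {ι : Type*} [Fintype ι] (a : ι → ℝ) (p : ι → E) (ha : ∀ i, 0 ≤ a i)
    (hs : ∑ i, a i ≤ 1) (hp : ∀ i, p i ∈ C) : ∑ i, a i • p i ∈ C := by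
  have := hC.sum_mem (t := Finset.univ) (w := fun o : Option ι => o.elim (1 - ∑ i, a i) a)
    (z := fun o => o.elim 0 p) (by rintro (_ | i) _ <;> simp [ha, hs])
    (by simp [Fintype.sum_option]) (by rintro (_ | i) _ <;> simp [hp, h0])
  simpa [Fintype.sum_option] using this

/-- A nonzero point `w` of the polytope lies below a boundary point which is a combination of few
vertices. -/
lemma aux_ray {E : Type*} [NormedAddCommGroup E] [NormedSpace ℝ E] [FiniteDimensional ℝ E]
    (X : Set E) (hX : X.Finite) (w : E) (hw : w ∈ convexHull ℝ X) (hw0 : w ≠ 0) :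
    ∃ (U : Finset E) (t : ℝ), (U : Set E) ⊆ X ∧
      U.card ≤ Module.finrank ℝ (Submodule.span ℝ X) ∧ 1 ≤ t ∧ t • w ∈ convexHull ℝ (U : Set E) := by
  classical
  have hcomp : IsCompact (convexHull ℝ X) := hX.isCompact_convexHull ℝ
  -- maximal t
  have hT : IsCompact ((fun t : ℝ => t • w) ⁻¹' convexHull ℝ X) :=
    (isClosedEmbedding_smul_left hw0).isCompact_preimage hcomp
  obtain ⟨t, htm, ht⟩ := hT.exists_isMaxOn ⟨1, by simpa using hw⟩ continuousOn_id
  have ht1 : 1 ≤ t := ht (show (1 : ℝ) ∈ _ by simpa using hw)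
  have htm' : t • w ∈ convexHull ℝ X := htm
  obtain ⟨ι, _, z, c, hz, haff, hc, hcs, hcy⟩ := eq_pos_convex_span_of_mem_convexHull htm'
  have hlin : LinearIndependent ℝ z := by
    by_contra hdep
    obtain ⟨a, ha, j, hj⟩ := Fintype.not_linearIndependent_iff.1 hdep
    have hsum : ∑ i, a i ≠ 0 := by
      intro h0
      have := (affineIndependent_iff.1 haff) Finset.univ a h0 ha j (Finset.mem_univ _)
      exact hj this
    -- wlog positive sum
    obtain ⟨a, ha, hpos⟩ : ∃ a : ι → ℝ, ∑ i, a i • z i = 0 ∧ 0 < ∑ i, a i := by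
      rcases lt_or_gt_of_ne hsum with h | h
      · exact ⟨fun i => - a i, by simp [ha], by simpa using h⟩
      · exact ⟨a, ha, h⟩
    have hev : ∀ᶠ ε : ℝ in nhdsWithin 0 (Set.Ioi 0),
        (∀ i, 0 < c i - ε * a i) ∧ 0 < 1 - ε * ∑ i, a i := by
      apply Filter.Eventually.filter_mono nhdsWithin_le_nhds
      apply Filter.Eventually.and
      · rw [Filter.eventually_all]
        intro i
        have : Filter.Tendsto (fun ε : ℝ => c i - ε * a i) (nhds 0) (nhds (c i - 0 * a i)) :=
          (Continuous.tendsto (by fun_prop) 0)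
        exact this.eventually (lt_mem_nhds (by simpa using hc i))
      · have : Filter.Tendsto (fun ε : ℝ => 1 - ε * ∑ i, a i) (nhds 0)
          (nhds (1 - 0 * ∑ i, a i)) := (Continuous.tendsto (by fun_prop) 0)
        exact this.eventually (lt_mem_nhds (by simp))
    obtain ⟨ε, ⟨h1, h2⟩, hε⟩ := (hev.and self_mem_nhdsWithin).exists
    have hε : 0 < ε := hε
    set s := 1 - ε * ∑ i, a i with hs
    have hs1 : s < 1 := by nlinarith [mul_pos hε hpos]
    have hmem : (s⁻¹ * t) • w ∈ convexHull ℝ X := by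
      have e1 : (s⁻¹ * t) • w = ∑ i, (s⁻¹ * (c i - ε * a i)) • z i := by
        simp only [mul_smul, ← Finset.smul_sum, sub_smul, Finset.sum_sub_distrib, ha, hcy]
        simp
      rw [e1]
      apply (convex_convexHull ℝ X).sum_mem
      · intro i _; exact (mul_pos (inv_pos.2 h2) (h1 i)).le
      · rw [← Finset.mul_sum, Finset.sum_sub_distrib, ← Finset.mul_sum, hcs]
        exact inv_mul_cancel₀ h2.ne'
      · intro i _; exact subset_convexHull ℝ X (hz ⟨i, rfl⟩)
    have h3 : s⁻¹ * t ≤ t := ht hmem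
    have h4 : 1 < s⁻¹ := (one_lt_inv₀ h2).2 hs1
    nlinarith
  refine ⟨Finset.univ.image z, t, by simpa using hz, ?_, ht1, ?_⟩
  · rw [Finset.card_image_of_injective _ hlin.injective, Finset.card_univ,
      ← finrank_span_eq_card hlin]
    exact Submodule.finrank_mono (Submodule.span_mono hz)
  · rw [← hcy]
    apply (convex_convexHull ℝ _).sum_mem (fun i _ => (hc i).le) hcs
    intro i _
    exact subset_convexHull ℝ _ (by simp)

/-- If `Q ⊆ ℝ^d` is a convex polytope (convex hull of a finite set)
with `Q ⊆ -λ • Q` for some `λ > 0`, then there are at most `2d` vertices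
(extreme points) of `Q` whose convex hull `Q'` satisfies `Q ⊆ -(λ+2)d • Q'`. -/
theorem sparse_approx_polytope (d : ℕ) (hd : 1 ≤ d) (l : ℝ) (hl : 0 < l)
    (Q : Set (EuclideanSpace ℝ (Fin d)))
    (hQpoly : ∃ V : Finset (EuclideanSpace ℝ (Fin d)), Q = convexHull ℝ (V : Set (EuclideanSpace ℝ (Fin d))))
    (hQsub : Q ⊆ (-l) • Q) :
    ∃ W : Finset (EuclideanSpace ℝ (Fin d)),
      (W : Set (EuclideanSpace ℝ (Fin d))) ⊆ Set.extremePoints ℝ Q ∧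
      W.card ≤ 2 * d ∧
      Q ⊆ (-((l + 2) * d)) • convexHull ℝ (W : Set (EuclideanSpace ℝ (Fin d))) := by

  classical
  obtain ⟨V, hV⟩ := hQpoly
  rcases Q.eq_empty_or_nonempty with hQe | ⟨q, hq⟩
  · exact ⟨∅, by simp, by simp, by simp [hQe]⟩
  have hQc : Convex ℝ Q := hV ▸ convex_convexHull ℝ _
  have hQk : IsCompact Q := hV ▸ V.finite_toSet.isCompact_convexHull ℝ
  set X := Set.extremePoints ℝ Q with hXdef
  have hXf : X.Finite := by
    apply V.finite_toSet.subset
    rw [hXdef, hV]; exact extremePoints_convexHull_subset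
  have hQX : convexHull ℝ X = Q := by
    have := closure_convexHull_extremePoints hQk hQc
    rwa [(hXf.isClosed_convexHull ℝ).closure_eq] at this
  have hneg : ∀ x ∈ Q, (-l⁻¹) • x ∈ Q := by
    intro x hx
    obtain ⟨y, hy, rfl⟩ := hQsub hx
    simpa [smul_smul, hl.ne'] using hy
  have hzero : (0 : EuclideanSpace ℝ (Fin d)) ∈ Q := by
    have := hQc hq (hneg q hq) (a := 1 / (1 + l)) (b := l / (1 + l)) (by positivity) (by positivity)
      (by field_simp)
    convert this using 1
    rw [smul_smul, ← add_smul]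
    have : 1 / (1 + l) + l / (1 + l) * -l⁻¹ = 0 := by field_simp; ring
    rw [this, zero_smul]
  obtain ⟨k, v, hvX, hvl, hk, hβ⟩ := aux_auerbach X hXf
  have hkd : k ≤ d := by
    rw [hk]; exact (Submodule.finrank_le _).trans (by simp)
  have hd' : (1 : ℝ) ≤ d := by exact_mod_cast hd
  have hcpos : 0 < (l + 2) * d := by positivity
  rcases Nat.eq_zero_or_pos k with hk0 | hkpos
  · subst hk0
    have hX0 : X ⊆ {0} := by
      intro x hx
      obtain ⟨β, _, h⟩ := hβ x hx
      simpa using h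
    have hQ0 : Q ⊆ {0} := by
      rw [← hQX]; exact convexHull_min hX0 (convex_singleton 0)
    have hXne : X.Nonempty := hQk.extremePoints_nonempty ⟨q, hq⟩
    obtain ⟨x, hx⟩ := hXne
    have hx0 : x = 0 := hX0 hx
    subst hx0
    refine ⟨{0}, by simpa using hx, by simp; omega, ?_⟩
    simpa using hQ0
  have hkr : (0 : ℝ) < k := by exact_mod_cast hkpos
  set w : EuclideanSpace ℝ (Fin d) := (-l⁻¹) • ∑ i, (k : ℝ)⁻¹ • v i with hw
  have hvs : ∑ i, v i = (-(l * k)) • w := by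
    rw [hw, ← Finset.smul_sum, smul_smul, smul_smul]
    have : -(l * k) * -l⁻¹ * (k : ℝ)⁻¹ = 1 := by field_simp
    rw [this, one_smul]
  have hwQ : w ∈ Q := by
    apply hneg
    apply hQc.sum_mem
    · intro i _; positivity
    · simp [hkr.ne']
    · intro i _; exact (hvX i).1
  have hw0 : w ≠ 0 := by
    intro h
    rw [h, smul_zero] at hvs
    have := Fintype.linearIndependent_iff.1 hvl (fun _ => 1) (by simpa using hvs) ⟨0, hkpos⟩
    norm_num at this
  obtain ⟨U, t, hUX, hUc, ht1, htU⟩ := aux_ray X hXf w (hQX ▸ hwQ) hw0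
  rw [← hk] at hUc
  refine ⟨Finset.univ.image v ∪ U, ?_, ?_, ?_⟩
  · intro x hx
    simp only [Finset.coe_union, Finset.coe_image, Finset.coe_univ, Set.image_univ,
      Set.mem_union, Set.mem_range] at hx
    rcases hx with ⟨i, rfl⟩ | hx
    · exact hvX i
    · exact hUX hx
  · have h1 := Finset.card_union_le (Finset.univ.image v) U
    have h2 : (Finset.univ.image v).card ≤ k := by
      simpa using Finset.card_image_le (s := Finset.univ) (f := v)
    omega
  set C := convexHull ℝ ((Finset.univ.image v ∪ U : Finset _) : Set (EuclideanSpace ℝ (Fin d)))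
    with hC
  have hCc : Convex ℝ C := convex_convexHull ℝ _
  have hvC : ∀ i, v i ∈ C := fun i => subset_convexHull ℝ _ (by simp)
  have htC : t • w ∈ C := convexHull_mono (by simp) htU
  have htpos : 0 < t := by linarith
  have h0C : (0 : EuclideanSpace ℝ (Fin d)) ∈ C := by
    have hm : ∑ i, (k : ℝ)⁻¹ • v i ∈ C := by
      apply hCc.sum_mem
      · intro i _; positivity
      · simp [hkr.ne']
      · intro i _; exact hvC i
    have hm' : ∑ i, (k : ℝ)⁻¹ • v i = (-l) • w := by
      rw [hw, smul_smul]; simp [hl.ne']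
    rw [hm'] at hm
    have := hCc hm htC (a := t / (t + l)) (b := l / (t + l)) (by positivity) (by positivity)
      (by field_simp)
    convert this using 1
    clear_value w
    rw [smul_smul, smul_smul, ← add_smul]
    have : t / (t + l) * -l + l / (t + l) * t = 0 := by field_simp; ring
    rw [this, zero_smul]
  have hwC : w ∈ C := by
    have := hCc.smul_mem_of_zero_mem h0C htC (t := t⁻¹)
      ⟨by positivity, inv_le_one_of_one_le₀ ht1⟩
    simpa [smul_smul, htpos.ne'] using this
  have hXsub : X ⊆ (-((l + 2) * d)) • C := by
    intro x hx
    obtain ⟨β, hβ1, hxβ⟩ := hβ x hx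
    refine ⟨∑ o : Option (Fin k), (o.elim (l * k / ((l + 2) * d))
      (fun i => (1 - β i) / ((l + 2) * d)) : ℝ) • (o.elim w v : EuclideanSpace ℝ (Fin d)), ?_, ?_⟩
    · apply aux_sum_mem hCc h0C
      · rintro (_ | i)
        · simp only [Option.elim]; positivity
        · have := (abs_le.1 (hβ1 i)).2
          exact div_nonneg (by linarith) hcpos.le
      · simp only [Fintype.sum_option, Option.elim]
        rw [← Finset.sum_div, ← add_div, div_le_one hcpos]
        have h1 : ∑ i, (1 - β i) ≤ ∑ i : Fin k, (2 : ℝ) :=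
          Finset.sum_le_sum fun i _ => by linarith [(abs_le.1 (hβ1 i)).1]
        have h2 : (k : ℝ) ≤ d := by exact_mod_cast hkd
        rw [Finset.sum_const, Finset.card_univ, Fintype.card_fin, nsmul_eq_mul] at h1
        nlinarith [mul_le_mul_of_nonneg_left h2 hl.le]
      · rintro (_ | i)
        · exact hwC
        · exact hvC i
    · simp only [Fintype.sum_option, Option.elim]
      rw [smul_add, Finset.smul_sum, smul_smul]
      have e1 : -((l + 2) * d) * (l * k / ((l + 2) * d)) = -(l * k) := by field_simp
      have e2 : ∀ i, (-((l + 2) * d)) • ((1 - β i) / ((l + 2) * d)) • v i = β i • v i - v i := by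
        intro i
        rw [smul_smul]
        have : -((l + 2) * d) * ((1 - β i) / ((l + 2) * d)) = β i - 1 := by field_simp; ring
        rw [this, sub_smul, one_smul]
      simp only [e1, e2, ← hvs, Finset.sum_sub_distrib]
      rw [hxβ]; abel
  rw [← hQX]
  exact convexHull_min hXsub (hCc.smul _)
end

section
/- Let d ≥ 1 and let Q ⊂ ℝ^d be a convex polytope in John's position, i.e., the Euclidean unit ball B^d is the ellipsoid of maximal volume contained in Q. Then there exists a set of at most 2d vertices of Q whose convex hull Q' satisfies Q ⊆ -2d² · Q'. -/
open Set MeasureTheory Pointwise Metric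

lemma support_ineq {r ε b s n M X : ℝ} (hr : 1 < r) (hε : 0 ≤ ε) (hε2 : ε ≤ (r - 1) / 4)
    (hb : b ^ 2 * (r - 1) = r - 1 - 2 * ε) (hs : |s| ≤ n)
    (hM1 : n ≤ M) (hM2 : r * s ≤ M)
    (hX : X ^ 2 = (1 + ε) ^ 2 * s ^ 2 + b ^ 2 * (n ^ 2 - s ^ 2)) : ε * s + X ≤ M := by
  obtain ⟨hs1, hs2⟩ := abs_le.1 hs
  have hr1 : 0 < r - 1 := by linarith
  rcases le_total (r * s) n with h | h
  · have h0 : 0 ≤ n - ε * s := by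
      rcases le_total s 0 with h' | h'
      · nlinarith
      · nlinarith
    have h1 : 0 ≤ (n - ε * s) ^ 2 - X ^ 2 := by
      have e : ((n - ε * s) ^ 2 - X ^ 2) * (r - 1) = 2 * ε * ((n - r * s) * (s + n)) := by
        rw [hX]; linear_combination (s ^ 2 - n ^ 2) * hb
      have : 0 ≤ 2 * ε * ((n - r * s) * (s + n)) :=
        mul_nonneg (by linarith) (mul_nonneg (by linarith) (by linarith))
      rw [← e] at this
      exact nonneg_of_mul_nonneg_left this hr1
    have := abs_le_of_sq_le_sq (by linarith : X ^ 2 ≤ (n - ε * s) ^ 2) h0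
    linarith [le_abs_self X]
  · have hn : 0 ≤ n := le_trans (abs_nonneg _) hs
    have hs0 : 0 ≤ s := by by_contra hh; push Not at hh; nlinarith
    have h0 : 0 ≤ (r - ε) * s := mul_nonneg (by linarith) hs0
    have h1 : 0 ≤ ((r - ε) * s) ^ 2 - X ^ 2 := by
      have e : ((r - ε) * s) ^ 2 - X ^ 2 = b ^ 2 * ((r * s - n) * (r * s + n)) := by
        rw [hX]; linear_combination (-s ^ 2 * (r + 1)) * hb
      rw [e]
      exact mul_nonneg (sq_nonneg _) (mul_nonneg (by linarith) (by linarith))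
    have := abs_le_of_sq_le_sq (by linarith : X ^ 2 ≤ ((r - ε) * s) ^ 2) h0
    linarith [le_abs_self X]

lemma exists_eps {m : ℕ} {r : ℝ} (hr : (m : ℝ) + 1 < r) :
    ∃ ε b : ℝ, 0 < ε ∧ ε ≤ (r - 1) / 4 ∧ 0 < b ∧ b ^ 2 * (r - 1) = r - 1 - 2 * ε ∧
      1 < b ^ m * (1 + ε) := by
  have hm : (0 : ℝ) ≤ m := Nat.cast_nonneg m
  have hr1 : 0 < r - 1 := by linarith
  set k : ℝ := m / (r - 1) with hk
  have hk0 : 0 ≤ k := by positivity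
  have hk1 : k < 1 := by rw [hk, div_lt_one hr1]; linarith
  set ε : ℝ := min ((1 - k) / 4) ((r - 1) / 4) with hεd
  have hε0 : 0 < ε := lt_min (by linarith) (by linarith)
  have hε1 : ε ≤ (1 - k) / 4 := min_le_left _ _
  have hε2 : ε ≤ (r - 1) / 4 := min_le_right _ _
  have hx : 2 * ε / (r - 1) ≤ 1 / 2 := by rw [div_le_iff₀ hr1]; linarith
  have hx0 : 0 ≤ 2 * ε / (r - 1) := by positivity
  have hbs : Real.sqrt (1 - 2 * ε / (r - 1)) ^ 2 = 1 - 2 * ε / (r - 1) :=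
    Real.sq_sqrt (by linarith)
  refine ⟨ε, Real.sqrt (1 - 2 * ε / (r - 1)), hε0, hε2, Real.sqrt_pos.2 (by linarith), ?_, ?_⟩
  · rw [hbs]; field_simp
  · have hb := one_add_mul_le_pow (a := -(2 * ε / (r - 1))) (by linarith) m
    have e : (m : ℝ) * -(2 * ε / (r - 1)) = - (2 * k * ε) := by rw [hk]; field_simp
    rw [e] at hb
    have h2 : 1 < (Real.sqrt (1 - 2 * ε / (r - 1)) ^ m * (1 + ε)) ^ 2 := by
      rw [mul_pow, ← pow_mul, mul_comm m 2, pow_mul, hbs]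
      have h3 : 1 < (1 + -(2 * k * ε)) * (1 + ε) ^ 2 := by
        have h4 : k * ε ≤ 1 / 4 := by nlinarith
        have h5 : 0 ≤ ε ^ 2 * (1 - 2 * (k * ε)) := mul_nonneg (sq_nonneg _) (by linarith)
        have h6 : 0 < ε * (2 * (1 - k) - 4 * k * ε) := by
          apply mul_pos hε0; nlinarith
        nlinarith
      have h7 := mul_le_mul_of_nonneg_right hb (sq_nonneg (1 + ε))
      rw [← sub_eq_add_neg] at h7
      rw [← sub_eq_add_neg] at h7
      linarith [h3]
    by_contra hh
    push Not at hh
    have : 0 ≤ Real.sqrt (1 - 2 * ε / (r - 1)) ^ m * (1 + ε) := by positivity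
    nlinarith

abbrev Eu (d : ℕ) := EuclideanSpace ℝ (Fin d)

lemma john_radius (d : ℕ) (hd : 1 ≤ d)
    (Q : Set (EuclideanSpace ℝ (Fin d))) (hconv : Convex ℝ Q) (hclosed : IsClosed Q)
    (hball : closedBall (0 : EuclideanSpace ℝ (Fin d)) 1 ⊆ Q)
    (hjohn : ∀ f : EuclideanSpace ℝ (Fin d) ≃ᵃ[ℝ] EuclideanSpace ℝ (Fin d),
      f '' closedBall (0 : EuclideanSpace ℝ (Fin d)) 1 ⊆ Q →
      volume (f '' closedBall (0 : EuclideanSpace ℝ (Fin d)) 1) ≤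
        volume (closedBall (0 : EuclideanSpace ℝ (Fin d)) 1))
    (p : EuclideanSpace ℝ (Fin d)) (hp : p ∈ Q) : ‖p‖ ≤ d := by
  by_contra hcon
  push Not at hcon
  obtain ⟨m, rfl⟩ : ∃ m, d = m + 1 := ⟨d - 1, by omega⟩
  set r := ‖p‖ with hr
  push_cast at hcon
  have hm : (0 : ℝ) ≤ m := Nat.cast_nonneg m
  have hr1 : 1 < r := by linarith
  have hr0 : 0 < r := by linarith
  obtain ⟨ε, b, hε0, hε2, hb0, hb, hdet⟩ := exists_eps hcon
  set e : (Eu (m + 1)) := r⁻¹ • p with he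
  have hpe : p = r • e := by rw [he, smul_smul, mul_inv_cancel₀ hr0.ne', one_smul]
  have hen : ‖e‖ = 1 := by
    rw [he, norm_smul, norm_inv, Real.norm_of_nonneg hr0.le, ← hr, inv_mul_cancel₀ hr0.ne']
  have hee : inner ℝ e e = (1 : ℝ) := by rw [real_inner_self_eq_norm_sq, hen]; norm_num
  set c : ℝ := (1 + ε - b) / b with hc
  have hbc : b * c = 1 + ε - b := by rw [hc]; field_simp
  set A : (Eu (m + 1)) →ₗ[ℝ] (Eu (m + 1)) := b • LinearMap.transvection (innerₛₗ ℝ e) (c • e) with hA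
  have hAx : ∀ x, A x = b • x + ((1 + ε - b) * inner ℝ e x) • e := by
    intro x
    simp only [hA, LinearMap.smul_apply, LinearMap.transvection.apply, smul_add, smul_smul,
      innerₛₗ_apply_apply]
    congr 2
    rw [← hbc]; ring
  have hAdet : LinearMap.det A = b ^ m * (1 + ε) := by
    rw [hA, LinearMap.det_smul, LinearMap.transvection.det]
    simp only [finrank_euclideanSpace, Fintype.card_fin, map_smul, innerₛₗ_apply_apply, hee,
      smul_eq_mul, mul_one]
    rw [pow_succ]; linear_combination b ^ m * hbc
  have hAne : LinearMap.det A ≠ 0 := by rw [hAdet]; linarith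
  set L : (Eu (m + 1)) ≃ₗ[ℝ] (Eu (m + 1)) := A.equivOfDetNeZero hAne
  have hLA : ∀ x, L x = A x := fun x => rfl
  set f : (Eu (m + 1)) ≃ᵃ[ℝ] (Eu (m + 1)) := L.toAffineEquiv.trans (AffineEquiv.constVAdd ℝ (Eu (m + 1)) (ε • e)) with hf
  have hfx : ∀ x, f x = ε • e + A x := fun x => by
    simp [hf, hLA]
  have hsub : f '' closedBall (0 : (Eu (m + 1))) 1 ⊆ Q := by
    rintro _ ⟨u, hu, rfl⟩
    by_contra hnot
    obtain ⟨φ, M, h1, h2⟩ := geometric_hahn_banach_closed_point hconv hclosed hnot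
    set θ : (Eu (m + 1)) := (InnerProductSpace.toDual ℝ (Eu (m + 1))).symm φ with hθ
    have hφ : ∀ x, φ x = inner ℝ θ x := fun x => by
      rw [hθ, InnerProductSpace.toDual_symm_apply]
    have hun : ‖u‖ ≤ 1 := by simpa using hu
    have hs : |inner ℝ e θ| ≤ ‖θ‖ := by
      simpa [hen] using abs_real_inner_le_norm e θ
    have hM2 : r * inner ℝ e θ ≤ M := by
      have := h1 p hp
      rw [hφ, hpe, real_inner_smul_right, real_inner_comm] at this
      exact this.le
    have hM1 : ‖θ‖ ≤ M := by
      have h3 : ‖θ‖⁻¹ • θ ∈ Q := by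
        apply hball
        simp only [mem_closedBall, dist_zero_right, norm_smul, norm_inv, norm_norm]
        exact inv_mul_le_one
      have := h1 _ h3
      rw [hφ, real_inner_smul_right, real_inner_self_eq_norm_sq] at this
      by_cases h0 : ‖θ‖ = 0
      · rw [h0] at this ⊢; simpa using this.le
      · have e2 : ‖θ‖⁻¹ * ‖θ‖ ^ 2 = ‖θ‖ := by field_simp
        rw [e2] at this; exact this.le
    have hX : ‖A θ‖ ^ 2 = (1 + ε) ^ 2 * (inner ℝ e θ) ^ 2 + b ^ 2 * (‖θ‖ ^ 2 - (inner ℝ e θ) ^ 2) := by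
      rw [hAx, ← real_inner_self_eq_norm_sq, ← real_inner_self_eq_norm_sq]
      simp only [inner_add_left, inner_add_right, real_inner_smul_left, real_inner_smul_right, hee,
        real_inner_comm e θ]
      ring
    have key := support_ineq hr1 hε0.le hε2 hb hs hM1 hM2 hX
    have h4 : φ (f u) = ε * inner ℝ e θ + inner ℝ (A θ) u := by
      rw [hφ, hfx, hAx, hAx]
      simp only [inner_add_left, inner_add_right, real_inner_smul_left, real_inner_smul_right]
      rw [real_inner_comm e θ]
      ring
    have h5 : inner ℝ (A θ) u ≤ ‖A θ‖ := by
      calc inner ℝ (A θ) u ≤ ‖A θ‖ * ‖u‖ := real_inner_le_norm _ _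
        _ ≤ ‖A θ‖ * 1 := by gcongr
        _ = _ := mul_one _
    linarith
  have hvol := hjohn f hsub
  have himg : f '' closedBall (0 : (Eu (m + 1))) 1 = (fun x => ε • e + x) '' (A '' closedBall (0 : (Eu (m + 1))) 1) := by
    rw [image_image]; exact image_congr fun x _ => hfx x
  rw [himg, image_add_left, measure_preimage_add, Measure.addHaar_image_linearMap, hAdet,
    abs_of_pos (by linarith)] at hvol
  have hpos : 0 < volume (closedBall (0 : Eu (m + 1)) 1) := measure_closedBall_pos _ _ one_pos
  have hfin : volume (closedBall (0 : Eu (m + 1)) 1) ≠ ⊤ := measure_closedBall_lt_top.ne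
  have h1 : (1 : ENNReal) < ENNReal.ofReal (b ^ m * (1 + ε)) := by
    rw [← ENNReal.ofReal_one]; exact (ENNReal.ofReal_lt_ofReal_iff (by linarith)).2 hdet
  have h2 := ENNReal.mul_lt_mul_left hpos.ne' hfin h1
  rw [one_mul] at h2
  exact absurd hvol (not_le.2 h2)

lemma exists_max_basis (d : ℕ) (S : Set (Eu d)) (hS : S.Finite)
    (hspan : Submodule.span ℝ S = ⊤) :
    ∃ v : Module.Basis (Fin d) ℝ (Eu d), (∀ i, v i ∈ S) ∧
      ∀ x ∈ S, ∀ i, |v.coord i x| ≤ 1 := by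
  classical
  obtain ⟨B, hBS, hBspan, hBli⟩ := exists_linearIndependent ℝ S
  have hBfin : B.Finite := hS.subset hBS
  have := hBfin.fintype
  have := hS.to_subtype
  let b1 : Module.Basis B ℝ (Eu d) := Module.Basis.mk hBli (by
    rw [Subtype.range_coe, hBspan, hspan])
  have hcard : Fintype.card B = Fintype.card (Fin d) := by
    rw [← Module.finrank_eq_card_basis b1]; simp [Eu]
  let b0 := b1.reindex (Fintype.equivOfCardEq hcard)
  have hb0 : ∀ i, b0 i ∈ S := fun i => by
    simp only [b0, b1, Module.Basis.reindex_apply, Module.Basis.mk_apply]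
    exact hBS (Subtype.coe_prop _)
  have : Nonempty (Fin d → S) := ⟨fun i => ⟨b0 i, hb0 i⟩⟩
  obtain ⟨g, hg⟩ := Finite.exists_max (fun g : Fin d → S => |b0.det (fun i => (g i : Eu d))|)
  set w : Fin d → Eu d := fun i => (g i : Eu d) with hw
  have hwdet : 1 ≤ |b0.det w| := by
    have := hg (fun i => ⟨b0 i, hb0 i⟩)
    simpa [Module.Basis.det_self] using this
  have hu : IsUnit (b0.det w) := by
    rw [isUnit_iff_ne_zero]; intro h; rw [h] at hwdet; norm_num at hwdet
  obtain ⟨hli, hsp⟩ := (Module.Basis.is_basis_iff_det b0).2 hu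
  refine ⟨Module.Basis.mk hli hsp.ge, fun i => by simp [hw], fun x hx i => ?_⟩
  have h1 := congrArg (fun φ => φ x) (Module.Basis.det_smul_mk_coord_eq_det_update b0 hli hsp.ge i)
  simp only [LinearMap.smul_apply, smul_eq_mul, MultilinearMap.toLinearMap_apply] at h1
  have h2 := hg (Function.update g i ⟨x, hx⟩)
  have h3 : (fun k => ((Function.update g i ⟨x, hx⟩ : Fin d → S) k : Eu d)) = Function.update w i x := by
    ext1 k
    by_cases hk : k = i
    · subst hk; simp
    · simp [hk, hw]
  rw [h3] at h2
  have h4 : |b0.det w| * |(Module.Basis.mk hli hsp.ge).coord i x| ≤ |b0.det w| := by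
    rw [← abs_mul, h1]; exact h2
  nlinarith [abs_nonneg ((Module.Basis.mk hli hsp.ge).coord i x)]

lemma exists_ray (d : ℕ) (S : Set (Eu d)) (hS : S.Finite)
    (hball : closedBall (0 : Eu d) 1 ⊆ convexHull ℝ S) (v : Eu d) (hv : v ≠ 0) :
    ∃ T : Finset (Eu d), (T : Set (Eu d)) ⊆ S ∧ T.card ≤ d ∧
      ∃ t : ℝ, 0 < t ∧ 1 ≤ t * ‖v‖ ∧ -(t • v) ∈ convexHull ℝ (T : Set (Eu d)) := by
  classical
  have hcomp : IsCompact (convexHull ℝ S) := hS.isCompact_convexHull ℝ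
  have hv0 : 0 < ‖v‖ := norm_pos_iff.2 hv
  have hcont : Continuous (fun t : ℝ => -(t • v)) := by fun_prop
  let K : Set ℝ := (fun t : ℝ => -(t • v)) ⁻¹' convexHull ℝ S
  have hKclosed : IsClosed K := hcomp.isClosed.preimage hcont
  obtain ⟨R, hR⟩ := hcomp.isBounded.exists_norm_le
  have hKcomp : IsCompact K := by
    apply Metric.isCompact_of_isClosed_isBounded hKclosed
    refine (Metric.isBounded_closedBall (x := (0 : ℝ)) (r := R / ‖v‖)).subset ?_
    intro t ht
    have := hR _ ht
    rw [norm_neg, norm_smul] at this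
    rw [mem_closedBall, dist_zero_right, le_div_iff₀ hv0]
    exact this
  have hK1 : ‖v‖⁻¹ ∈ K := by
    apply hball
    rw [mem_closedBall, dist_zero_right, norm_neg, norm_smul, norm_inv, norm_norm,
      inv_mul_cancel₀ hv0.ne']
  obtain ⟨t, htK, htmax⟩ := hKcomp.exists_isGreatest ⟨_, hK1⟩
  have ht1 : ‖v‖⁻¹ ≤ t := htmax hK1
  have ht0 : 0 < t := lt_of_lt_of_le (inv_pos.2 hv0) ht1
  have hnint : -(t • v) ∉ interior (convexHull ℝ S) := by
    intro hint
    have hnh : (fun t : ℝ => -(t • v)) ⁻¹' interior (convexHull ℝ S) ∈ nhds t :=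
      (isOpen_interior.preimage hcont).mem_nhds hint
    obtain ⟨δ, hδ, hsub⟩ := Metric.mem_nhds_iff.1 hnh
    have : t + δ / 2 ∈ K := by
      have h := hsub (show t + δ / 2 ∈ ball t δ by
        rw [mem_ball, Real.dist_eq, add_sub_cancel_left, abs_of_pos (by linarith)]; linarith)
      exact interior_subset (s := convexHull ℝ S) h
    have := htmax this
    linarith
  obtain ⟨ι, hι, z, w, hzS, hzai, hw0, hw1, hwz⟩ := eq_pos_convex_span_of_mem_convexHull htK
  have hcardle : Fintype.card ι ≤ d := by
    have h1 : Fintype.card ι ≤ d + 1 := by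
      have := hzai.card_le_finrank_succ
      have h2 := Submodule.finrank_le (vectorSpan ℝ (Set.range z))
      have h3 : Module.finrank ℝ (Eu d) = d := by simp [Eu]
      omega
    by_contra hlt
    have heq : Fintype.card ι = Module.finrank ℝ (Eu d) + 1 := by simp [Eu]; omega
    have htop := hzai.affineSpan_eq_top_iff_card_eq_finrank_add_one.2 heq
    let ab : AffineBasis ι ℝ (Eu d) := ⟨z, hzai, htop⟩
    apply hnint
    have hmono : interior (convexHull ℝ (Set.range ab)) ⊆ interior (convexHull ℝ S) :=
      interior_mono (convexHull_mono hzS)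
    apply hmono
    rw [AffineBasis.interior_convexHull]
    intro i
    have h5 : -(t • v) = Finset.univ.affineCombination ℝ ab w := by
      rw [Finset.affineCombination_eq_linear_combination _ _ _ hw1]; exact hwz.symm
    rw [h5, ab.coord_apply_combination_of_mem (Finset.mem_univ i) hw1]
    exact hw0 i
  refine ⟨Finset.univ.image z, ?_, ?_, t, ht0, ?_, ?_⟩
  · simpa using hzS
  · exact Finset.card_image_le.trans hcardle
  · rw [← inv_mul_cancel₀ hv0.ne']; gcongr
  · have : -(t • v) = ∑ i, w i • z i := hwz.symm
    rw [this]
    exact (convex_convexHull ℝ _).sum_mem (fun i _ => (hw0 i).le) hw1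
      (fun i _ => subset_convexHull ℝ _ (by simp))

lemma combo_mem {d : ℕ} {H : Set (Eu d)} (hH : Convex ℝ H) (h0 : (0 : Eu d) ∈ H)
    {z : Fin d → Eu d} (hz : ∀ i, z i ∈ H) {y : Eu d} (hy : y ∈ H)
    {α : Fin d → ℝ} (hα : ∀ i, 0 ≤ α i) {γ : ℝ} (hγ : 0 ≤ γ) (hsum : ∑ i, α i + γ ≤ 1) :
    ∑ i, α i • z i + γ • y ∈ H := by
  have := hH.sum_mem (t := Finset.univ) (ι := Option (Option (Fin d)))
    (w := fun o => o.elim (1 - (∑ i, α i + γ)) (fun o => o.elim γ α))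
    (z := fun o => o.elim 0 (fun o => o.elim y z)) ?_ ?_ ?_
  · simp only [Fintype.sum_option, Option.elim] at this
    rw [smul_zero, zero_add, add_comm] at this
    exact this
  · rintro (_ | _ | i) _
    · simpa using hsum
    · exact hγ
    · exact hα i
  · simp only [Fintype.sum_option, Option.elim]; ring
  · rintro (_ | _ | i) _
    · exact h0
    · exact hy
    · exact hz i

lemma coef_bound {d : ℕ} (hd : 1 ≤ d) (β : Fin d → ℝ) (hβ : ∀ i, |β i| ≤ 1) :
    ∃ m : ℝ, 0 ≤ m ∧ m ≤ 1 ∧ (∀ i, β i ≤ m) ∧ ∑ i, (m - β i) + m * (d : ℝ) ^ 2 ≤ 2 * (d : ℝ) ^ 2 := by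
  have : Nonempty (Fin d) := ⟨⟨0, hd⟩⟩
  have hd' : (1 : ℝ) ≤ d := by exact_mod_cast hd
  obtain ⟨j, hj⟩ := Finite.exists_max β
  rcases le_total (β j) 0 with h | h
  · refine ⟨0, le_rfl, zero_le_one, fun i => (hj i).trans h, ?_⟩
    have : ∑ i, (0 - β i) ≤ ∑ _i : Fin d, (1 : ℝ) :=
      Finset.sum_le_sum fun i _ => by linarith [(abs_le.1 (hβ i)).1]
    simp only [Finset.sum_const, Finset.card_univ, Fintype.card_fin, nsmul_eq_mul, mul_one] at this
    nlinarith
  · have hj1 := (abs_le.1 (hβ j)).2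
    refine ⟨β j, h, hj1, hj, ?_⟩
    have : ∑ i ∈ Finset.univ.erase j, (β j - β i) ≤ ∑ _i ∈ Finset.univ.erase j, (2 : ℝ) :=
      Finset.sum_le_sum fun i _ => by linarith [(abs_le.1 (hβ i)).1]
    rw [Finset.sum_const, Finset.card_erase_of_mem (Finset.mem_univ j), Finset.card_univ,
      Fintype.card_fin, nsmul_eq_mul, Nat.cast_sub hd, Nat.cast_one] at this
    rw [← Finset.add_sum_erase _ _ (Finset.mem_univ j)]
    nlinarith [sq_nonneg ((d : ℝ) - 1)]



/-- If `Q ⊆ ℝ^d` is a convex polytope in John's position (the closed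
Euclidean unit ball is contained in `Q` and every ellipsoid, i.e. image of the unit
ball under an invertible affine map, contained in `Q` has volume at most that of the
unit ball), then there are at most `2d` vertices of `Q` whose convex hull `Q'`
satisfies `Q ⊆ -2d² • Q'`. -/
theorem sparse_approx_john_position (d : ℕ) (hd : 1 ≤ d)
    (Q : Set (EuclideanSpace ℝ (Fin d)))
    (hQpoly : ∃ V : Finset (EuclideanSpace ℝ (Fin d)), Q = convexHull ℝ (V : Set (EuclideanSpace ℝ (Fin d))))
    (hball : closedBall (0 : EuclideanSpace ℝ (Fin d)) 1 ⊆ Q)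
    (hjohn : ∀ f : EuclideanSpace ℝ (Fin d) ≃ᵃ[ℝ] EuclideanSpace ℝ (Fin d),
      f '' closedBall (0 : EuclideanSpace ℝ (Fin d)) 1 ⊆ Q →
      volume (f '' closedBall (0 : EuclideanSpace ℝ (Fin d)) 1) ≤
        volume (closedBall (0 : EuclideanSpace ℝ (Fin d)) 1)) :
    ∃ W : Finset (EuclideanSpace ℝ (Fin d)),
      (W : Set (EuclideanSpace ℝ (Fin d))) ⊆ Set.extremePoints ℝ Q ∧
      W.card ≤ 2 * d ∧
      Q ⊆ (-(2 * (d : ℝ) ^ 2)) • convexHull ℝ (W : Set (EuclideanSpace ℝ (Fin d))) := by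
  classical
  obtain ⟨V0, hV0⟩ := hQpoly
  have hconv : Convex ℝ Q := by rw [hV0]; exact convex_convexHull ℝ _
  have hcomp : IsCompact Q := by rw [hV0]; exact V0.finite_toSet.isCompact_convexHull ℝ
  set S : Set (Eu d) := Set.extremePoints ℝ Q with hSdef
  have hSfin : S.Finite := by
    refine V0.finite_toSet.subset ?_
    rw [hSdef, hV0]; exact extremePoints_convexHull_subset
  have hQS : Q = convexHull ℝ S := by
    rw [← (hSfin.isCompact_convexHull ℝ).isClosed.closure_eq, hSdef,
      closure_convexHull_extremePoints hcomp hconv]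
  have hrad := john_radius d hd Q hconv hcomp.isClosed hball hjohn
  have hspan : Submodule.span ℝ S = ⊤ := by
    rw [eq_top_iff]
    have h1 : Q ⊆ Submodule.span ℝ S := by
      rw [hQS]
      exact convexHull_min Submodule.subset_span (Submodule.span ℝ S).convex
    intro x _
    by_cases hx : x = 0
    · rw [hx]; exact zero_mem _
    have hxn : ‖x‖ ≠ 0 := norm_ne_zero_iff.2 hx
    have h2 : ‖x‖⁻¹ • x ∈ Submodule.span ℝ S := by
      apply h1; apply hball
      rw [mem_closedBall, dist_zero_right, norm_smul, norm_inv, norm_norm, inv_mul_cancel₀ hxn]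
    have h3 := Submodule.smul_mem _ ‖x‖ h2
    rwa [smul_smul, mul_inv_cancel₀ hxn, one_smul] at h3
  obtain ⟨v, hvS, hvmax⟩ := exists_max_basis d S hSfin hspan
  have hcoord : ∀ x ∈ Q, ∀ i, |v.coord i x| ≤ 1 := by
    intro x hx i
    have hc : Convex ℝ ((v.coord i) ⁻¹' Set.Icc (-1 : ℝ) 1) :=
      (convex_Icc (-1 : ℝ) 1).linear_preimage _
    have hsub : convexHull ℝ S ⊆ (v.coord i) ⁻¹' Set.Icc (-1 : ℝ) 1 :=
      convexHull_min (fun y hy => abs_le.1 (hvmax y hy i)) hc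
    rw [hQS] at hx
    exact abs_le.2 (hsub hx)
  have hd' : (1 : ℝ) ≤ d := by exact_mod_cast hd
  set U : Eu d := ∑ i, v i with hU
  have hU0 : U ≠ 0 := by
    intro h
    have h1 := congrArg (v.coord ⟨0, hd⟩) h
    rw [hU, map_sum, map_zero] at h1
    simp [Finsupp.single_apply] at h1
  have hUn : ‖U‖ ≤ (d : ℝ) ^ 2 := by
    calc ‖U‖ ≤ ∑ i, ‖v i‖ := norm_sum_le _ _
      _ ≤ ∑ _i : Fin d, (d : ℝ) := Finset.sum_le_sum fun i _ => hrad _ (hvS i).1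
      _ = _ := by simp; ring
  obtain ⟨T, hTS, hTcard, t, ht0, ht1, hyT⟩ := exists_ray d S hSfin (hQS ▸ hball) U hU0
  refine ⟨Finset.univ.image v ∪ T, ?_, ?_, ?_⟩
  · intro x hx
    rw [Finset.mem_coe, Finset.mem_union, Finset.mem_image] at hx
    rcases hx with ⟨i, _, rfl⟩ | hx
    · exact hvS i
    · exact hTS hx
  · have h1 : (Finset.univ.image v).card ≤ d := Finset.card_image_le.trans (by simp)
    have := Finset.card_union_le (Finset.univ.image v) T
    omega
  · set H := convexHull ℝ ((Finset.univ.image v ∪ T : Finset (Eu d)) : Set (Eu d)) with hH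
    have hHc : Convex ℝ H := convex_convexHull ℝ _
    have hvH : ∀ i, v i ∈ H := fun i => subset_convexHull ℝ _ (by simp)
    have hyH : -(t • U) ∈ H := convexHull_mono (by simp) hyT
    have hUH : (d : ℝ)⁻¹ • U ∈ H := by
      rw [hU, Finset.smul_sum]
      refine hHc.sum_mem (fun i _ => by positivity) ?_ (fun i _ => hvH i)
      simp; field_simp
    have h0H : (0 : Eu d) ∈ H := by
      have hden : 0 < 1 + t * d := by positivity
      have := hHc hyH hUH (a := 1 / (1 + t * d)) (b := t * d / (1 + t * d)) (by positivity)
        (by positivity) (by field_simp)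
      convert this using 1
      rw [smul_neg, smul_smul, smul_smul, ← neg_smul, ← add_smul]
      rw [show -(1 / (1 + t * (d : ℝ)) * t) + t * d / (1 + t * d) * (d : ℝ)⁻¹ = 0 by
        field_simp; ring, zero_smul]
    intro x hx
    obtain ⟨m, hm0, hm1, hmβ, hmsum⟩ := coef_bound hd (fun i => v.coord i x) (hcoord x hx)
    have hD : 0 < 2 * (d : ℝ) ^ 2 := by positivity
    have htinv : 1 / t ≤ (d : ℝ) ^ 2 := by
      rw [div_le_iff₀ ht0]; nlinarith
    have hmem := combo_mem hHc h0H hvH hyH (α := fun i => (m - v.coord i x) / (2 * (d : ℝ) ^ 2))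
      (γ := m * (1 / t) / (2 * (d : ℝ) ^ 2))
      (fun i => div_nonneg (sub_nonneg.2 (hmβ i)) hD.le) (by positivity) (by
        rw [← Finset.sum_div, ← add_div, div_le_one hD]
        have := mul_le_mul_of_nonneg_left htinv hm0
        linarith)
    refine ⟨_, hmem, ?_⟩
    have hx' : x = ∑ i, v.coord i x • v i := (v.sum_repr x).symm
    simp only [smul_add, Finset.smul_sum, smul_smul, smul_neg]
    have e1 : ∀ i, -(2 * (d : ℝ) ^ 2) * ((m - v.coord i x) / (2 * (d : ℝ) ^ 2)) = v.coord i x - m := by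
      intro i; field_simp; ring
    have e2 : -(2 * (d : ℝ) ^ 2) * (m * (1 / t) / (2 * (d : ℝ) ^ 2)) * t = -m := by field_simp
    simp only [e1]
    rw [← mul_assoc] at *
    rw [e2, neg_smul, neg_neg]
    simp only [sub_smul, Finset.sum_sub_distrib]
    rw [← hx', ← Finset.smul_sum, ← hU]
    abel
end

section
/- There exists an absolute constant c > 0 with the following property. Let d ≥ 2 and let K₁, …, Kₙ be closed convex sets in ℝ^d whose intersection K = K₁ ∩ ⋯ ∩ Kₙ is a convex body (a compact convex set with nonempty interior). Then there exists a subset σ ⊆ {1,…,n} with |σ| ≤ 2d such that the intersection K_σ = ⋂_{i ∈ σ} K_i satisfies vol_d(K_σ) ≤ (c·d)^{3d/2} · vol_d(K). -/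
open Set MeasureTheory Pointwise
open scoped Matrix

theorem isCompact_convexHull_of_isCompact {E : Type*} [AddCommGroup E] [Module ℝ E]
    [TopologicalSpace E] [IsTopologicalAddGroup E] [ContinuousSMul ℝ E] [FiniteDimensional ℝ E]
    {X : Set E} (hX : IsCompact X) : IsCompact (convexHull ℝ X) := by
  rcases X.eq_empty_or_nonempty with rfl | ⟨x0, hx0⟩
  · simp
  let N := Module.finrank ℝ E + 1
  have hcomp : IsCompact ((stdSimplex ℝ (Fin N)) ×ˢ (Set.univ.pi fun _ : Fin N => X)) :=
    (isCompact_stdSimplex ℝ (Fin N)).prod (isCompact_univ_pi fun _ => hX)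
  have himg := hcomp.image (f := fun p : (Fin N → ℝ) × (Fin N → E) => ∑ i, p.1 i • p.2 i)
    (by fun_prop)
  convert himg using 1
  apply Set.Subset.antisymm
  · intro x hx
    obtain ⟨ι, _, z, w, hz, haff, hw, hw1, hx⟩ := eq_pos_convex_span_of_mem_convexHull hx
    have hcard : Fintype.card ι ≤ Fintype.card (Fin N) := by
      rw [Fintype.card_fin]
      exact haff.card_le_finrank_succ.trans (by
        simp only [N]; gcongr; exact Submodule.finrank_le _)
    obtain ⟨e⟩ := Function.Embedding.nonempty_of_card_le hcard
    refine ⟨(Function.extend e w 0, Function.extend e z (fun _ => x0)), ⟨⟨?_, ?_⟩, ?_⟩, ?_⟩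
    · intro j
      by_cases hj : ∃ i, e i = j
      · obtain ⟨i, rfl⟩ := hj
        simp only [e.injective.extend_apply]; exact (hw i).le
      · simp [Function.extend_apply' _ _ _ hj]
    · rw [← hw1]
      symm
      apply Finset.sum_of_injOn e (e.injective.injOn) (by simp)
      · intro j _ hj
        simp only [Finset.coe_univ, Set.image_univ, Set.mem_range] at hj
        simp [Function.extend_apply' _ _ _ hj]
      · intro i _; simp [e.injective.extend_apply]
    · intro j _
      by_cases hj : ∃ i, e i = j
      · obtain ⟨i, rfl⟩ := hj
        simp only [e.injective.extend_apply]; exact hz ⟨i, rfl⟩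
      · simp [Function.extend_apply' _ _ _ hj, hx0]
    · rw [← hx]
      symm
      apply Finset.sum_of_injOn e (e.injective.injOn) (by simp)
      · intro j _ hj
        simp only [Finset.coe_univ, Set.image_univ, Set.mem_range] at hj
        simp [Function.extend_apply' _ _ _ hj]
      · intro i _; simp [e.injective.extend_apply]
  · rintro x ⟨⟨w, z⟩, ⟨hw, hz⟩, rfl⟩
    exact mem_convexHull_of_exists_fintype w z hw.1 hw.2 (fun i => hz i trivial) rfl

/-- sub-convex conical Caratheodory -/
theorem sub_caratheodory {d : ℕ} {X : Set (Fin d → ℝ)} {z : Fin d → ℝ}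
    (hz : z ∈ convexHull ℝ X) :
    ∃ (t : Finset (Fin d → ℝ)) (a : (Fin d → ℝ) → ℝ), (t : Set (Fin d → ℝ)) ⊆ X ∧ t.card ≤ d ∧
      (∀ y ∈ t, 0 ≤ a y) ∧ ∑ y ∈ t, a y ≤ 1 ∧ ∑ y ∈ t, a y • y = z := by
  classical
  let P : ℕ → Prop := fun k => ∃ (t : Finset (Fin d → ℝ)) (a : (Fin d → ℝ) → ℝ),
    (t : Set (Fin d → ℝ)) ⊆ X ∧ t.card = k ∧
      (∀ y ∈ t, 0 ≤ a y) ∧ ∑ y ∈ t, a y ≤ 1 ∧ ∑ y ∈ t, a y • y = z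
  have hP : ∃ k, P k := by
    rw [convexHull_eq_union_convexHull_finite_subsets] at hz
    simp only [Set.mem_iUnion] at hz
    obtain ⟨t, htX, hz⟩ := hz
    rw [Finset.mem_convexHull'] at hz
    obtain ⟨w, h0, h1, h2⟩ := hz
    exact ⟨t.card, t, w, htX, rfl, h0, h1.le, h2⟩
  obtain ⟨t, a, htX, hcard, ha0, ha1, haz⟩ := Nat.find_spec hP
  refine ⟨t, a, htX, ?_, ha0, ha1, haz⟩
  by_contra hlt
  push Not at hlt
  have hdep : ∃ c : (Fin d → ℝ) → ℝ, ∑ y ∈ t, c y • y = 0 ∧ ∃ y ∈ t, c y ≠ 0 :=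
    Module.exists_nontrivial_relation_of_finrank_lt_card (by simpa using hlt)
  have hdep2 : ∃ c : (Fin d → ℝ) → ℝ, ∑ y ∈ t, c y • y = 0 ∧ 0 ≤ ∑ y ∈ t, c y ∧
      ∃ y ∈ t, 0 < c y := by
    obtain ⟨c, hc, y, hy, hcy⟩ := hdep
    have key : ∀ c : (Fin d → ℝ) → ℝ, (∃ y ∈ t, c y ≠ 0) → 0 ≤ ∑ y ∈ t, c y →
        ∃ y ∈ t, 0 < c y := by
      intro c ⟨y, hy, hcy⟩ hs
      by_contra hno
      push Not at hno
      have := (Finset.sum_eq_zero_iff_of_nonpos hno).1 (le_antisymm (Finset.sum_nonpos hno) hs)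
      exact hcy (this y hy)
    rcases le_total 0 (∑ y ∈ t, c y) with h | h
    · exact ⟨c, hc, h, key c ⟨y, hy, hcy⟩ h⟩
    · refine ⟨fun y => - c y, by simp [hc], by simpa using h, key _ ⟨y, hy, by simpa using hcy⟩ (by simpa using h)⟩
  obtain ⟨c, hc, hcs, y1, hy1, hcy1⟩ := hdep2
  obtain ⟨y0, hy0, hmin⟩ := Finset.exists_min_image (t.filter fun y => 0 < c y)
    (fun y => a y / c y) ⟨y1, by simp [hy1, hcy1]⟩
  simp only [Finset.mem_filter] at hy0 hmin
  set s := a y0 / c y0 with hs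
  have hs0 : 0 ≤ s := div_nonneg (ha0 _ hy0.1) hy0.2.le
  have hzero : a y0 - s * c y0 = 0 := by
    rw [hs, div_mul_cancel₀ _ hy0.2.ne']; ring
  have hsum : ∑ y ∈ t, (a y - s * c y) • y = z := by
    simp only [sub_smul, Finset.sum_sub_distrib, haz, mul_smul, ← Finset.smul_sum, hc]; simp
  have hsum1 : ∑ y ∈ t, (a y - s * c y) ≤ 1 := by
    simp only [Finset.sum_sub_distrib, ← Finset.mul_sum]
    nlinarith [mul_nonneg hs0 hcs]
  have hP' : P (t.card - 1) := by
    refine ⟨t.erase y0, fun y => a y - s * c y, ?_, Finset.card_erase_of_mem hy0.1, ?_, ?_, ?_⟩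
    · exact (Finset.coe_subset.2 (Finset.erase_subset _ _)).trans htX
    · intro y hy
      have hyt := Finset.mem_of_mem_erase hy
      rcases lt_or_ge 0 (c y) with h | h
      · have := hmin y ⟨hyt, h⟩
        rw [le_div_iff₀ h] at this
        linarith
      · have := mul_nonneg hs0 (neg_nonneg.2 h)
        have := ha0 y hyt
        linarith
    · rw [← Finset.sum_erase_add _ _ hy0.1, hzero] at hsum1
      simpa using hsum1
    · rw [← Finset.sum_erase_add _ _ hy0.1, hzero] at hsum
      simpa using hsum
  have hpos : 0 < t.card := Finset.card_pos.2 ⟨y0, hy0.1⟩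
  have := Nat.find_min' hP hP'
  omega

theorem exists_max_tuple {m : ℕ} {X : Set (Fin m → ℝ)} (hX : IsCompact X)
    (hspan : ∀ a : Fin m → ℝ, (∀ x ∈ X, x ⬝ᵥ a = 0) → a = 0) :
    ∃ v : Fin m → Fin m → ℝ, (∀ i, v i ∈ X) ∧ (Matrix.of v).det ≠ 0 ∧
      ∀ w : Fin m → Fin m → ℝ, (∀ i, w i ∈ X) → |(Matrix.of w).det| ≤ |(Matrix.of v).det| := by
  have hbasis : ∃ v : Fin m → Fin m → ℝ, (∀ i, v i ∈ X) ∧ (Matrix.of v).det ≠ 0 := by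
    have hs : Submodule.span ℝ X = ⊤ := by
      by_contra hne
      obtain ⟨f, hf0, hf⟩ := Submodule.exists_le_ker_of_lt_top _ (lt_top_iff_ne_top.2 hne)
      apply hf0
      have hfa : ∀ x, f x = x ⬝ᵥ (fun i => f (Pi.single i 1)) := by
        intro x
        conv_lhs => rw [pi_eq_sum_univ' x]
        simp [dotProduct]
      have := hspan (fun i => f (Pi.single i 1)) (fun x hx => by
        rw [← hfa]; exact hf (Submodule.subset_span hx))
      refine LinearMap.ext fun x => ?_
      rw [hfa, this]; simp
    obtain ⟨b, hbX, hb, hli⟩ := exists_linearIndependent ℝ X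
    have B : Module.Basis b ℝ (Fin m → ℝ) := Module.Basis.mk hli (by rw [Subtype.range_coe, hb, hs])
    have : Fintype b := FiniteDimensional.fintypeBasisIndex B
    have hc : Fintype.card b = m := by
      rw [← Module.finrank_eq_card_basis B]; simp
    let e : Fin m ≃ b := (Fintype.equivFinOfCardEq hc).symm
    refine ⟨fun i => (e i : Fin m → ℝ), fun i => hbX (e i).2, ?_⟩
    have hli2 : LinearIndependent ℝ (Matrix.of fun i => (e i : Fin m → ℝ)).row :=
      hli.comp e e.injective
    rw [Matrix.linearIndependent_rows_iff_isUnit, Matrix.isUnit_iff_isUnit_det] at hli2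
    exact hli2.ne_zero
  obtain ⟨v0, hv0, hd0⟩ := hbasis
  have hcomp : IsCompact (Set.univ.pi fun _ : Fin m => X) := isCompact_univ_pi fun _ => hX
  have hcont : Continuous fun v : Fin m → Fin m → ℝ => |(Matrix.of v).det| := by
    apply Continuous.abs
    apply Continuous.matrix_det
    exact continuous_id
  obtain ⟨v, hv, hmax⟩ := hcomp.exists_isMaxOn ⟨v0, fun i _ => hv0 i⟩ hcont.continuousOn
  refine ⟨v, fun i => hv i trivial, ?_, fun w hw => hmax (fun i _ => hw i)⟩
  have := hmax (a := v0) (fun i _ => hv0 i)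
  simp only [Set.mem_ofPred_eq] at this
  intro h
  rw [h, abs_zero] at this
  exact hd0 (abs_eq_zero.1 (le_antisymm this (abs_nonneg _)))

theorem max_tuple_coeff {m : ℕ} {X : Set (Fin m → ℝ)} {v : Fin m → Fin m → ℝ}
    (hv : ∀ i, v i ∈ X) (hdet : (Matrix.of v).det ≠ 0)
    (hmax : ∀ w : Fin m → Fin m → ℝ, (∀ i, w i ∈ X) → |(Matrix.of w).det| ≤ |(Matrix.of v).det|)
    {x : Fin m → ℝ} (hx : x ∈ X) : ∃ b : Fin m → ℝ, (∀ i, |b i| ≤ 1) ∧ x = ∑ i, b i • v i := by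
  set A := Matrix.of v with hA
  refine ⟨fun i => A.det⁻¹ * Aᵀ.cramer x i, ?_, ?_⟩
  · intro i
    rw [abs_mul, abs_inv, inv_mul_le_iff₀ (abs_pos.2 hdet), mul_one, Matrix.cramer_transpose_apply]
    have := hmax (Function.update v i x) (by
      intro j
      rcases eq_or_ne j i with rfl | h
      · simpa using hx
      · simpa [Function.update_of_ne h] using hv j)
    exact this
  · have h := Matrix.mulVec_cramer Aᵀ x
    rw [Matrix.det_transpose] at h
    have h2 : x = A.det⁻¹ • (A.det • x) := by rw [smul_smul, inv_mul_cancel₀ hdet, one_smul]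
    rw [← h] at h2
    conv_lhs => rw [h2]
    ext j
    simp only [Matrix.mulVec, dotProduct, Pi.smul_apply, Finset.sum_apply, smul_eq_mul,
      Finset.mul_sum, Matrix.transpose_apply, hA, Matrix.of_apply]
    apply Finset.sum_congr rfl
    intro i _
    ring
theorem eq_zero_of_dot_const {d : ℕ} {K : Set (Fin d → ℝ)} (hint : (interior K).Nonempty)
    {a : Fin d → ℝ} {r : ℝ} (h : ∀ x ∈ K, x ⬝ᵥ a = r) : a = 0 := by
  obtain ⟨p, hp⟩ := hint
  have hc : Filter.Tendsto (fun t : ℝ => p + t • a) (nhds 0) (nhds p) := by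
    have : Continuous (fun t : ℝ => p + t • a) := by fun_prop
    simpa using this.tendsto 0
  have hev := hc.eventually (isOpen_interior.mem_nhds hp)
  obtain ⟨e, he, hball⟩ := Metric.eventually_nhds_iff.1 hev
  have h1 := h _ (interior_subset (hball (y := e / 2) (by
    rw [Real.dist_eq, sub_zero, abs_of_pos (by positivity)]; linarith)))
  have h2 := h _ (interior_subset hp)
  rw [add_dotProduct, h2, smul_dotProduct] at h1
  have h3 : (e / 2) * (a ⬝ᵥ a) = 0 := by simpa using h1
  have h4 : a ⬝ᵥ a = 0 := by
    rcases mul_eq_zero.1 h3 with h | h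
    · linarith
    · exact h
  exact dotProduct_self_eq_zero.1 h4

theorem exists_center {d : ℕ} (hd : 0 < d) {K : Set (Fin d → ℝ)} (hK : IsCompact K)
    (hconv : Convex ℝ K) (hint : (interior K).Nonempty) :
    ∃ g : Fin d → ℝ, ∀ x ∈ K, g - (d : ℝ)⁻¹ • (x - g) ∈ K := by
  have hdR : (0 : ℝ) < d := by exact_mod_cast hd
  let f : (Fin d → ℝ) → (Fin (d + 1) → ℝ) := fun x => Matrix.vecCons 1 x
  have hf : Continuous f := by
    apply continuous_pi
    intro i
    refine Fin.cases ?_ (fun j => ?_) i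
    · simpa [f] using continuous_const
    · simpa [f] using continuous_apply j
  obtain ⟨v, hv, hdet, hmax⟩ := exists_max_tuple (hK.image hf) (by
    intro a ha
    have h1 : ∀ x ∈ K, x ⬝ᵥ (fun j => a j.succ) = - a 0 := by
      intro x hx
      have := ha _ ⟨x, hx, rfl⟩
      simp only [f, dotProduct, Fin.sum_univ_succ, Matrix.cons_val_zero, Matrix.cons_val_succ] at this
      simp only [dotProduct]
      linarith
    have h2 := eq_zero_of_dot_const hint h1
    obtain ⟨p, hp⟩ := hint
    have h3 := h1 p (interior_subset hp)
    rw [h2] at h3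
    ext i
    refine Fin.cases ?_ (fun j => ?_) i
    · simpa using h3
    · exact congrFun h2 j)
  choose y hyK hy using hv
  refine ⟨((d : ℝ) + 1)⁻¹ • ∑ i, y i, ?_⟩
  intro x hx
  obtain ⟨b, hb, hxb⟩ := max_tuple_coeff (X := f '' K) (v := v) (fun i => ⟨y i, hyK i, hy i⟩) hdet hmax
    (x := f x) ⟨x, hx, rfl⟩
  have hb1 : ∑ i, b i = 1 := by
    have := congrFun hxb 0
    simp only [← hy] at this
    simpa [f, Finset.sum_apply] using this.symm
  have hbx : x = ∑ i, b i • y i := by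
    ext j
    have := congrFun hxb j.succ
    simp only [← hy] at this
    simpa [f, Finset.sum_apply] using this
  have key : ((d : ℝ) + 1)⁻¹ • ∑ i, y i - (d : ℝ)⁻¹ • (x - ((d : ℝ) + 1)⁻¹ • ∑ i, y i)
      = ∑ i, ((d : ℝ)⁻¹ * (1 - b i)) • y i := by
    rw [hbx]
    simp only [mul_smul, sub_smul, one_smul, ← Finset.smul_sum, Finset.sum_sub_distrib]
    rw [smul_sub, smul_sub, smul_smul, sub_sub_eq_add_sub, ← add_smul]
    congr 2
    field_simp
  rw [key]
  apply hconv.sum_mem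
  · intro i _
    have := (abs_le.1 (hb i)).2
    have : 0 ≤ 1 - b i := by linarith
    positivity
  · rw [← Finset.mul_sum, Finset.sum_sub_distrib, hb1]
    simp
    field_simp
  · intro i _; exact hyK i

theorem det_sum_vecMulVec {d : ℕ} {ι : Type*} [Fintype ι] (w : ι → ℝ) (v : ι → Fin d → ℝ) :
    (d.factorial : ℝ) * (∑ i, w i • Matrix.vecMulVec (v i) (v i)).det =
      ∑ f : Fin d → ι, (∏ j, w (f j)) * (Matrix.of fun j => v (f j)).det ^ 2 := by
  classical
  have h1 : (∑ i, w i • Matrix.vecMulVec (v i) (v i)).det =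
      ∑ f : Fin d → ι, (∏ j, w (f j)) * ((∏ j, v (f j) j) * (Matrix.of fun j => v (f j)).det) := by
    have hrow : (∑ i, w i • Matrix.vecMulVec (v i) (v i)) =
        fun j => ∑ i, (w i * v i j) • v i := by
      ext j k
      simp [Matrix.sum_apply, Matrix.vecMulVec_apply, Finset.sum_apply, mul_assoc]
    rw [hrow]
    change Matrix.detRowAlternating (fun j => ∑ i, (w i * v i j) • v i) = _
    rw [← AlternatingMap.coe_multilinearMap, MultilinearMap.map_sum]
    apply Finset.sum_congr rfl
    intro f _
    rw [MultilinearMap.map_smul_univ, Finset.prod_mul_distrib, smul_eq_mul, mul_assoc]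
    rfl
  have h2 : ∀ s : Equiv.Perm (Fin d), (∑ i, w i • Matrix.vecMulVec (v i) (v i)).det =
      ∑ f : Fin d → ι, (∏ j, w (f j)) * (((Equiv.Perm.sign s : ℤ) : ℝ) * (∏ j, v (f (s j)) j)
        * (Matrix.of fun j => v (f j)).det) := by
    intro s
    rw [h1]
    rw [← Equiv.sum_comp (Equiv.arrowCongr s (Equiv.refl ι)).symm]
    apply Finset.sum_congr rfl
    intro f _
    have e1 : ∀ j, (Equiv.arrowCongr s (Equiv.refl ι)).symm f j = f (s j) := fun j => rfl
    simp only [e1]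
    rw [Equiv.prod_comp s (fun j => w (f j))]
    have e2 : (Matrix.of fun j => v (f (s j))) = (Matrix.of fun j => v (f j)).submatrix s id := by
      ext; rfl
    rw [e2, Matrix.det_permute]
    ring
  have h3 : (d.factorial : ℝ) * (∑ i, w i • Matrix.vecMulVec (v i) (v i)).det =
      ∑ s : Equiv.Perm (Fin d), (∑ i, w i • Matrix.vecMulVec (v i) (v i)).det := by
    simp [Fintype.card_perm]
  rw [h3, Finset.sum_congr rfl (fun s _ => h2 s), Finset.sum_comm]
  apply Finset.sum_congr rfl
  intro f _
  rw [← Finset.mul_sum, ← Finset.sum_mul, sq]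
  congr 2
  rw [Matrix.det_apply']
  rfl

theorem det_sum_vecMulVec_le {d : ℕ} {ι : Type*} [Fintype ι] (w : ι → ℝ) (v : ι → Fin d → ℝ)
    (hw : ∀ i, 0 ≤ w i) (hw1 : ∑ i, w i = 1) (D : ℝ)
    (hD : ∀ f : Fin d → ι, |(Matrix.of fun j => v (f j)).det| ≤ D) :
    (d.factorial : ℝ) * (∑ i, w i • Matrix.vecMulVec (v i) (v i)).det ≤ D ^ 2 := by
  classical
  rw [det_sum_vecMulVec]
  calc _ ≤ ∑ f : Fin d → ι, (∏ j, w (f j)) * D ^ 2 := by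
        apply Finset.sum_le_sum
        intro f _
        apply mul_le_mul_of_nonneg_left _ (Finset.prod_nonneg fun j _ => hw _)
        rw [← sq_abs]
        exact pow_le_pow_left₀ (abs_nonneg _) (hD f) 2
    _ = D ^ 2 := by
        rw [← Finset.sum_mul]
        have : ∑ f : Fin d → ι, ∏ j, w (f j) = ∏ j : Fin d, ∑ i, w i := by
          rw [Finset.prod_univ_sum]; simp
        rw [this, hw1]; simp

theorem le_of_bernoulli {d : ℕ} {q : ℝ} (h : ∀ s : ℝ, 0 < s → 1 + s * q ≤ (1 + s) ^ d) :
    q ≤ d := by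
  by_contra hlt
  push Not at hlt
  have hd0 : (0 : ℝ) ≤ d := Nat.cast_nonneg d
  have hq : 0 < q := by linarith
  set s := min 1 ((q - d) / (2 * (d + 1) * q)) with hs
  have hs0 : 0 < s := lt_min one_pos (by apply div_pos; linarith; positivity)
  have hs1 : s ≤ 1 := min_le_left _ _
  have hs2 : s * (2 * (d + 1) * q) ≤ q - d := by
    rw [← le_div_iff₀ (by positivity)]; exact min_le_right _ _
  have hb : 1 + (d : ℝ) * (-s) ≤ (1 + -s) ^ d := one_add_mul_le_pow (by linarith) d
  have h1 := h s hs0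
  have h2 : (1 + s) ^ d * (1 - d * s) ≤ 1 := by
    calc (1 + s) ^ d * (1 - d * s) ≤ (1 + s) ^ d * (1 + -s) ^ d := by
          apply mul_le_mul_of_nonneg_left _ (by positivity); linarith
      _ = (1 - s ^ 2) ^ d := by rw [← mul_pow]; ring_nf
      _ ≤ 1 := pow_le_one₀ (by nlinarith) (by nlinarith)
  have hds : 0 ≤ 1 - d * s := by
    have : d * s * q ≤ q := by nlinarith [mul_nonneg (mul_nonneg hd0 hs0.le) hq.le, mul_pos hs0 hq]
    nlinarith
  have h3 : (1 + s * q) * (1 - d * s) ≤ 1 := (mul_le_mul_of_nonneg_right h1 hds).trans h2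
  have h4 : s * (q - d - d * s * q) ≤ 0 := by nlinarith
  have h5 : 0 < q - d - d * s * q := by
    nlinarith [mul_nonneg (mul_nonneg hd0 hs0.le) hq.le, mul_pos hs0 hq]
  nlinarith [mul_pos hs0 h5]
open scoped MatrixOrder Matrix.Norms.L2Operator in
theorem exists_sq_factor {d : ℕ} {M : Matrix (Fin d) (Fin d) ℝ} (hM : M.PosSemidef) :
    ∃ C : Matrix (Fin d) (Fin d) ℝ, M = Cᵀ * C := by
  obtain ⟨y, hy⟩ := CStarAlgebra.nonneg_iff_eq_star_mul_self.mp hM.nonneg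
  refine ⟨y, ?_⟩
  rw [hy, Matrix.star_eq_conjTranspose, Matrix.conjTranspose_eq_transpose_of_trivial]

theorem exists_design {d : ℕ} (hd : 0 < d) {X : Set (Fin d → ℝ)} (hX : IsCompact X)
    {v : Fin d → Fin d → ℝ} (hv : ∀ i, v i ∈ X) (hdet : (Matrix.of v).det ≠ 0)
    (hmax : ∀ w : Fin d → Fin d → ℝ, (∀ i, w i ∈ X) → |(Matrix.of w).det| ≤ |(Matrix.of v).det|) :
    ∃ C : Matrix (Fin d) (Fin d) ℝ, C.det ≠ 0 ∧
      (d.factorial : ℝ) * C.det ^ 2 ≤ (Matrix.of v).det ^ 2 ∧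
      ∀ y : Fin d → ℝ, d * ((C *ᵥ y) ⬝ᵥ (C *ᵥ y)) ≤ 1 → ∀ x ∈ X, x ⬝ᵥ y ≤ 1 := by
  have hdR : (0 : ℝ) < d := by exact_mod_cast hd
  let g : (Fin d → ℝ) → Matrix (Fin d) (Fin d) ℝ := fun x => Matrix.vecMulVec x x
  have hg : Continuous g := by
    apply continuous_matrix
    intro i j
    simp only [g, Matrix.vecMulVec_apply]
    fun_prop
  have hcomp : IsCompact (convexHull ℝ (g '' X)) := isCompact_convexHull_of_isCompact (hX.image hg)
  have hmem0 : ∑ i, (d : ℝ)⁻¹ • g (v i) ∈ convexHull ℝ (g '' X) :=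
    mem_convexHull_of_exists_fintype (fun _ => (d : ℝ)⁻¹) (fun i => g (v i))
      (fun _ => by positivity) (by simp; field_simp) (fun i => ⟨v i, hv i, rfl⟩) rfl
  have hdet0 : 0 < (∑ i, (d : ℝ)⁻¹ • g (v i)).det := by
    have : ∑ i, (d : ℝ)⁻¹ • g (v i) = (d : ℝ)⁻¹ • ((Matrix.of v)ᵀ * Matrix.of v) := by
      ext j k
      simp [Matrix.sum_apply, g, Matrix.vecMulVec_apply, Matrix.mul_apply, Finset.mul_sum]
    rw [this, Matrix.det_smul, Matrix.det_mul, Matrix.det_transpose]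
    have := mul_self_pos.2 hdet
    positivity
  have hcont : Continuous fun M : Matrix (Fin d) (Fin d) ℝ => M.det :=
    Continuous.matrix_det continuous_id
  obtain ⟨M, hM, hMmax⟩ := hcomp.exists_isMaxOn ⟨_, hmem0⟩ hcont.continuousOn
  have hMmax' : ∀ N ∈ convexHull ℝ (g '' X), N.det ≤ M.det := fun N hN => hMmax hN
  have hMpos : 0 < M.det := hdet0.trans_le (hMmax' _ hmem0)
  obtain ⟨ι, _, w, z, hw0, hw1, hz, hMz⟩ := mem_convexHull_iff_exists_fintype.1 hM
  choose y hyX hy using hz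
  have hMy : M = ∑ i, w i • Matrix.vecMulVec (y i) (y i) := by
    rw [← hMz]; exact Finset.sum_congr rfl fun i _ => by rw [← hy]
  have hle := det_sum_vecMulVec_le w y hw0 hw1 |(Matrix.of v).det|
    (fun f => hmax (fun j => y (f j)) (fun j => hyX _))
  rw [← hMy, sq_abs] at hle
  have hPSD : M.PosSemidef := by
    rw [hMy]
    apply Matrix.posSemidef_sum
    intro i _
    apply Matrix.PosSemidef.smul _ (hw0 i)
    simpa using Matrix.posSemidef_vecMulVec_self_star (y i)
  obtain ⟨C, hC⟩ := exists_sq_factor hPSD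
  have hCdet : M.det = C.det ^ 2 := by rw [hC, Matrix.det_mul, Matrix.det_transpose, sq]
  have hC0 : C.det ≠ 0 := by
    intro h; rw [hCdet, h] at hMpos; simp at hMpos
  refine ⟨C, hC0, by rwa [← hCdet], ?_⟩
  intro p hp x hx
  have hunit : IsUnit Cᵀ.det := by rw [Matrix.det_transpose]; exact hC0.isUnit
  set u := (Cᵀ)⁻¹ *ᵥ x with hu
  have hux : Cᵀ *ᵥ u = x := by
    rw [hu, Matrix.mulVec_mulVec, Matrix.mul_nonsing_inv _ hunit, Matrix.one_mulVec]
  have hq : u ⬝ᵥ u ≤ d := by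
    apply le_of_bernoulli
    intro s hs
    have hmem : (1 + s)⁻¹ • M + (s * (1 + s)⁻¹) • g x ∈ convexHull ℝ (g '' X) := by
      apply (convex_convexHull ℝ (g '' X)) hM (subset_convexHull ℝ _ ⟨x, hx, rfl⟩) (by positivity)
        (by positivity)
      field_simp
    have hle2 := hMmax' _ hmem
    have hfac : (1 + s)⁻¹ • M + (s * (1 + s)⁻¹) • g x =
        (1 + s)⁻¹ • (Cᵀ * (1 + Matrix.replicateCol Unit (s • u) * Matrix.replicateRow Unit u) * C) := by
      have hgx : g x = Cᵀ * Matrix.vecMulVec u u * C := by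
        rw [Matrix.mul_vecMulVec, Matrix.vecMulVec_mul, hux, ← Matrix.mulVec_transpose, hux]
      have : Matrix.replicateCol Unit (s • u) * Matrix.replicateRow Unit u
          = s • Matrix.vecMulVec u u := by
        rw [← Matrix.vecMulVec_eq, Matrix.smul_vecMulVec]
      rw [this, hgx, hC, Matrix.mul_add, Matrix.add_mul, Matrix.mul_one, Matrix.mul_smul,
        Matrix.smul_mul, smul_add, smul_smul, mul_comm s]
    rw [hfac, Matrix.det_smul, Matrix.det_mul, Matrix.det_mul, Matrix.det_transpose,
      Matrix.det_one_add_replicateCol_mul_replicateRow, hCdet, Fintype.card_fin, dotProduct_smul,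
      inv_pow, inv_mul_le_iff₀ (by positivity), smul_eq_mul] at hle2
    have hsq : 0 < C.det ^ 2 := by positivity
    have : (1 + s * (u ⬝ᵥ u)) * C.det ^ 2 ≤ (1 + s) ^ d * C.det ^ 2 := by linarith
    exact le_of_mul_le_mul_right this hsq
  have hdot : x ⬝ᵥ p = u ⬝ᵥ (C *ᵥ p) := by
    rw [← hux, Matrix.mulVec_transpose, Matrix.dotProduct_mulVec]
  have hCS : (u ⬝ᵥ (C *ᵥ p)) ^ 2 ≤ (u ⬝ᵥ u) * ((C *ᵥ p) ⬝ᵥ (C *ᵥ p)) := by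
    have := Finset.sum_mul_sq_le_sq_mul_sq Finset.univ u (C *ᵥ p)
    simpa [dotProduct, sq] using this
  have hnn : 0 ≤ (C *ᵥ p) ⬝ᵥ (C *ᵥ p) := by
    simp only [dotProduct]; exact Finset.sum_nonneg fun i _ => mul_self_nonneg _
  rw [hdot]
  have : (u ⬝ᵥ (C *ᵥ p)) ^ 2 ≤ 1 :=
    hCS.trans ((mul_le_mul_of_nonneg_right hq hnn).trans hp)
  nlinarith

theorem volume_ge {d : ℕ} (hd : 0 < d) (C : Matrix (Fin d) (Fin d) ℝ) (hC : C.det ≠ 0)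
    {K : Set (Fin d → ℝ)} (hK : ∀ y : Fin d → ℝ, d * ((C *ᵥ y) ⬝ᵥ (C *ᵥ y)) ≤ 1 → y ∈ K) :
    ENNReal.ofReal ((2 / d) ^ d * |C.det|⁻¹) ≤ volume K := by
  have hdR : (0 : ℝ) < d := by exact_mod_cast hd
  have hsub : (Matrix.toLin' C) ⁻¹' (Set.Icc (fun _ => -(1 / d : ℝ)) (fun _ => (1 / d : ℝ))) ⊆ K := by
    intro y hy
    apply hK
    simp only [Set.mem_preimage, Matrix.toLin'_apply, Set.mem_Icc, Pi.le_def] at hy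
    calc d * ((C *ᵥ y) ⬝ᵥ (C *ᵥ y)) ≤ d * ∑ i : Fin d, (1 / d : ℝ) ^ 2 := by
          apply mul_le_mul_of_nonneg_left _ hdR.le
          simp only [dotProduct]
          apply Finset.sum_le_sum
          intro i _
          have h1 := hy.1 i
          have h2 := hy.2 i
          nlinarith
      _ = 1 := by simp; field_simp
  refine le_trans (le_of_eq ?_) (measure_mono hsub)
  rw [Measure.addHaar_preimage_linearMap _ (by rwa [LinearMap.det_toLin']), LinearMap.det_toLin',
    Real.volume_Icc_pi, abs_inv, mul_comm ((2 / d : ℝ) ^ d), ENNReal.ofReal_mul (by positivity)]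
  congr 1
  simp only [Finset.prod_const, Finset.card_univ, Fintype.card_fin]
  rw [ENNReal.ofReal_pow (by positivity)]
  congr 2
  ring

theorem volume_le {d : ℕ} (hd : 0 < d) (V : Matrix (Fin d) (Fin d) ℝ) (hV : V.det ≠ 0) {r : ℝ}
    (hr : 0 ≤ r) {K : Set (Fin d → ℝ)} (hK : ∀ y ∈ K, ∑ i, |(V *ᵥ y) i| ≤ r) :
    volume K ≤ ENNReal.ofReal (r ^ d * (2 ^ d / d.factorial) * |V.det|⁻¹) := by
  have : Nonempty (Fin d) := ⟨⟨0, hd⟩⟩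
  have hsub : K ⊆ (Matrix.toLin' V) ⁻¹' {x : Fin d → ℝ | (∑ i, |x i| ^ (1 : ℝ)) ^ (1 / (1 : ℝ)) ≤ r} := by
    intro y hy
    simpa using hK y hy
  refine (measure_mono hsub).trans (le_of_eq ?_)
  rw [Measure.addHaar_preimage_linearMap _ (by rwa [LinearMap.det_toLin']), LinearMap.det_toLin',
    volume_sum_rpow_le (Fin d) (p := 1) (le_refl (1 : ℝ)) r, abs_inv, mul_comm _ |V.det|⁻¹, ENNReal.ofReal_mul (by positivity),
    ENNReal.ofReal_mul (by positivity), ENNReal.ofReal_pow hr]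
  simp only [Fintype.card_fin, div_one]
  rw [Real.Gamma_nat_eq_factorial]
  norm_num

theorem pow_le_factorial_mul (d : ℕ) : (d : ℝ) ^ d ≤ d.factorial * Real.exp d := by
  have := Real.pow_div_factorial_le_exp (d : ℝ) (Nat.cast_nonneg d) d
  rw [div_le_iff₀ (by positivity)] at this
  linarith

theorem final_bound {d : ℕ} (hd : 2 ≤ d) {D E : ℝ} (hD : 0 < D) (hE : 0 < E)
    (h : (d.factorial : ℝ) * E ^ 2 ≤ D ^ 2) :
    ((d : ℝ) * (d + 2)) ^ d * (2 ^ d / d.factorial) * D⁻¹ ≤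
      (8 * d) ^ ((3 * (d : ℝ)) / 2) * ((2 / d) ^ d * E⁻¹) := by
  have hdR : (0 : ℝ) < d := by positivity
  have hd2 : (2 : ℝ) ≤ d := by exact_mod_cast hd
  set F : ℝ := (d.factorial : ℝ) with hF
  have hFpos : 0 < F := by positivity
  -- square both sides
  have hsq : ((d * (d + 2) * d : ℝ) ^ d / F * E / D) ^ 2 ≤ ((8 * d : ℝ) ^ ((3 * (d : ℝ)) / 2)) ^ 2 := by
    have e1 : ((8 * d : ℝ) ^ ((3 * (d : ℝ)) / 2)) ^ 2 = ((8 * d : ℝ) ^ 3) ^ d := by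
      rw [← Real.rpow_natCast _ 2, ← Real.rpow_mul (by positivity), ← pow_mul, ← Real.rpow_natCast]
      congr 1
      push_cast; ring
    rw [e1]
    have hED : E ^ 2 / D ^ 2 ≤ 1 / F := by
      rw [div_le_div_iff₀ (by positivity) hFpos]; linarith
    have hdF : (d : ℝ) ^ d ≤ F * 3 ^ d := by
      refine (pow_le_factorial_mul d).trans ?_
      apply mul_le_mul_of_nonneg_left _ hFpos.le
      rw [← mul_one (d : ℝ), Real.exp_nat_mul]
      exact pow_le_pow_left₀ (Real.exp_pos 1).le (by linarith [Real.exp_one_lt_d9]) d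
    have hinv : 1 / F ≤ (3 / d) ^ d := by
      rw [div_pow, div_le_div_iff₀ hFpos (by positivity)]; linarith
    calc ((d * (d + 2) * d : ℝ) ^ d / F * E / D) ^ 2
        = ((d * (d + 2) * d : ℝ) ^ 2) ^ d * (1 / F) ^ 2 * (E ^ 2 / D ^ 2) := by
          rw [← pow_mul, mul_comm 2 d, pow_mul]; field_simp
      _ ≤ ((d * (2 * d) * d : ℝ) ^ 2) ^ d * ((3 / d) ^ d) ^ 2 * (3 / d) ^ d := by
          gcongr
          · linarith
          · exact hED.trans hinv
      _ = ((d * (2 * d) * d : ℝ) ^ 2 * (3 / d) ^ 3) ^ d := by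
          have hAB : ∀ A B : ℝ, A ^ d * (B ^ d) ^ 2 * B ^ d = (A * B ^ 3) ^ d := by
            intro A B; ring
          exact hAB _ _
      _ ≤ ((8 * d : ℝ) ^ 3) ^ d := by
          apply pow_le_pow_left₀ (by positivity)
          have : (d * (2 * d) * d : ℝ) ^ 2 * (3 / d) ^ 3 = 108 * d ^ 3 := by field_simp; norm_num
          rw [this, mul_pow]
          have : (0 : ℝ) < d ^ 3 := by positivity
          nlinarith
  have hle := (pow_le_pow_iff_left₀ (by positivity) (by positivity) two_ne_zero).1 hsq
  calc ((d : ℝ) * (d + 2)) ^ d * (2 ^ d / F) * D⁻¹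
      = ((d * (d + 2) * d : ℝ) ^ d / F * E / D) * ((2 / d) ^ d * E⁻¹) := by
        rw [mul_pow (d * (d + 2) : ℝ) d, div_pow]; field_simp
    _ ≤ _ := by gcongr

theorem core {d n : ℕ} (hd : 2 ≤ d) (K : Fin n → Set (Fin d → ℝ)) (hcl : ∀ i, IsClosed (K i))
    (hconv : ∀ i, Convex ℝ (K i)) (hcomp : IsCompact (⋂ i, K i)) (h0 : 0 ∈ interior (⋂ i, K i))
    (hsym : ∀ x ∈ ⋂ i, K i, -((d : ℝ)⁻¹ • x) ∈ ⋂ i, K i) :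
    ∃ σ : Finset (Fin n), σ.card ≤ 2 * d ∧
      volume (⋂ i ∈ σ, K i) ≤
        ENNReal.ofReal ((8 * d) ^ ((3 * (d : ℝ)) / 2)) * volume (⋂ i, K i) := by
  classical
  have hd0 : 0 < d := by omega
  have hdR : (0 : ℝ) < d := by exact_mod_cast hd0
  have h0K : ∀ i, (0 : Fin d → ℝ) ∈ K i := fun i => Set.mem_iInter.1 (interior_subset h0) i
  let Y : Fin n → Set (Fin d → ℝ) := fun i => {y | ∀ x ∈ K i, y ⬝ᵥ x ≤ 1}
  let X : Set (Fin d → ℝ) := ⋃ i, Y i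
  have hYcl : ∀ i, IsClosed (Y i) := by
    intro i
    have : Y i = ⋂ x ∈ K i, {y : Fin d → ℝ | y ⬝ᵥ x ≤ 1} := by ext; simp [Y]
    rw [this]
    refine isClosed_biInter fun x _ => isClosed_le ?_ continuous_const
    simp only [dotProduct]; fun_prop
  -- boundedness
  obtain ⟨e, he, hball⟩ := Metric.mem_nhds_iff.1 (mem_interior_iff_mem_nhds.1 h0)
  have hYb : ∀ i, Bornology.IsBounded (Y i) := by
    intro i
    rw [isBounded_iff_forall_norm_le]
    refine ⟨2 / e, fun y hy => ?_⟩
    rw [pi_norm_le_iff_of_nonneg (by positivity)]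
    intro j
    have key : ∀ s : ℝ, |s| < e → y j * s ≤ 1 := by
      intro s hs
      have := hy (Pi.single j s) (Set.mem_iInter.1 (hball (by
        rw [mem_ball_zero_iff, Pi.norm_single]; exact hs)) i)
      simpa using this
    have k1 := key (e / 2) (by rw [abs_of_pos (by positivity)]; linarith)
    have k2 := key (-(e / 2)) (by rw [abs_neg, abs_of_pos (by positivity)]; linarith)
    rw [Real.norm_eq_abs, abs_le, ← neg_div, div_le_iff₀ he, le_div_iff₀ he]
    constructor <;> linarith
  have hX : IsCompact X := isCompact_iUnion fun i => Metric.isCompact_of_isClosed_isBounded (hYcl i) (hYb i)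
  have hrep : ∀ f : (Fin d → ℝ) →L[ℝ] ℝ, ∀ x, f x = (fun i => f (Pi.single i 1)) ⬝ᵥ x := by
    intro f x
    conv_lhs => rw [pi_eq_sum_univ' x]
    simp [dotProduct, mul_comm]
  -- bipolar
  have hbip : ∀ x, (∀ y ∈ X, y ⬝ᵥ x ≤ 1) → x ∈ ⋂ i, K i := by
    intro x hx
    rw [Set.mem_iInter]
    intro i
    by_contra hxi
    obtain ⟨f, s, hf1, hf2⟩ := geometric_hahn_banach_closed_point (hconv i) (hcl i) hxi
    have hs : 0 < s := by simpa using hf1 0 (h0K i)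
    have h1 : (s⁻¹ • (fun i => f (Pi.single i 1))) ∈ X := by
      refine Set.mem_iUnion.2 ⟨i, fun z hz => ?_⟩
      rw [smul_dotProduct, ← hrep, smul_eq_mul, inv_mul_le_iff₀ hs, mul_one]
      exact (hf1 z hz).le
    have h2 := hx _ h1
    rw [smul_dotProduct, ← hrep, smul_eq_mul, inv_mul_le_iff₀ hs, mul_one] at h2
    linarith
  have hpol : ∀ x ∈ ⋂ i, K i, ∀ y ∈ X, y ⬝ᵥ x ≤ 1 := by
    intro x hx y hy
    obtain ⟨i, hi⟩ := Set.mem_iUnion.1 hy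
    exact hi x (Set.mem_iInter.1 hx i)
  have hspan : ∀ a : Fin d → ℝ, (∀ x ∈ X, x ⬝ᵥ a = 0) → a = 0 := by
    intro a ha
    obtain ⟨R, hR⟩ := isBounded_iff_forall_norm_le.1 hcomp.isBounded
    by_contra hne
    have hna : 0 < ‖a‖ := norm_pos_iff.2 hne
    have := hR (((|R| + 1) / ‖a‖) • a) (hbip _ (fun y hy => by
      rw [dotProduct_smul, ha y hy]; simp))
    rw [norm_smul, Real.norm_eq_abs, abs_of_pos (by positivity), div_mul_cancel₀ _ hna.ne'] at this
    linarith [le_abs_self R]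
  obtain ⟨v, hv, hdet, hmax⟩ := exists_max_tuple hX hspan
  obtain ⟨C, hC0, hCle, hCK⟩ := exists_design hd0 hX hv hdet hmax
  -- the opposite point
  have hz : -(((d : ℝ) * d)⁻¹ • ∑ i, v i) ∈ convexHull ℝ X := by
    by_contra hnot
    obtain ⟨f, s, hf1, hf2⟩ := geometric_hahn_banach_closed_point (convex_convexHull ℝ X)
      (isCompact_convexHull_of_isCompact hX).isClosed hnot
    have hf1' : ∀ y ∈ X, f y < s := fun y hy => hf1 y (subset_convexHull ℝ X hy)
    have hs : 0 < s := by
      obtain ⟨i, _⟩ := Set.mem_iUnion.1 (hv ⟨0, hd0⟩)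
      have : (0 : Fin d → ℝ) ∈ X := Set.mem_iUnion.2 ⟨i, fun x _ => by simp⟩
      simpa using hf1' 0 this
    set x := s⁻¹ • (fun i => f (Pi.single i 1)) with hx
    have hfx : ∀ y, f y = s * (y ⬝ᵥ x) := by
      intro y
      rw [hx, dotProduct_smul, dotProduct_comm, ← hrep, smul_eq_mul, mul_inv_cancel_left₀ hs.ne']
    have hxK : x ∈ ⋂ i, K i := hbip x (fun y hy => by
      have := hf1' y hy
      rw [hfx] at this
      nlinarith)
    have h1 : ∀ i, -(v i ⬝ᵥ x) ≤ d := by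
      intro i
      have := hpol _ (hsym x hxK) (v i) (hv i)
      rw [dotProduct_neg, dotProduct_smul, smul_eq_mul, ← mul_neg, inv_mul_le_iff₀ hdR] at this
      linarith
    have h2 : -((∑ i, v i) ⬝ᵥ x) ≤ d * d := by
      rw [sum_dotProduct, ← Finset.sum_neg_distrib]
      refine (Finset.sum_le_sum fun i _ => h1 i).trans (by simp)
    rw [hfx, neg_dotProduct, smul_dotProduct, smul_eq_mul, ← mul_neg] at hf2
    have h3 : ((d : ℝ) * d)⁻¹ * -((∑ i, v i) ⬝ᵥ x) ≤ 1 := by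
      rw [inv_mul_le_iff₀ (by positivity)]; linarith
    nlinarith
  obtain ⟨t, a, htX, htc, ha0, ha1, haz⟩ := sub_caratheodory hz
  have hidx : ∀ y : Fin d → ℝ, y ∈ X → ∃ i, y ∈ Y i := fun y hy => Set.mem_iUnion.1 hy
  have : Nonempty (Fin n) := ⟨(Set.mem_iUnion.1 (hv ⟨0, hd0⟩)).choose⟩
  choose! idx hidx using hidx
  refine ⟨(Finset.univ.image fun j => idx (v j)) ∪ t.image idx, ?_, ?_⟩
  · refine (Finset.card_union_le _ _).trans ?_
    have h1 : (Finset.univ.image fun j => idx (v j)).card ≤ d :=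
      Finset.card_image_le.trans (by simp)
    have h2 : (t.image idx).card ≤ d := Finset.card_image_le.trans htc
    omega
  have hup := volume_le hd0 (Matrix.of v) hdet (r := d * (d + 2)) (by positivity)
    (K := ⋂ i ∈ (Finset.univ.image fun j => idx (v j)) ∪ t.image idx, K i) (by
      intro y hy
      simp only [Set.mem_iInter, Finset.mem_union, Finset.mem_image, Finset.mem_univ,
        true_and] at hy
      have hvy : ∀ j, v j ⬝ᵥ y ≤ 1 := fun j => hidx _ (hv j) y (hy _ (Or.inl ⟨j, rfl⟩))
      have hty : ∀ w ∈ t, w ⬝ᵥ y ≤ 1 := fun w hw => hidx _ (htX hw) y (hy _ (Or.inr ⟨w, hw, rfl⟩))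
      have h1 : -(((d : ℝ) * d)⁻¹ * ∑ j, v j ⬝ᵥ y) ≤ 1 := by
        have : -(((d : ℝ) * d)⁻¹ * ∑ j, v j ⬝ᵥ y) = ∑ w ∈ t, a w * (w ⬝ᵥ y) := by
          have := congrArg (· ⬝ᵥ y) haz
          simp only [sum_dotProduct, neg_dotProduct, smul_dotProduct, smul_eq_mul] at this
          exact this.symm
        rw [this]
        refine le_trans (Finset.sum_le_sum fun w hw => ?_) ha1
        nlinarith [ha0 w hw, hty w hw]
      have h2 : -∑ j, v j ⬝ᵥ y ≤ d * d := by
        rw [← mul_neg, inv_mul_le_iff₀ (by positivity)] at h1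
        linarith
      have h3 : ∀ j, |(Matrix.of v *ᵥ y) j| ≤ 2 - v j ⬝ᵥ y := by
        intro j
        change |v j ⬝ᵥ y| ≤ _
        rw [abs_le]
        constructor <;> linarith [hvy j]
      refine (Finset.sum_le_sum fun j _ => h3 j).trans ?_
      rw [Finset.sum_sub_distrib]
      simp only [Finset.sum_const, Finset.card_univ, Fintype.card_fin, nsmul_eq_mul]
      linarith)
  have hlow := volume_ge hd0 C hC0 (K := ⋂ i, K i) (fun y hy => hbip y (hCK y hy))
  refine hup.trans ?_
  refine le_trans ?_ (mul_le_mul_right hlow _)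
  rw [← ENNReal.ofReal_mul (by positivity)]
  apply ENNReal.ofReal_le_ofReal
  exact final_bound hd (abs_pos.2 hdet) (abs_pos.2 hC0) (by simpa using hCle)

theorem core_translate {d n : ℕ} (hd : 2 ≤ d) (K : Fin n → Set (Fin d → ℝ))
    (hcl : ∀ i, IsClosed (K i))
    (hconv : ∀ i, Convex ℝ (K i)) (hcomp : IsCompact (⋂ i, K i))
    (hint : (interior (⋂ i, K i)).Nonempty) :
    ∃ σ : Finset (Fin n), σ.card ≤ 2 * d ∧
      volume (⋂ i ∈ σ, K i) ≤
        ENNReal.ofReal ((8 * d) ^ ((3 * (d : ℝ)) / 2)) * volume (⋂ i, K i) := by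
  have hdR : (0 : ℝ) < d := by positivity
  have hconvK : Convex ℝ (⋂ i, K i) := convex_iInter hconv
  obtain ⟨g, hg⟩ := exists_center (by omega) hcomp hconvK hint
  let T : (Fin d → ℝ) ≃ₜ (Fin d → ℝ) := Homeomorph.addRight g
  have hT : ∀ x, T x = x + g := fun x => rfl
  have hpre : ⋂ i, T ⁻¹' K i = T ⁻¹' ⋂ i, K i := by rw [Set.preimage_iInter]
  have hgint : g ∈ interior (⋂ i, K i) := by
    obtain ⟨p, hp⟩ := hint
    have h1 := hg p (interior_subset hp)
    have h2 := hconvK.combo_interior_self_mem_interior hp h1 (a := 1 / (d + 1)) (b := d / (d + 1))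
      (by positivity) (by positivity) (by field_simp; ring)
    convert h2 using 1
    ext j
    simp
    field_simp
    ring
  obtain ⟨σ, hσ, hvol⟩ := core hd (fun i => T ⁻¹' K i) (fun i => (hcl i).preimage T.continuous)
    (fun i => by
      have := (hconv i).translate_preimage_left g
      exact this)
    (by rw [hpre]; exact T.isCompact_preimage.2 hcomp)
    (by rw [hpre, ← T.preimage_interior]; simpa [hT] using hgint)
    (by
      intro x hx
      rw [hpre, Set.mem_preimage, hT] at hx ⊢
      have := hg _ hx
      simpa [sub_eq_add_neg, add_comm] using this)
  refine ⟨σ, hσ, ?_⟩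
  have e1 : ⋂ i ∈ σ, T ⁻¹' K i = (fun x => x + g) ⁻¹' ⋂ i ∈ σ, K i := by
    simp only [Set.preimage_iInter]; rfl
  have e2 : ⋂ i, T ⁻¹' K i = (fun x => x + g) ⁻¹' ⋂ i, K i := hpre
  rw [e1, e2, measure_preimage_add_right, measure_preimage_add_right] at hvol
  exact hvol

/-- There is an absolute constant `c > 0` such that for every `d ≥ 2`
and every finite family of closed convex sets in `ℝ^d` whose intersection `K` is a
convex body, one may select at most `2d` of the sets so that the volume of their
intersection is at most `(c·d)^(3d/2) · vol(K)`. -/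
theorem quantitative_helly_volume :
    ∃ c : ℝ, 0 < c ∧
      ∀ (d n : ℕ), 2 ≤ d →
        ∀ K : Fin n → Set (EuclideanSpace ℝ (Fin d)),
          (∀ i, IsClosed (K i)) → (∀ i, Convex ℝ (K i)) →
          IsCompact (⋂ i, K i) → (interior (⋂ i, K i)).Nonempty →
          ∃ σ : Finset (Fin n), σ.card ≤ 2 * d ∧
            volume (⋂ i ∈ σ, K i) ≤
              ENNReal.ofReal ((c * d) ^ ((3 * (d : ℝ)) / 2)) * volume (⋂ i, K i) := by
  refine ⟨8, by norm_num, ?_⟩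
  intro d n hd K hcl hconv hcomp hint
  let T : (Fin d → ℝ) ≃L[ℝ] EuclideanSpace ℝ (Fin d) := (EuclideanSpace.equiv (Fin d) ℝ).symm
  have hmp : MeasurePreserving (T : (Fin d → ℝ) → EuclideanSpace ℝ (Fin d)) :=
    PiLp.volume_preserving_toLp (Fin d)
  have hme : MeasurableEmbedding (T : (Fin d → ℝ) → EuclideanSpace ℝ (Fin d)) :=
    T.toHomeomorph.measurableEmbedding
  have hpre : ⋂ i, T ⁻¹' K i = T ⁻¹' ⋂ i, K i := by rw [Set.preimage_iInter]
  obtain ⟨σ, hσ, hvol⟩ := core_translate hd (fun i => T ⁻¹' K i)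
    (fun i => (hcl i).preimage T.continuous)
    (fun i => (hconv i).linear_preimage T.toLinearEquiv.toLinearMap)
    (by rw [hpre]; exact T.toHomeomorph.isCompact_preimage.2 hcomp)
    (by
      rw [hpre]
      have := T.toHomeomorph.preimage_interior (⋂ i, K i)
      obtain ⟨p, hp⟩ := hint
      refine ⟨T.symm p, ?_⟩
      change T.symm p ∈ interior (T.toHomeomorph ⁻¹' ⋂ i, K i)
      rw [← this]
      change T (T.symm p) ∈ interior (⋂ i, K i)
      simpa using hp)
  refine ⟨σ, hσ, ?_⟩
  have e1 : ⋂ i ∈ σ, T ⁻¹' K i = T ⁻¹' ⋂ i ∈ σ, K i := by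
    simp only [Set.preimage_iInter]
  rw [e1, hpre, hmp.measure_preimage_emb hme, hmp.measure_preimage_emb hme] at hvol
  exact hvol
end

section
/- Let d ≥ 2 and let K₁, …, Kₙ be closed convex sets in ℝ^d whose intersection K = K₁ ∩ ⋯ ∩ Kₙ is a convex body. Then there exist a point z ∈ ℝ^d and a subset σ ⊆ {1,…,n} with |σ| ≤ 2d such that K_σ − z ⊆ −2d² · (K − z), where K_σ = ⋂_{i ∈ σ} K_i. -/
open Set MeasureTheory Pointwise

namespace QH

open Module

lemma exists_center {E : Type*} [NormedAddCommGroup E] [InnerProductSpace ℝ E]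
    [FiniteDimensional ℝ E] (d : ℕ) (hd : 0 < d) (hE : finrank ℝ E = d)
    (K : Set E) (hK : IsCompact K) (hc : Convex ℝ K) (hne : K.Nonempty) :
    ∃ z, ∀ x ∈ K, z - (1 / (d : ℝ)) • (x - z) ∈ K := by
  have hd' : (0 : ℝ) < d := by exact_mod_cast hd
  let g : E → E → E := fun x y => ((d : ℝ) / (d + 1)) • y + (1 / ((d : ℝ) + 1)) • x
  obtain ⟨z, hz⟩ : (⋂ x : K, (g x) '' K).Nonempty := by
    apply Convex.helly_theorem_compact' (𝕜 := ℝ)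
    · intro x
      have : g x '' K = (fun y => y + (1 / ((d : ℝ) + 1)) • (x : E)) '' (((d : ℝ) / (d + 1)) • K) := by
        rw [← image_smul, image_image]
      rw [this]
      have := (hc.smul ((d : ℝ) / (d + 1))).translate ((1 / ((d : ℝ) + 1)) • (x : E))
      simpa [add_comm] using this
    · intro x
      exact hK.image (by fun_prop)
    · intro I hI
      rw [hE] at hI
      obtain ⟨p, hp⟩ := hne
      -- average with padding by `p`
      let m : ℝ := (d : ℝ) + 1 - I.card
      have hm : 0 ≤ m := by
        have : (I.card : ℝ) ≤ d + 1 := by exact_mod_cast hI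
        simp only [m]; linarith
      refine ⟨(1 / ((d : ℝ) + 1)) • ((∑ x ∈ I, (x : E)) + m • p), ?_⟩
      simp only [mem_iInter]
      intro x hx
      classical
      refine ⟨(1 / (d : ℝ)) • ((∑ x ∈ I.erase x, (x : E)) + m • p), ?_, ?_⟩
      · have h1 : ((I.erase x).card : ℝ) = I.card - 1 := by
          rw [Finset.card_erase_of_mem hx, Nat.cast_sub (Finset.card_pos.2 ⟨x, hx⟩)]; simp
        have := (hc.sum_mem (t := Finset.insertNone (I.erase x)) (w := fun o : Option K => o.elim (m / d) (fun _ => 1 / (d : ℝ)))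
          (z := fun o : Option K => o.elim p (fun y => (y : E))) ?_ ?_ ?_)
        · convert this using 1
          rw [Finset.sum_insertNone]
          simp only [Option.elim]
          rw [smul_add, smul_smul, Finset.smul_sum, add_comm]
          congr 2; ring
        · rintro (_ | y) _
          · exact div_nonneg hm hd'.le
          · simp
        · rw [Finset.sum_insertNone]
          simp only [Option.elim, Finset.sum_const, nsmul_eq_mul, h1, m]
          field_simp; ring
        · rintro (_ | y) _
          · exact hp
          · exact y.2
      · simp only [g]
        rw [← Finset.add_sum_erase I _ hx, smul_smul]
        have : (d : ℝ) / (d + 1) * (1 / d) = 1 / (d + 1) := by field_simp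
        rw [this]; module
  refine ⟨z, fun x hx => ?_⟩
  obtain ⟨y, hy, hyz⟩ := mem_iInter.1 hz ⟨x, hx⟩
  convert hy using 1
  rw [← hyz]
  simp only [g]
  match_scalars <;> field_simp <;> ring

lemma bipolar {E : Type*} [NormedAddCommGroup E] [InnerProductSpace ℝ E]
    [FiniteDimensional ℝ E] (L : Set E) (hL : IsClosed L) (hc : Convex ℝ L) (h0 : (0 : E) ∈ L)
    (x : E) (h : ∀ u, (∀ y ∈ L, inner ℝ y u ≤ 1) → inner ℝ x u ≤ 1) : x ∈ L := by
  by_contra hx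
  obtain ⟨f, s, h1, h2⟩ := geometric_hahn_banach_closed_point hc hL hx
  have hs : 0 < s := by simpa using h1 0 h0
  have key : ∀ y, inner ℝ y (s⁻¹ • (InnerProductSpace.toDual ℝ E).symm f) = s⁻¹ * f y := by
    intro y
    rw [inner_smul_right, real_inner_comm, InnerProductSpace.toDual_symm_apply]
  have := h (s⁻¹ • (InnerProductSpace.toDual ℝ E).symm f) (fun y hy => by
    rw [key, inv_mul_le_one₀ hs]; exact (h1 y hy).le)
  rw [key, inv_mul_le_one₀ hs] at this
  linarith

lemma compact_join {E : Type*} [NormedAddCommGroup E] [InnerProductSpace ℝ E]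
    (s t : Set E) (hs : IsCompact s) (ht : IsCompact t) : IsCompact (convexJoin ℝ s t) := by
  have : convexJoin ℝ s t = (fun p : (E × E) × ℝ => (1 - p.2) • p.1.1 + p.2 • p.1.2) ''
      ((s ×ˢ t) ×ˢ Icc (0 : ℝ) 1) := by
    ext x
    simp only [mem_convexJoin, segment_eq_image, mem_image, Prod.exists, mem_prod]
    constructor
    · rintro ⟨a, ha, b, hb, c, hc, rfl⟩
      exact ⟨a, b, c, ⟨⟨ha, hb⟩, hc⟩, rfl⟩
    · rintro ⟨a, b, c, ⟨⟨ha, hb⟩, hc⟩, rfl⟩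
      exact ⟨a, ha, b, hb, c, hc, rfl⟩
  rw [this]
  exact ((hs.prod ht).prod isCompact_Icc).image (by fun_prop)

lemma compact_hull {E ι : Type*} [NormedAddCommGroup E] [InnerProductSpace ℝ E]
    (C : ι → Set E) (h : ∀ i, IsCompact (C i)) (hc : ∀ i, Convex ℝ (C i))
    (s : Finset ι) : IsCompact (convexHull ℝ (⋃ i ∈ s, C i)) := by
  classical
  induction s using Finset.induction_on with
  | empty => simp
  | insert a s ha ih =>
    rw [Finset.set_biUnion_insert]
    rcases (C a).eq_empty_or_nonempty with h1 | h1
    · simpa [h1] using ih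
    rcases (⋃ i ∈ s, C i).eq_empty_or_nonempty with h2 | h2
    · rw [h2, union_empty, (hc a).convexHull_eq]; exact h a
    rw [convexHull_union h1 h2, (hc a).convexHull_eq]
    exact compact_join _ _ (h a) ih

lemma sparse {E : Type*} [NormedAddCommGroup E] [InnerProductSpace ℝ E]
    [FiniteDimensional ℝ E] (d : ℕ) (hd : 0 < d) (hE : finrank ℝ E = d)
    (W : Set E) (hW : IsCompact W) (hQ : IsCompact (convexHull ℝ W))
    (hspan : Submodule.span ℝ W = ⊤)
    (hsym : ∀ u ∈ convexHull ℝ W, (-(1 / (d : ℝ))) • u ∈ convexHull ℝ W) :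
    ∃ T : Finset E, T.card ≤ 2 * d ∧ (T : Set E) ⊆ W ∧
      ∀ x, (∀ t ∈ T, inner ℝ x t ≤ 1) → ∀ u ∈ W, -(inner ℝ x u) ≤ 2 * d + (d : ℝ) ^ 2 := by
  classical
  have hd' : (0 : ℝ) < d := by exact_mod_cast hd
  let b : Basis (Fin d) ℝ E := finBasisOfFinrankEq ℝ E hE
  have hcont : Continuous (fun v : Fin d → E => |b.det v|) := by
    refine continuous_abs.comp (g := fun t : ℝ => |t|) (f := fun v : Fin d → E => (b.toMatrix v).det) ?_
    apply Continuous.matrix_det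
    refine continuous_matrix (fun i j => ?_)
    simp only [Basis.toMatrix_apply]
    exact ((b.coord i).continuous_of_finiteDimensional).comp (continuous_apply j)
  -- a basis inside W
  obtain ⟨v0, hv0W, hv0⟩ : ∃ v : Fin d → E, (∀ i, v i ∈ W) ∧ b.det v ≠ 0 := by
    obtain ⟨s, hsW, hs1, hs2⟩ := exists_linearIndependent ℝ W
    rw [hspan] at hs1
    let b1 : Basis s ℝ E := Basis.mk hs2 (by simp [hs1])
    have : Finite s := Module.Finite.finite_basis b1
    have := Fintype.ofFinite s
    have hcard : Fintype.card s = d := by rw [← hE, finrank_eq_card_basis b1]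
    let e : s ≃ Fin d := Fintype.equivFinOfCardEq hcard
    refine ⟨b1.reindex e, fun i => ?_, (b.isUnit_det (b1.reindex e)).ne_zero⟩
    simp only [Basis.reindex_apply, b1, Basis.mk_apply]
    exact hsW (e.symm i).2
  obtain ⟨v, hvW, hvmax⟩ := (isCompact_univ_pi (fun _ : Fin d => hW)).exists_isMaxOn
    ⟨v0, fun i _ => hv0W i⟩ hcont.continuousOn
  have hvW' : ∀ i, v i ∈ W := fun i => hvW i (mem_univ i)
  have hdet : b.det v ≠ 0 := by
    have : |b.det v0| ≤ |b.det v| := hvmax (fun i _ => hv0W i)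
    intro h
    rw [h, abs_zero] at this
    exact hv0 (abs_eq_zero.1 (le_antisymm this (abs_nonneg _)))
  obtain ⟨hli, hsp⟩ := (Basis.is_basis_iff_det b).2 (isUnit_iff_ne_zero.2 hdet)
  let bv : Basis (Fin d) ℝ E := Basis.mk hli hsp.ge
  have hbv : ∀ i, bv i = v i := fun i => by simp [bv]
  have hcoef : ∀ u ∈ W, ∀ i, |bv.repr u i| ≤ 1 := by
    intro u hu i
    have h1 := congrArg (fun f => f u) (b.det_smul_mk_coord_eq_det_update hli hsp.ge i)
    have h2 : b.det v * bv.repr u i = b.det (Function.update v i u) := by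
      simpa [bv] using h1
    have h3 : |b.det (Function.update v i u)| ≤ |b.det v| := by
      apply hvmax
      intro j _
      by_cases hj : j = i
      · subst hj; simpa using hu
      · simpa [hj] using hvW' j
    rw [← h2, abs_mul] at h3
    have h4 : 0 < |b.det v| := abs_pos.2 hdet
    by_contra hcon
    push Not at hcon
    nlinarith
  set V : E := ∑ i, v i with hV
  have hV0 : V ≠ 0 := by
    intro h
    have := Fintype.linearIndependent_iff.1 hli (fun _ => 1) (by simpa [hV] using h) ⟨0, hd⟩
    simp at this
  have hVQ : (1 / (d : ℝ)) • V ∈ convexHull ℝ W := by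
    rw [hV, Finset.smul_sum]
    apply (convex_convexHull ℝ W).sum_mem
    · intros; positivity
    · simp [hd'.ne']
    · intro i _; exact subset_convexHull ℝ W (hvW' i)
  have hVQ2 := hsym _ hVQ
  -- maximal multiple
  let S : Set ℝ := {c | c • (-V) ∈ convexHull ℝ W}
  have hS : IsCompact S := by
    have : Topology.IsClosedEmbedding (fun c : ℝ => c • (-V)) :=
      isClosedEmbedding_smul_left (neg_ne_zero.2 hV0)
    exact this.isCompact_preimage hQ
  have hS1 : 1 / (d : ℝ) ^ 2 ∈ S := by
    simp only [S, mem_ofPred_eq]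
    convert hVQ2 using 1
    rw [smul_smul, smul_neg, ← neg_smul]
    congr 1; ring
  obtain ⟨c, hcS, hcmax⟩ := hS.exists_isMaxOn ⟨_, hS1⟩ continuousOn_id
  have hc1 : 1 / (d : ℝ) ^ 2 ≤ c := hcmax hS1
  have hc0 : 0 < c := lt_of_lt_of_le (by positivity) hc1
  obtain ⟨ι, _, z, w, hzW, hzind, hw, hw1, hwz⟩ := eq_pos_convex_span_of_mem_convexHull hcS
  have hcard : Fintype.card ι ≤ d := by
    have h1 := hzind.card_le_finrank_succ
    have h2 : Fintype.card ι ≤ d + 1 :=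
      h1.trans (by rw [← hE]; exact Nat.succ_le_succ (Submodule.finrank_le _))
    by_contra hcon
    have h3 : Fintype.card ι = finrank ℝ E + 1 := by omega
    have htop := (hzind.affineSpan_eq_top_iff_card_eq_finrank_add_one).2 h3
    let B : AffineBasis ι ℝ E := ⟨z, hzind, htop⟩
    have hBz : (B : ι → E) = z := rfl
    have hint : c • (-V) ∈ interior (convexHull ℝ W) := by
      apply interior_mono (convexHull_mono hzW)
      rw [← hBz, B.interior_convexHull]
      intro i
      have := B.coord_apply_combination_of_mem (Finset.mem_univ i) hw1
      rw [Finset.affineCombination_eq_linear_combination _ _ _ hw1, hBz, hwz] at this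
      rw [this]; exact hw i
    have hev : ∀ᶠ t in nhds c, t • (-V) ∈ interior (convexHull ℝ W) :=
      (by fun_prop : Continuous (fun t : ℝ => t • (-V))).continuousAt.eventually_mem
        (isOpen_interior.mem_nhds hint)
    obtain ⟨ε, hε, hball⟩ := Metric.eventually_nhds_iff.1 hev
    have h5 : (c + ε / 2) • (-V) ∈ convexHull ℝ W := interior_subset (hball (y := c + ε / 2) (by
      rw [Real.dist_eq, add_sub_cancel_left, abs_of_pos] <;> linarith))
    have : c + ε / 2 ≤ c := hcmax h5
    linarith
  refine ⟨Finset.univ.image v ∪ Finset.univ.image z, ?_, ?_, ?_⟩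
  · refine (Finset.card_union_le _ _).trans ?_
    have h1 : (Finset.univ.image v).card ≤ d := Finset.card_image_le.trans (by simp)
    have h2 : (Finset.univ.image z).card ≤ d := Finset.card_image_le.trans (by simpa using hcard)
    omega
  · intro t ht
    simp only [Finset.coe_union, Finset.coe_image, Finset.coe_univ, image_univ] at ht
    rcases ht with ⟨i, rfl⟩ | ht
    · exact hvW' i
    · exact hzW ht
  · intro x hx u hu
    have hxv : ∀ i, inner ℝ x (v i) ≤ 1 := fun i => hx _ (by simp)
    have hxz : ∀ i, inner ℝ x (z i) ≤ 1 := fun i => hx _ (by simp)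
    have h1 : inner ℝ x (c • (-V)) ≤ 1 := by
      rw [← hwz, inner_sum, ← hw1]
      apply Finset.sum_le_sum
      intro i _
      rw [inner_smul_right]
      nlinarith [hw i, hxz i]
    rw [inner_smul_right, inner_neg_right] at h1
    have h2 : -inner ℝ x V ≤ (d : ℝ) ^ 2 := by
      by_contra hcon
      push Not at hcon
      have h3 : 1 / (d : ℝ) ^ 2 * (d : ℝ) ^ 2 = 1 := by field_simp
      have h4 : (0 : ℝ) < (d : ℝ) ^ 2 := by positivity
      have h5 : c * (d : ℝ) ^ 2 < c * (-inner ℝ x V) := by gcongr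
      have h6 : 1 / (d : ℝ) ^ 2 * (d : ℝ) ^ 2 ≤ c * (d : ℝ) ^ 2 := by gcongr
      linarith
    have h3 : inner ℝ x u = ∑ i, bv.repr u i * inner ℝ x (v i) := by
      conv_lhs => rw [← bv.sum_repr u]
      rw [inner_sum]
      simp only [inner_smul_right, hbv]
    have h4 : inner ℝ x V = ∑ i, inner ℝ x (v i) := by rw [hV, inner_sum]
    have h5 : inner ℝ x V - inner ℝ x u ≤ 2 * d := by
      rw [h3, h4, ← Finset.sum_sub_distrib]
      calc _ ≤ ∑ i : Fin d, (2 : ℝ) := by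
            apply Finset.sum_le_sum
            intro i _
            have := abs_le.1 (hcoef u hu i)
            nlinarith [hxv i]
        _ = 2 * d := by simp [mul_comm]
    linarith

end QH

/-- For `d ≥ 2` and a finite family of closed convex sets in `ℝ^d`
whose intersection `K` is a convex body, there exist a point `z ∈ ℝ^d` and at most
`2d` of the sets such that their intersection `K_σ` satisfies
`K_σ - z ⊆ -2d² • (K - z)`. -/
theorem quantitative_helly_homothety (d n : ℕ) (hd : 2 ≤ d)
    (K : Fin n → Set (EuclideanSpace ℝ (Fin d)))
    (hclosed : ∀ i, IsClosed (K i)) (hconv : ∀ i, Convex ℝ (K i))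
    (hcompact : IsCompact (⋂ i, K i)) (hint : (interior (⋂ i, K i)).Nonempty) :
    ∃ (z : EuclideanSpace ℝ (Fin d)) (σ : Finset (Fin n)), σ.card ≤ 2 * d ∧
      (fun x => x - z) '' (⋂ i ∈ σ, K i) ⊆
        (-(2 * (d : ℝ) ^ 2)) • ((fun x => x - z) '' (⋂ i, K i)) := by
  classical
  have hd2 : (2 : ℝ) ≤ d := by exact_mod_cast hd
  have hd0 : (0 : ℝ) < d := by linarith
  have hfin : Module.finrank ℝ (EuclideanSpace ℝ (Fin d)) = d := by simp
  have hKc : Convex ℝ (⋂ i, K i) := convex_iInter hconv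
  obtain ⟨p, hp⟩ := hint
  obtain ⟨z, hz⟩ := QH.exists_center d (by omega) hfin _ hcompact hKc ⟨p, interior_subset hp⟩
  have hzint : z ∈ interior (⋂ i, K i) := by
    have h1 := hz p (interior_subset hp)
    have h2 := hKc.combo_interior_self_mem_interior hp h1 (a := 1 / ((d : ℝ) + 1))
      (b := d / ((d : ℝ) + 1)) (by positivity) (by positivity) (by field_simp; ring)
    convert h2 using 1
    match_scalars <;> field_simp <;> ring
  obtain ⟨r, hr, hball⟩ := Metric.isOpen_iff.1 isOpen_interior z hzint
  have hin : ∀ y : EuclideanSpace ℝ (Fin d), ‖y‖ < r → ∀ i, y + z ∈ K i := by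
    intro y hy i
    have : y + z ∈ Metric.ball z r := by simpa [Metric.mem_ball, dist_eq_norm] using hy
    exact mem_iInter.1 (interior_subset (hball this)) i
  let L : Fin n → Set (EuclideanSpace ℝ (Fin d)) := fun i => {y | y + z ∈ K i}
  have hL0 : ∀ i, (0 : EuclideanSpace ℝ (Fin d)) ∈ L i := fun i => hin 0 (by simpa using hr) i
  have hLcl : ∀ i, IsClosed (L i) := fun i => (hclosed i).preimage (by fun_prop)
  have hLcv : ∀ i, Convex ℝ (L i) := fun i => (hconv i).translate_preimage_left z
  let C : Fin n → Set (EuclideanSpace ℝ (Fin d)) := fun i => {u | ∀ y ∈ L i, inner ℝ y u ≤ 1}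
  have hCconv : ∀ i, Convex ℝ (C i) := by
    intro i u hu v hv a b ha hb hab y hy
    rw [inner_add_right, inner_smul_right, inner_smul_right]
    nlinarith [hu y hy, hv y hy]
  have hCcl : ∀ i, IsClosed (C i) := by
    intro i
    have : C i = ⋂ y ∈ L i, {u | inner ℝ y u ≤ 1} := by ext; simp [C]
    rw [this]
    exact isClosed_biInter (fun y _ => isClosed_le (by fun_prop) continuous_const)
  have hCb : ∀ i, C i ⊆ Metric.closedBall 0 (2 / r) := by
    intro i u hu
    rw [mem_closedBall_zero_iff]
    by_cases h0 : ‖u‖ = 0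
    · rw [h0]; positivity
    have hpos : 0 < ‖u‖ := lt_of_le_of_ne (norm_nonneg _) (Ne.symm h0)
    have h1 := hu ((r / 2 / ‖u‖) • u) (hin _ (by
      rw [norm_smul, Real.norm_of_nonneg (by positivity)]
      rw [div_mul_cancel₀ _ h0]; linarith) i)
    rw [real_inner_smul_left, real_inner_self_eq_norm_sq] at h1
    rw [le_div_iff₀ hr]
    have : r / 2 / ‖u‖ * ‖u‖ ^ 2 = r / 2 * ‖u‖ := by field_simp
    linarith
  have hCc : ∀ i, IsCompact (C i) := fun i =>
    (isCompact_closedBall _ _).of_isClosed_subset (hCcl i) (hCb i)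
  have hbip : ∀ i x, (∀ u ∈ C i, inner ℝ x u ≤ 1) → x ∈ L i := fun i x h =>
    QH.bipolar (L i) (hLcl i) (hLcv i) (hL0 i) x h
  set W : Set (EuclideanSpace ℝ (Fin d)) := ⋃ i, C i with hWdef
  have hWc : IsCompact W := isCompact_iUnion hCc
  have hQ : IsCompact (convexHull ℝ W) := by
    simpa [hWdef] using QH.compact_hull C hCc hCconv Finset.univ
  have hWL : ∀ x, (∀ u ∈ W, inner ℝ x u ≤ 1) → x + z ∈ ⋂ i, K i := fun x h =>
    mem_iInter.2 (fun i => hbip i x (fun u hu => h u (mem_iUnion.2 ⟨i, hu⟩)))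
  have hLW : ∀ x, x + z ∈ ⋂ i, K i → ∀ u ∈ convexHull ℝ W, inner ℝ x u ≤ 1 := by
    intro x hx u hu
    have : convexHull ℝ W ⊆ {u | inner ℝ x u ≤ 1} := by
      apply convexHull_min
      · intro w hw
        obtain ⟨i, hi⟩ := mem_iUnion.1 hw
        exact hi x (mem_iInter.1 hx i)
      · exact convex_halfSpace_le (𝕜 := ℝ) (f := fun u => inner ℝ x u)
          ⟨fun a b => inner_add_right _ _ _, fun a b => inner_smul_right _ _ _⟩ 1
    exact this hu
  have hspan : Submodule.span ℝ W = ⊤ := by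
    rw [← Submodule.orthogonal_eq_bot_iff, Submodule.eq_bot_iff]
    intro x hx
    by_contra hx0
    have horth : ∀ u ∈ W, inner ℝ x u = 0 := fun u hu =>
      Submodule.inner_left_of_mem_orthogonal (Submodule.subset_span hu) hx
    have hall : ∀ t : ℝ, t • x + z ∈ ⋂ i, K i := fun t => hWL _ (fun u hu => by
      rw [real_inner_smul_left, horth u hu]; simp)
    obtain ⟨R, hR⟩ := hcompact.isBounded.exists_norm_le
    have hxp : 0 < ‖x‖ := norm_pos_iff.2 hx0
    have h1 := hR _ (hall ((R + ‖z‖ + 1) / ‖x‖))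
    have hz1 := hR z (by simpa using hall 0)
    have hRz : 0 ≤ R := (norm_nonneg _).trans hz1
    have h2 : ‖((R + ‖z‖ + 1) / ‖x‖) • x‖ = R + ‖z‖ + 1 := by
      rw [norm_smul, Real.norm_of_nonneg (by positivity), div_mul_cancel₀ _ hxp.ne']
    have h3 := norm_sub_le (((R + ‖z‖ + 1) / ‖x‖) • x + z) z
    rw [add_sub_cancel_right, h2] at h3
    linarith
  have hsym : ∀ u ∈ convexHull ℝ W, (-(1 / (d : ℝ))) • u ∈ convexHull ℝ W := by
    intro u hu
    have h0 : (0 : EuclideanSpace ℝ (Fin d)) ∈ convexHull ℝ W := by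
      obtain ⟨w, hw⟩ := convexHull_nonempty_iff.1 ⟨u, hu⟩
      obtain ⟨i, hi⟩ := mem_iUnion.1 hw
      exact subset_convexHull ℝ W (mem_iUnion.2 ⟨i, fun y _ => by simp⟩)
    apply QH.bipolar _ hQ.isClosed (convex_convexHull ℝ W) h0
    intro x hx
    have h1 : x + z ∈ ⋂ i, K i := hWL x (fun w hw => by
      rw [real_inner_comm]; exact hx w (subset_convexHull ℝ W hw))
    have h2 := hz _ h1
    rw [add_sub_cancel_right] at h2
    have h3 := hLW (-((1 / (d : ℝ)) • x)) (by rwa [neg_add_eq_sub]) u hu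
    rw [inner_neg_left, real_inner_smul_left] at h3
    rw [real_inner_smul_left, real_inner_comm]
    linarith
  obtain ⟨T, hTcard, hTW, hT⟩ := QH.sparse d (by omega) hfin W hWc hQ hspan hsym
  have hidx : ∀ t : T, ∃ i, (t : EuclideanSpace ℝ (Fin d)) ∈ C i := fun t =>
    mem_iUnion.1 (hTW t.2)
  choose φ hφ using hidx
  refine ⟨z, Finset.univ.image φ, ?_, ?_⟩
  · exact Finset.card_image_le.trans (by simpa using hTcard)
  · rintro _ ⟨x, hx, rfl⟩
    simp only [mem_iInter] at hx
    have hxT : ∀ t ∈ T, inner ℝ (x - z) t ≤ 1 := by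
      intro t ht
      apply hφ ⟨t, ht⟩ (x - z)
      simp only [L, mem_ofPred_eq, sub_add_cancel]
      exact hx _ (Finset.mem_image_of_mem φ (Finset.mem_univ _))
    have hpos : (0 : ℝ) < 2 * (d : ℝ) ^ 2 := by positivity
    have hmem : (-(2 * (d : ℝ) ^ 2))⁻¹ • (x - z) + z ∈ ⋂ i, K i := by
      apply hWL
      intro u hu
      have h1 := hT _ hxT u hu
      rw [real_inner_smul_left, inv_neg, neg_mul, ← mul_neg, inv_mul_le_one₀ hpos]
      nlinarith
    refine mem_smul_set.2 ⟨_, ⟨_, hmem, rfl⟩, ?_⟩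
    simp only [add_sub_cancel_right]
    rw [smul_inv_smul₀ (by linarith)]
end

section
/- There exists an absolute constant c > 0 with the following property. Let d ≥ 2 and let K ⊂ ℝ^d be a convex polytope in John's position (the Euclidean unit ball B^d is the ellipsoid of maximal volume contained in K), written as the intersection of n closed halfspaces K₁, …, Kₙ. Then there exists σ ⊆ {1,…,n} with |σ| ≤ 2d such that K_σ = ⋂_{i ∈ σ} K_i satisfies both K_σ ⊆ −2d² · K and vol_d(K_σ) ≤ (c·d)^{3d/2} · vol_d(K). -/
open Set MeasureTheory Pointwise Metric RealInnerProductSpace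

open Matrix in
lemma qh_cauchy_binet {d n : ℕ} (c : Fin n → ℝ) (v : Fin n → Fin d → ℝ) :
    (d.factorial : ℝ) * (∑ i, c i • vecMulVec (v i) (v i)).det =
      ∑ f : Fin d → Fin n, (∏ j, c (f j)) * (Matrix.of fun j => v (f j)).det ^ 2 := by
  have h1 : (∑ i, c i • vecMulVec (v i) (v i)).det =
      ∑ f : Fin d → Fin n, (∏ j, c (f j)) * ((∏ j, v (f j) j) *
        (Matrix.of fun j => v (f j)).det) := by
    have : (∑ i, c i • vecMulVec (v i) (v i)) =
        (Matrix.of fun j => ∑ i : Fin n, (c i * v i j) • v i) := by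
      ext a b
      simp [Matrix.sum_apply, vecMulVec_apply, mul_assoc]
    rw [this]
    have h2 := (Matrix.detRowAlternating (n := Fin d) (R := ℝ)).toMultilinearMap.map_sum
      (fun (j : Fin d) (i : Fin n) => (c i * v i j) • v i)
    refine h2.trans (Finset.sum_congr rfl fun f _ => ?_)
    have h3 := (Matrix.detRowAlternating (n := Fin d) (R := ℝ)).toMultilinearMap.map_smul_univ
      (fun j => c (f j) * v (f j) j) (fun j => v (f j))
    refine h3.trans ?_
    rw [smul_eq_mul, Finset.prod_mul_distrib, mul_assoc]
    rfl
  have h4 : ∀ σ : Equiv.Perm (Fin d), (∑ i, c i • vecMulVec (v i) (v i)).det =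
      ∑ f : Fin d → Fin n, (∏ j, c (f j)) * (((Equiv.Perm.sign σ : ℤ) : ℝ) *
        (∏ j, v (f (σ j)) j) * (Matrix.of fun j => v (f j)).det) := by
    intro σ
    rw [h1, ← (Equiv.arrowCongr σ (Equiv.refl (Fin n))).symm.sum_comp]
    refine Finset.sum_congr rfl fun f _ => ?_
    have e1 : ∀ j, ((Equiv.arrowCongr σ (Equiv.refl (Fin n))).symm f) j = f (σ j) := fun j => rfl
    simp only [e1]
    rw [Equiv.prod_comp σ (fun j => c (f j))]
    have h5 := Matrix.det_permute σ (Matrix.of fun j => v (f j))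
    have h6 : (Matrix.of fun j => v (f (σ j))) = (Matrix.of fun j => v (f j)).submatrix σ id := rfl
    rw [h6, h5]
    ring
  have h7 : (d.factorial : ℝ) * (∑ i, c i • vecMulVec (v i) (v i)).det =
      ∑ σ : Equiv.Perm (Fin d), (∑ i, c i • vecMulVec (v i) (v i)).det := by
    simp [Fintype.card_perm]
  rw [h7, Finset.sum_congr rfl (fun σ _ => h4 σ), Finset.sum_comm]
  refine Finset.sum_congr rfl fun f _ => ?_
  rw [← Finset.mul_sum, ← Finset.sum_mul, sq]
  congr 2
  rw [Matrix.det_apply']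
  rfl

open Matrix in
lemma qh_det_rank_one {d : ℕ} (M : Matrix (Fin d) (Fin d) ℝ) (hM : M.det ≠ 0) (u w : Fin d → ℝ) :
    (M + vecMulVec u w).det = M.det * (1 + w ⬝ᵥ (M⁻¹ *ᵥ u)) := by
  rw [vecMulVec_eq Unit, det_add_replicateCol_mul_replicateRow (isUnit_iff_ne_zero.2 hM)]
  congr 1
  rw [Matrix.mul_assoc, det_unique]
  simp [Matrix.mul_apply, dotProduct, mulVec]

lemma qh_carath {d n : ℕ} (v : Fin n → Fin d → ℝ) (z : Fin d → ℝ) (τ : Finset (Fin n))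
    (μ : Fin n → ℝ) (h0 : ∀ i, 0 ≤ μ i) (h1 : ∑ i ∈ τ, μ i ≤ 1) (hz : z = ∑ i ∈ τ, μ i • v i) :
    ∃ (τ' : Finset (Fin n)) (ν : Fin n → ℝ), τ'.card ≤ d ∧ (∀ i, 0 ≤ ν i) ∧
      ∑ i ∈ τ', ν i ≤ 1 ∧ z = ∑ i ∈ τ', ν i • v i := by
  induction hk : τ.card using Nat.strong_induction_on generalizing τ μ with
  | _ k ih =>
  by_cases hd : τ.card ≤ d
  · exact ⟨τ, μ, hd, h0, h1, hz⟩
  push Not at hd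
  have hnl : ¬ LinearIndepOn ℝ v (τ : Set (Fin n)) := by
    intro hl
    have := hl.encard_le_toENat_rank
    simp at this
    omega
  rw [linearIndepOn_finset_iff] at hnl
  push Not at hnl
  obtain ⟨g0, hg0, i0, hi0, hgi0⟩ := hnl
  obtain ⟨g, hg, i1, hi1, hgi1, hgs⟩ : ∃ g : Fin n → ℝ, ∑ i ∈ τ, g i • v i = 0 ∧
      ∃ i ∈ τ, 0 < g i ∧ 0 ≤ ∑ i ∈ τ, g i := by
    have key : ∀ g : Fin n → ℝ, g i0 ≠ 0 → 0 ≤ ∑ i ∈ τ, g i → ∃ i ∈ τ, 0 < g i := by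
      intro g hgi hs
      by_contra! hcon
      have := (Finset.sum_eq_zero_iff_of_nonpos hcon).1
        (le_antisymm (Finset.sum_nonpos hcon) hs) i0 hi0
      exact hgi this
    rcases le_total 0 (∑ i ∈ τ, g0 i) with h | h
    · obtain ⟨i, hi, hp⟩ := key g0 hgi0 h
      exact ⟨g0, hg0, i, hi, hp, h⟩
    · have hs : 0 ≤ ∑ i ∈ τ, (-g0) i := by simpa using h
      obtain ⟨i, hi, hp⟩ := key (-g0) (by simpa using hgi0) hs
      exact ⟨-g0, by simp [hg0], i, hi, hp, hs⟩
  obtain ⟨j, hj, hmin⟩ := Finset.exists_min_image (τ.filter fun i => 0 < g i)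
    (fun i => μ i / g i) ⟨i1, by simp [hi1, hgi1]⟩
  simp only [Finset.mem_filter] at hj hmin
  set t := μ j / g j with ht
  have ht0 : 0 ≤ t := div_nonneg (h0 j) hj.2.le
  let μ' : Fin n → ℝ := fun i => if i ∈ τ then μ i - t * g i else 0
  have hμj : μ' j = 0 := by
    have : g j ≠ 0 := hj.2.ne'
    simp only [μ', hj.1, if_true, ht]
    field_simp
    simp
  have hsum : ∀ {i}, i ∈ τ → μ' i = μ i - t * g i := fun hi => by simp [μ', hi]
  refine ih (τ.erase j).card ?_ (τ.erase j) μ' ?_ ?_ ?_ rfl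
  · rw [← hk]; exact Finset.card_erase_lt_of_mem hj.1
  · intro i
    by_cases hi : i ∈ τ
    · rw [hsum hi]
      rcases le_or_gt (g i) 0 with hgi | hgi
      · nlinarith [h0 i]
      · have := hmin i ⟨hi, hgi⟩
        rw [le_div_iff₀ hgi] at this
        linarith
    · simp [μ', hi]
  · rw [Finset.sum_erase _ hμj, Finset.sum_congr rfl (fun i hi => hsum hi),
      Finset.sum_sub_distrib, ← Finset.mul_sum]
    nlinarith [mul_nonneg ht0 hgs]
  · rw [Finset.sum_erase _ (by simp [hμj]), hz,
      Finset.sum_congr rfl (fun i hi => by rw [hsum hi] : ∀ i ∈ τ, μ' i • v i = (μ i - t * g i) • v i)]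
    simp only [sub_smul, Finset.sum_sub_distrib, mul_smul]
    rw [← Finset.smul_sum, hg]
    simp

lemma qh_cs {d : ℕ} (w x : Fin d → ℝ) (r : ℝ) (hr : 0 ≤ r) (hw : w ⬝ᵥ w ≤ r ^ 2)
    (hx : x ⬝ᵥ x ≤ 1) : w ⬝ᵥ x ≤ r := by
  have h := Finset.sum_mul_sq_le_sq_mul_sq Finset.univ w x
  have h1 : (w ⬝ᵥ x) ^ 2 ≤ (w ⬝ᵥ w) * (x ⬝ᵥ x) := by
    simpa [dotProduct, sq] using h
  have h2 : 0 ≤ x ⬝ᵥ x := Finset.sum_nonneg fun i _ => mul_self_nonneg _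
  have h3 : 0 ≤ w ⬝ᵥ w := Finset.sum_nonneg fun i _ => mul_self_nonneg _
  nlinarith [abs_le_of_sq_le_sq' (show (w ⬝ᵥ x) ^ 2 ≤ r ^ 2 by nlinarith) hr]

/-- Matrix form of John's position. -/
def QHJohn {d n : ℕ} (v : Fin n → Fin d → ℝ) : Prop :=
  ∀ (A : Matrix (Fin d) (Fin d) ℝ) (a : Fin d → ℝ), A.det ≠ 0 →
    (∀ i, ∀ x : Fin d → ℝ, x ⬝ᵥ x ≤ 1 → v i ⬝ᵥ (A.mulVec x + a) ≤ 1) → |A.det| ≤ 1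

set_option maxHeartbeats 1000000 in
open Matrix in
lemma qh_bound {d n : ℕ} (hd : 2 ≤ d) (v : Fin n → Fin d → ℝ) (hv : ∀ i, v i ⬝ᵥ v i ≤ 1)
    (hJ : QHJohn v) (p : Fin d → ℝ) (hp : ∀ i, v i ⬝ᵥ p ≤ 1) : p ⬝ᵥ p ≤ (d : ℝ) ^ 2 := by
  by_contra! hcon
  have hd' : (2 : ℝ) ≤ d := by exact_mod_cast hd
  set R := Real.sqrt (p ⬝ᵥ p) with hR
  have hRR : R ^ 2 = p ⬝ᵥ p := Real.sq_sqrt (by nlinarith)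
  have hRd : (d : ℝ) < R := by
    rw [hR]; exact Real.lt_sqrt_of_sq_lt hcon
  have hR0 : 0 < R := by linarith
  set e : Fin d → ℝ := R⁻¹ • p with he
  have hee : e ⬝ᵥ e = 1 := by
    simp only [he, smul_dotProduct, dotProduct_smul, smul_eq_mul, ← hRR]
    field_simp
  set κ : ℝ := (d - 1) / (R - 1) with hκ
  have hκ1 : κ < 1 := by rw [hκ, div_lt_one (by linarith)]; linarith
  have hκ0 : 0 < κ := by rw [hκ]; apply div_pos <;> linarith
  set a : ℝ := (1 - κ) / 2 with ha
  have ha0 : 0 < a := by rw [ha]; linarith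
  have haR : 2 * a / (R - 1) < 1 := by rw [div_lt_one (by linarith)]; linarith
  have haR0 : 0 < 2 * a / (R - 1) := by apply div_pos <;> linarith
  set β : ℝ := Real.sqrt (1 - 2 * a / (R - 1)) with hβ
  have hββ : β ^ 2 = 1 - 2 * a / (R - 1) := Real.sq_sqrt (by linarith)
  have hβ0 : 0 < β := Real.sqrt_pos.2 (by linarith)
  set α : ℝ := 1 + a with hα
  set A : Matrix (Fin d) (Fin d) ℝ := β • (1 + vecMulVec (((α - β) / β) • e) e) with hA
  have hdet : A.det = β ^ d * (1 + (α - β) / β) := by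
    rw [hA, det_smul, qh_det_rank_one 1 (by simp)]
    simp [hee]
  obtain ⟨m, rfl⟩ : ∃ m, d = m + 1 := ⟨d - 1, by omega⟩
  have hdet2 : A.det = β ^ m * α := by
    rw [hdet, pow_succ]; field_simp; ring
  have hpos : 0 < A.det := by rw [hdet2]; positivity
  have hAx : ∀ w x : Fin (m + 1) → ℝ, w ⬝ᵥ (A *ᵥ x) = (β • w + ((α - β) * (w ⬝ᵥ e)) • e) ⬝ᵥ x := by
    intro w x
    simp only [hA, smul_mulVec, add_mulVec, one_mulVec, vecMulVec_mulVec, dotProduct_smul,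
      dotProduct_add, smul_dotProduct, add_dotProduct, smul_eq_mul,
      op_smul_eq_smul]
    field_simp
  have hle := hJ A (a • e) hpos.ne' ?_
  · rw [abs_of_pos hpos, hdet2] at hle
    have h1 : (β ^ m * α) ^ 2 ≤ 1 := by
      have : 0 ≤ β ^ m * α := by positivity
      nlinarith
    have h2 : 1 + (m : ℝ) * (-(2 * a / (R - 1))) ≤ (1 + (-(2 * a / (R - 1)))) ^ m :=
      one_add_mul_le_pow (by linarith) m
    have h3 : (β ^ m * α) ^ 2 = (1 + (-(2 * a / (R - 1)))) ^ m * (1 + a) ^ 2 := by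
      rw [mul_pow, ← pow_mul, mul_comm m 2, pow_mul, hββ, hα, sub_eq_add_neg]
    have h4 : (m : ℝ) * (-(2 * a / (R - 1))) = - (2 * a * κ) := by
      rw [hκ]; push_cast; ring
    rw [h4] at h2
    rw [h3] at h1
    have h5 : (1 + -(2 * a * κ)) * (1 + a) ^ 2 ≤ 1 :=
      (mul_le_mul_of_nonneg_right h2 (sq_nonneg _)).trans h1
    have h6 : 2 * a = 1 - κ := by rw [ha]; ring
    have h7 : 0 < 1 + -(2 * a * κ) := by nlinarith
    have h8 : (1 + -(2 * a * κ)) * (1 + 2 * a) ≤ 1 := by nlinarith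
    rw [h6] at h8
    nlinarith [mul_pos (sub_pos.2 hκ1) (sub_pos.2 hκ1)]
  · intro i x hx
    have hae : v i ⬝ᵥ (a • e) = a * (v i ⬝ᵥ e) := by rw [dotProduct_smul, smul_eq_mul]
    rw [dotProduct_add, hAx, hae]
    set s := v i ⬝ᵥ e with hs
    have hsR : s * R ≤ 1 := by
      have := hp i
      rw [hs, he, dotProduct_smul, smul_eq_mul]
      field_simp
      exact this
    have hs1 : s ≤ 1 / R := by rwa [le_div_iff₀ hR0]
    have hsm : -1 ≤ s := by
      have := qh_cs (-v i) e 1 zero_le_one (by simpa using hv i) hee.le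
      rw [neg_dotProduct] at this
      linarith
    have hs1' : s < 1 / 2 := by
      refine lt_of_le_of_lt hs1 ?_
      rw [div_lt_div_iff₀ hR0 two_pos]; linarith
    have has : 0 ≤ 1 - a * s := by
      have h9 : a * s ≤ a * (1 / 2) := mul_le_mul_of_nonneg_left hs1'.le ha0.le
      have h10 : a ≤ 1 / 2 := by rw [ha]; linarith
      linarith
    have hcs := qh_cs (β • v i + ((α - β) * s) • e) x (1 - a * s) has ?_ hx
    · linarith
    have hexp : (β • v i + ((α - β) * s) • e) ⬝ᵥ (β • v i + ((α - β) * s) • e)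
        = β ^ 2 * (v i ⬝ᵥ v i) + (α ^ 2 - β ^ 2) * s ^ 2 := by
      simp only [dotProduct_smul, dotProduct_add, smul_dotProduct, add_dotProduct, smul_eq_mul, hee,
        dotProduct_comm e (v i), ← hs]
      ring
    rw [hexp]
    have hb : β ^ 2 * (v i ⬝ᵥ v i) ≤ β ^ 2 := by nlinarith [hv i, sq_nonneg β]
    have hk : 2 * a * s ≤ (1 - β ^ 2) * (1 - s) := by
      rw [hββ]
      have : (1 - (1 - 2 * a / (R - 1))) * (1 - s) - 2 * a * s
          = 2 * a / (R - 1) * (1 - s * R) := by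
        have : R - 1 ≠ 0 := by linarith
        field_simp; ring
      nlinarith [mul_nonneg haR0.le (sub_nonneg.2 hsR)]
    rw [hα]
    nlinarith [mul_nonneg (by linarith : 0 ≤ 1 + s) (sub_nonneg.2 hk)]

lemma qh_span {d n : ℕ} (v : Fin n → Fin d → ℝ)
    (hb : ∀ p : Fin d → ℝ, (∀ i, v i ⬝ᵥ p ≤ 1) → p ⬝ᵥ p ≤ (d : ℝ) ^ 2)
    (x : Fin d → ℝ) (hx : ∀ i, v i ⬝ᵥ x ≤ 0) : x = 0 := by
  by_contra hne
  have hpos : 0 < x ⬝ᵥ x := by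
    refine lt_of_le_of_ne (Finset.sum_nonneg fun i _ => mul_self_nonneg _) (Ne.symm ?_)
    rwa [Ne, dotProduct_self_eq_zero]
  set q := x ⬝ᵥ x with hq
  set t : ℝ := (d + 1) * (1 + 1 / q) with ht
  have ht0 : 0 < t := by positivity
  have h := hb (t • x) (fun i => by
    rw [dotProduct_smul, smul_eq_mul]
    nlinarith [hx i])
  simp only [dotProduct_smul, smul_dotProduct, smul_eq_mul, ← hq] at h
  have h2 : t * (t * q) = (d + 1) ^ 2 * ((1 + 1 / q) * (q + 1)) := by
    rw [ht]; field_simp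
  rw [h2] at h
  have h3 : 1 ≤ (1 + 1 / q) * (q + 1) := by
    have : 0 < 1 / q := by positivity
    nlinarith
  nlinarith [sq_nonneg ((d : ℝ) + 1), Nat.cast_nonneg (α := ℝ) d]

open Matrix in
lemma qh_quad {d n : ℕ} (v : Fin n → Fin d → ℝ) (c : Fin n → ℝ) (x : Fin d → ℝ) :
    x ⬝ᵥ ((∑ i, c i • vecMulVec (v i) (v i)) *ᵥ x) = ∑ i, c i * (v i ⬝ᵥ x) ^ 2 := by
  rw [Matrix.sum_mulVec, dotProduct_sum]
  refine Finset.sum_congr rfl fun i _ => ?_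
  rw [smul_mulVec, vecMulVec_mulVec, dotProduct_smul, op_smul_eq_smul, dotProduct_smul,
    smul_eq_mul, smul_eq_mul, dotProduct_comm x]
  ring

open Matrix in
lemma qh_psd {d n : ℕ} (v : Fin n → Fin d → ℝ) (c : Fin n → ℝ) (hc : ∀ i, 0 ≤ c i) :
    (∑ i, c i • vecMulVec (v i) (v i)).PosSemidef := by
  refine Matrix.posSemidef_sum _ fun i _ => ?_
  refine Matrix.PosSemidef.smul ?_ (hc i)
  simpa using Matrix.posSemidef_vecMulVec_self_star (v i)

lemma qh_kw {m : ℕ} (hm : 1 ≤ m) (q : ℝ)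
    (h : ∀ t : ℝ, 0 ≤ t → t < 1 → (1 - t) ^ m * (1 - t + t * q) ≤ 1) : q ≤ m + 1 := by
  by_contra! hcon
  have hm' : (1 : ℝ) ≤ m := by exact_mod_cast hm
  set t : ℝ := (q - (m + 1)) / (2 * m * (q - 1)) with ht
  have hden : 0 < 2 * m * (q - 1) := by apply mul_pos <;> linarith
  have ht0 : 0 < t := div_pos (by linarith) hden
  have htm : t * (2 * m * (q - 1)) = q - (m + 1) := by
    rw [ht]; exact div_mul_cancel₀ _ hden.ne'
  have ht1 : t * m ≤ 1 / 2 := by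
    have : (t * m) * (q - 1) ≤ 1 / 2 * (q - 1) := by nlinarith
    exact le_of_mul_le_mul_right this (by linarith)
  have ht2 : t < 1 := by nlinarith
  have h1 := h t ht0.le ht2
  have h2 : 1 + (m : ℝ) * (-t) ≤ (1 + (-t)) ^ m := one_add_mul_le_pow (by linarith) m
  have h3 : (1 + (m : ℝ) * (-t)) * (1 - t + t * q) ≤ 1 := by
    refine le_trans (mul_le_mul_of_nonneg_right h2 ?_) h1
    nlinarith
  nlinarith

open Matrix in
set_option maxHeartbeats 1000000 in
lemma qh_dopt {d n : ℕ} (hd : 2 ≤ d) (v : Fin n → Fin d → ℝ)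
    (hb : ∀ p : Fin d → ℝ, (∀ i, v i ⬝ᵥ p ≤ 1) → p ⬝ᵥ p ≤ (d : ℝ) ^ 2)
    (hJ : QHJohn v) : ∃ c : Fin n → ℝ, (∀ i, 0 ≤ c i) ∧ ∑ i, c i = 1 ∧
      1 ≤ (d : ℝ) ^ d * (∑ i, c i • vecMulVec (v i) (v i)).det := by
  have hspan := qh_span v hb
  have hd' : (2 : ℝ) ≤ d := by exact_mod_cast hd
  have hn : 0 < n := by
    rcases Nat.eq_zero_or_pos n with rfl | h
    · exfalso
      have h1 := hspan (fun _ => 1) (fun i => i.elim0)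
      have := congrFun h1 ⟨0, by omega⟩
      simp at this
    · exact h
  have hn' : (0 : ℝ) < n := by exact_mod_cast hn
  set F : (Fin n → ℝ) → ℝ := fun c => (∑ i, c i • vecMulVec (v i) (v i)).det with hF
  have hFc : Continuous F := by
    rw [hF]
    refine Continuous.matrix_det ?_
    fun_prop
  have hu : (fun _ : Fin n => (1 / n : ℝ)) ∈ stdSimplex ℝ (Fin n) := by
    refine ⟨fun i => by positivity, ?_⟩
    simp [hn'.ne']
  obtain ⟨c, hc, hmax⟩ := (isCompact_stdSimplex ℝ (Fin n)).exists_isMaxOn ⟨_, hu⟩ hFc.continuousOn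
  have hupos : 0 < F (fun _ : Fin n => (1 / n : ℝ)) := by
    refine (Matrix.PosDef.of_dotProduct_mulVec_pos (qh_psd v _ hu.1).1 fun x hx => ?_).det_pos
    simp only [star_trivial]
    rw [qh_quad v (fun _ : Fin n => (1 / n : ℝ)) x]
    by_contra! hle
    have hz := (Finset.sum_eq_zero_iff_of_nonneg (fun i _ => by positivity)).1
      (le_antisymm hle (Finset.sum_nonneg fun i _ => by positivity))
    refine hx (hspan x fun i => ?_)
    have := hz i (Finset.mem_univ _)
    have h2 : (v i ⬝ᵥ x) ^ 2 = 0 := by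
      rcases mul_eq_zero.1 this with h | h
      · exfalso; have : (0 : ℝ) < 1 / n := by positivity
        exact this.ne' h
      · exact h
    exact (pow_eq_zero_iff two_ne_zero |>.1 h2).le
  have hdetpos : 0 < F c := lt_of_lt_of_le hupos (hmax hu)
  refine ⟨c, hc.1, hc.2, ?_⟩
  change 1 ≤ (d : ℝ) ^ d * F c
  set M := ∑ i, c i • vecMulVec (v i) (v i) with hM
  have hFM : F c = M.det := rfl
  rw [hFM] at hdetpos ⊢
  obtain ⟨m, rfl⟩ : ∃ m, d = m + 1 := ⟨d - 1, by omega⟩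
  have hq : ∀ j, v j ⬝ᵥ (M⁻¹ *ᵥ v j) ≤ m + 1 := by
    intro j
    refine qh_kw (by omega) _ fun t ht0 ht1 => ?_
    have hmem : (1 - t) • c + t • Pi.single j 1 ∈ stdSimplex ℝ (Fin n) :=
      (convex_stdSimplex ℝ (Fin n)) hc (single_mem_stdSimplex ℝ j) (by linarith) ht0 (by ring)
    have hle : F ((1 - t) • c + t • Pi.single j 1) ≤ M.det := hmax hmem
    have hMM : (∑ i, ((1 - t) • c + t • (Pi.single j 1 : Fin n → ℝ)) i • vecMulVec (v i) (v i)) =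
        (1 - t) • (M + vecMulVec ((t / (1 - t)) • v j) (v j)) := by
      have h1t : (1 - t) ≠ 0 := by linarith
      simp only [Pi.add_apply, Pi.smul_apply, smul_eq_mul, add_smul, Finset.sum_add_distrib, hM,
        smul_add, Finset.smul_sum, smul_smul, smul_vecMulVec]
      congr 1
      rw [Finset.sum_eq_single j]
      · simp; congr 1; field_simp
      · intro b _ hb; simp [hb]
      · simp
    have hFe : F ((1 - t) • c + t • Pi.single j 1) =
        (1 - t) ^ m * (1 - t + t * (v j ⬝ᵥ (M⁻¹ *ᵥ v j))) * M.det := by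
      simp only [hF]
      rw [hMM, det_smul, qh_det_rank_one M hdetpos.ne', mulVec_smul, dotProduct_smul,
        smul_eq_mul, Fintype.card_fin, pow_succ]
      have h1t : (1 - t) ≠ 0 := by linarith
      field_simp
    rw [hFe] at hle
    by_contra! hcon
    nlinarith
  obtain ⟨L, hL⟩ : ∃ L : Matrix (Fin (m+1)) (Fin (m+1)) ℝ, M = Lᵀ * L := by
    have := (qh_psd v c hc.1)
    open scoped MatrixOrder in
    obtain ⟨L, hL⟩ := CStarAlgebra.nonneg_iff_eq_star_mul_self.mp this.nonneg
    exact ⟨L, by rw [hM, hL, star_eq_conjTranspose, conjTranspose_eq_transpose_of_trivial]⟩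
  have hLdet : M.det = L.det ^ 2 := by rw [hL, det_mul, det_transpose, sq]
  have hL0 : L.det ≠ 0 := by
    intro h; rw [hLdet, h] at hdetpos; simp at hdetpos
  set r : ℝ := Real.sqrt ((m + 1 : ℕ) : ℝ) with hr
  have hr0 : 0 < r := Real.sqrt_pos.2 (by linarith)
  have hrr : r ^ 2 = ((m + 1 : ℕ) : ℝ) := Real.sq_sqrt (by linarith)
  have hAdet : (r⁻¹ • L⁻¹).det = r⁻¹ ^ (m + 1) * L.det⁻¹ := by
    rw [det_smul, det_nonsing_inv, Fintype.card_fin, Ring.inverse_eq_inv']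
  have h := hJ (r⁻¹ • L⁻¹) 0 (by rw [hAdet]; positivity) (fun i x hx => by
    rw [add_zero]
    have e1 : v i ⬝ᵥ ((r⁻¹ • L⁻¹) *ᵥ x) = (r⁻¹ • (v i ᵥ* L⁻¹)) ⬝ᵥ x := by
      rw [smul_mulVec, dotProduct_smul, dotProduct_mulVec, smul_dotProduct]
    rw [e1]
    refine qh_cs _ _ 1 zero_le_one ?_ hx
    have e2 : (v i ᵥ* L⁻¹) ⬝ᵥ (v i ᵥ* L⁻¹) = v i ⬝ᵥ (M⁻¹ *ᵥ v i) := by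
      rw [hL, Matrix.mul_inv_rev, ← mulVec_mulVec, dotProduct_mulVec, ← transpose_nonsing_inv,
        mulVec_transpose]
    rw [smul_dotProduct, dotProduct_smul, e2, smul_eq_mul, smul_eq_mul, ← mul_assoc, ← sq, inv_pow,
      hrr, inv_mul_le_iff₀ (by linarith)]
    have := hq i
    push_cast
    linarith)
  have hLp : 0 < |L.det| := abs_pos.2 hL0
  rw [hAdet, abs_mul, abs_inv, abs_of_pos (by positivity : 0 < r⁻¹ ^ (m+1)), inv_pow, ← mul_inv,
    inv_le_one₀ (by positivity)] at h
  have h2 : (r ^ (m + 1) * |L.det|) ^ 2 = ((m + 1 : ℕ) : ℝ) ^ (m + 1) * M.det := by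
    rw [mul_pow, ← pow_mul, mul_comm (m + 1) 2, pow_mul, hrr, sq_abs, hLdet]
  rw [← h2]
  exact one_le_pow₀ h

open Matrix in
lemma qh_maxdet {d n : ℕ} (hd : 2 ≤ d) (v : Fin n → Fin d → ℝ)
    (hb : ∀ p : Fin d → ℝ, (∀ i, v i ⬝ᵥ p ≤ 1) → p ⬝ᵥ p ≤ (d : ℝ) ^ 2)
    (hJ : QHJohn v) : ∃ f : Fin d → Fin n,
      (d.factorial : ℝ) ≤ (d : ℝ) ^ d * (Matrix.of fun j => v (f j)).det ^ 2 ∧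
      ∀ j, ∃ β : Fin d → ℝ, (∀ i, |β i| ≤ 1) ∧ v j = ∑ i, β i • v (f i) := by
  obtain ⟨c, hc0, hc1, hdet⟩ := qh_dopt hd v hb hJ
  have hne : Nonempty (Fin n) := by
    by_contra hcon
    rw [not_nonempty_iff] at hcon
    simp at hc1
  obtain ⟨f, hf⟩ := Finite.exists_max
    (fun f : Fin d → Fin n => |(Matrix.of fun j => v (f j)).det|)
  have hcb := qh_cauchy_binet c v
  have hle : ∑ g : Fin d → Fin n, (∏ j, c (g j)) * (Matrix.of fun j => v (g j)).det ^ 2 ≤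
      ∑ g : Fin d → Fin n, (∏ j, c (g j)) * (Matrix.of fun j => v (f j)).det ^ 2 := by
    refine Finset.sum_le_sum fun g _ => mul_le_mul_of_nonneg_left (sq_le_sq.2 (hf g))
      (Finset.prod_nonneg fun j _ => hc0 _)
  have hone : ∑ g : Fin d → Fin n, ∏ j, c (g j) = 1 := by
    have := Finset.prod_univ_sum (fun _ : Fin d => (Finset.univ : Finset (Fin n)))
      (fun _ i => c i)
    simp only [hc1, Finset.prod_const_one, Fintype.piFinset_univ] at this
    exact this.symm
  rw [← Finset.sum_mul, hone, one_mul, ← hcb] at hle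
  have hfac : (d.factorial : ℝ) ≤ (d : ℝ) ^ d * (Matrix.of fun j => v (f j)).det ^ 2 := by
    calc (d.factorial : ℝ) = d.factorial * 1 := by ring
      _ ≤ d.factorial * ((d : ℝ) ^ d * (∑ i, c i • vecMulVec (v i) (v i)).det) := by gcongr
      _ = (d : ℝ) ^ d * (d.factorial * (∑ i, c i • vecMulVec (v i) (v i)).det) := by ring
      _ ≤ _ := by gcongr
  refine ⟨f, hfac, fun j => ?_⟩
  set V := Matrix.of fun j => v (f j) with hV
  have hV0 : V.det ≠ 0 := by
    intro h
    rw [h] at hfac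
    have : (0 : ℝ) < d.factorial := by exact_mod_cast d.factorial_pos
    simp only [ne_eq, OfNat.ofNat_ne_zero, not_false_eq_true, zero_pow, mul_zero] at hfac
    linarith
  refine ⟨fun i => V.det⁻¹ * cramer Vᵀ (v j) i, fun i => ?_, ?_⟩
  · beta_reduce
    rw [cramer_transpose_apply, abs_mul, abs_inv, inv_mul_le_iff₀ (abs_pos.2 hV0), mul_one]
    have := hf (Function.update f i j)
    have heq : V.updateRow i (v j) = Matrix.of fun k => v (Function.update f i j k) := by
      ext a b
      by_cases h : a = i
      · subst h; simp [hV]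
      · simp [hV, h]
    rw [heq]
    exact this
  · have h := mulVec_cramer Vᵀ (v j)
    rw [det_transpose, mulVec_transpose, vecMul_eq_sum] at h
    have h2 : v j = V.det⁻¹ • (V.det • v j) := by rw [smul_smul, inv_mul_cancel₀ hV0, one_smul]
    refine h2.trans ?_
    rw [← h, Finset.smul_sum]
    refine Finset.sum_congr rfl fun i _ => ?_
    rw [smul_smul]
    rfl

open Matrix in
lemma qh_hull {d n : ℕ} (hn : Nonempty (Fin n)) (v : Fin n → Fin d → ℝ)
    (hb : ∀ p : Fin d → ℝ, (∀ i, v i ⬝ᵥ p ≤ 1) → p ⬝ᵥ p ≤ (d : ℝ) ^ 2)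
    (z : Fin d → ℝ) (hz : ∀ x : Fin d → ℝ, (∀ i, v i ⬝ᵥ x ≤ 1) → z ⬝ᵥ x ≤ 1) :
    ∃ μ : Fin n → ℝ, (∀ i, 0 ≤ μ i) ∧ ∑ i, μ i ≤ 1 ∧ z = ∑ i, μ i • v i := by
  by_cases hmem : z ∈ convexHull ℝ (range v)
  · rw [convexHull_range_eq_exists_affineCombination] at hmem
    obtain ⟨s, w, hw0, hw1, rfl⟩ := hmem
    refine ⟨fun i => if i ∈ s then w i else 0, fun i => ?_, ?_, ?_⟩
    · by_cases h : i ∈ s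
      · simpa [h] using hw0 i h
      · simp [h]
    · simp [hw1]
    · rw [Finset.affineCombination_eq_linear_combination _ _ _ hw1]
      simp
  · exfalso
    obtain ⟨g, s, hg1, hg2⟩ := geometric_hahn_banach_closed_point (convex_convexHull ℝ (range v))
      ((Set.finite_range v).isClosed_convexHull ℝ) hmem
    obtain ⟨x, hx⟩ : ∃ x : Fin d → ℝ, ∀ y, g y = y ⬝ᵥ x := by
      refine ⟨fun i => g (Pi.single i 1), fun y => ?_⟩
      have := (g : (Fin d → ℝ) →ₗ[ℝ] ℝ).pi_apply_eq_sum_univ y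
      simp only [ContinuousLinearMap.coe_coe, smul_eq_mul] at this
      rw [this]
      simp only [dotProduct]
      refine Finset.sum_congr rfl fun i _ => ?_
      congr 2
      ext j
      simp [Pi.single_apply, eq_comm]
    have hv : ∀ i, v i ⬝ᵥ x < s := fun i => by
      rw [← hx]; exact hg1 _ (subset_convexHull ℝ _ ⟨i, rfl⟩)
    rw [hx] at hg2
    rcases le_or_gt s 0 with hs | hs
    · have h0 : x = 0 := qh_span v hb x fun i => (hv i).le.trans hs
      obtain ⟨i⟩ := hn
      have := hv i
      simp [h0] at this hg2
      linarith
    · have := hz (s⁻¹ • x) (fun i => by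
        rw [dotProduct_smul, smul_eq_mul, inv_mul_le_iff₀ hs, mul_one]; exact (hv i).le)
      rw [dotProduct_smul, smul_eq_mul, inv_mul_le_iff₀ hs, mul_one] at this
      linarith

lemma qh_simplex (d : ℕ) :
    volume {s : Fin d → ℝ | (∀ i, 0 ≤ s i) ∧ ∑ i, s i ≤ d + (d : ℝ) ^ 2} ≤
      ENNReal.ofReal ((Real.exp 1 * (d + 1)) ^ d) := by
  set k : ℝ := 1 / (d + 1) with hk
  have hk0 : 0 < k := by positivity
  set g : ℝ → ℝ := (Ici (0 : ℝ)).indicator (fun x => Real.exp 1 * Real.exp (-k * x)) with hg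
  have hg0 : ∀ x, 0 ≤ g x := fun x => indicator_nonneg (fun _ _ => by positivity) x
  have hgint : Integrable g := by
    rw [hg, integrable_indicator_iff measurableSet_Ici, integrableOn_Ici_iff_integrableOn_Ioi]
    exact (integrableOn_exp_mul_Ioi (by linarith) 0).const_mul _
  have hgI : ∫ x, g x = Real.exp 1 * (d + 1) := by
    rw [hg, integral_indicator measurableSet_Ici, integral_Ici_eq_integral_Ioi,
      integral_const_mul, integral_exp_mul_Ioi (by linarith)]
    simp [hk]
  have hprod : Integrable (fun x : Fin d → ℝ => ∏ i, g (x i)) :=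
    Integrable.fintype_prod (fun _ => hgint)
  have hI : ∫ x : Fin d → ℝ, ∏ i, g (x i) = (Real.exp 1 * (d + 1)) ^ d := by
    rw [integral_fintype_prod_volume_eq_pow, hgI, Fintype.card_fin]
  set S := {s : Fin d → ℝ | (∀ i, 0 ≤ s i) ∧ ∑ i, s i ≤ d + (d : ℝ) ^ 2} with hS
  have hSm : MeasurableSet S := by
    refine IsClosed.measurableSet ?_
    rw [hS, ofPred_and, ofPred_forall]
    exact (isClosed_iInter fun i => isClosed_le (by fun_prop) (by fun_prop)).inter
      (isClosed_le (by fun_prop) (by fun_prop))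
  rw [← hI, ofReal_integral_eq_lintegral_ofReal hprod
    (Filter.Eventually.of_forall fun x => Finset.prod_nonneg fun i _ => hg0 _),
    ← lintegral_indicator_one hSm]
  refine lintegral_mono fun x => ?_
  by_cases hx : x ∈ S
  · rw [indicator_of_mem hx, Pi.one_apply, ← ENNReal.ofReal_one]
    refine ENNReal.ofReal_le_ofReal ?_
    have : ∀ i, g (x i) = Real.exp (1 + -k * x i) := fun i => by
      rw [hg, indicator_of_mem (show x i ∈ Ici 0 from hx.1 i), Real.exp_add]
    simp only [this]
    rw [← Real.exp_sum, Finset.sum_add_distrib, ← Finset.mul_sum]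
    refine Real.one_le_exp ?_
    have h1 : k * ∑ i, x i ≤ k * (d + (d : ℝ) ^ 2) := mul_le_mul_of_nonneg_left hx.2 hk0.le
    have h2 : k * (d + (d : ℝ) ^ 2) = d := by rw [hk]; field_simp; ring
    simp
    linarith
  · rw [indicator_of_notMem hx]; exact zero_le

open Matrix in
lemma qh_vol {d : ℕ} (V : Matrix (Fin d) (Fin d) ℝ) (hV : V.det ≠ 0) :
    volume {x : Fin d → ℝ | (∀ i, (V *ᵥ x) i ≤ 1) ∧ -((d : ℝ) ^ 2) ≤ ∑ i, (V *ᵥ x) i} ≤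
      ENNReal.ofReal (|V.det|⁻¹ * (Real.exp 1 * (d + 1)) ^ d) := by
  set S := {s : Fin d → ℝ | (∀ i, 0 ≤ s i) ∧ ∑ i, s i ≤ d + (d : ℝ) ^ 2} with hS
  have hset : {x : Fin d → ℝ | (∀ i, (V *ᵥ x) i ≤ 1) ∧ -((d : ℝ) ^ 2) ≤ ∑ i, (V *ᵥ x) i} =
      (Matrix.toLin' (-V)) ⁻¹' ((fun s => s + fun _ => (1 : ℝ)) ⁻¹' S) := by
    ext x
    have hx : ∀ i, ((Matrix.toLin' (-V) x : Fin d → ℝ) + (fun _ => (1 : ℝ)) : Fin d → ℝ) i =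
        1 - (V *ᵥ x) i := by
      intro i
      rw [Pi.add_apply, Matrix.toLin'_apply, neg_mulVec, Pi.neg_apply]
      ring
    simp only [mem_ofPred_eq, mem_preimage, hS, hx]
    simp only [sub_nonneg, Finset.sum_sub_distrib]
    simp
    intro _
    constructor <;> intro h <;> linarith
  have hdet : |(LinearMap.det (Matrix.toLin' (-V)))⁻¹| = |V.det|⁻¹ := by
    rw [LinearMap.det_toLin', det_neg, abs_inv, abs_mul]
    simp
  have hdet0 : LinearMap.det (Matrix.toLin' (-V)) ≠ 0 := by
    rw [LinearMap.det_toLin', det_neg]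
    simp [hV]
  rw [hset, Measure.addHaar_preimage_linearMap _ hdet0, hdet, measure_preimage_add_right,
    ENNReal.ofReal_mul (by positivity)]
  gcongr
  exact qh_simplex d

lemma qh_ball (d : ℕ) (hd : 2 ≤ d) : ENNReal.ofReal ((2 / Real.sqrt d) ^ d) ≤
    volume (closedBall (0 : EuclideanSpace ℝ (Fin d)) 1) := by
  have hd' : (2 : ℝ) ≤ d := by exact_mod_cast hd
  set r := Real.sqrt d with hr
  have hr0 : 0 < r := Real.sqrt_pos.2 (by linarith)
  have hrr : r ^ 2 = d := Real.sq_sqrt (by linarith)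
  have h1 : volume (Icc (fun _ : Fin d => -(1 / r)) (fun _ => 1 / r)) =
      ENNReal.ofReal ((2 / r) ^ d) := by
    rw [Real.volume_Icc_pi]
    simp only [Finset.prod_const, Finset.card_univ, Fintype.card_fin]
    rw [← ENNReal.ofReal_pow (by rw [sub_neg_eq_add]; positivity)]
    congr 2; ring
  rw [← h1, ← (PiLp.volume_preserving_ofLp (Fin d)).measure_preimage
    measurableSet_Icc.nullMeasurableSet]
  refine measure_mono fun x hx => ?_
  rw [mem_closedBall_zero_iff, EuclideanSpace.norm_eq, Real.sqrt_le_one]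
  calc ∑ i, ‖x i‖ ^ 2 ≤ ∑ i : Fin d, (1 / r) ^ 2 := by
        refine Finset.sum_le_sum fun i _ => ?_
        rw [Real.norm_eq_abs]
        gcongr
        exact abs_le.2 ⟨hx.1 i, hx.2 i⟩
    _ = 1 := by
        rw [Finset.sum_const, one_div, inv_pow, hrr]; simp; field_simp

lemma qh_numeric (d : ℕ) (hd : 2 ≤ d) (D : ℝ)
    (hD : (d.factorial : ℝ) ≤ (d : ℝ) ^ d * D ^ 2) :
    |D|⁻¹ * (Real.exp 1 * (d + 1)) ^ d ≤
      ((Real.exp 1 * d) ^ ((3 * (d : ℝ)) / 2)) * (2 / Real.sqrt d) ^ d := by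
  have hd' : (2 : ℝ) ≤ d := by exact_mod_cast hd
  have hd0 : (0 : ℝ) < d := by linarith
  have hfac : (0 : ℝ) < d.factorial := by exact_mod_cast d.factorial_pos
  have hD0 : D ≠ 0 := by
    rintro rfl
    simp only [ne_eq, OfNat.ofNat_ne_zero, not_false_eq_true, zero_pow, mul_zero] at hD
    linarith
  set E := Real.exp (1 / 2) with hE
  have hE0 : 0 < E := Real.exp_pos _
  have hEE : E ^ 2 = Real.exp 1 := by
    rw [hE, ← Real.exp_nat_mul]; norm_num
  have h1 : |D|⁻¹ ≤ E ^ d := by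
    have h2 := Real.pow_div_factorial_le_exp (d : ℝ) hd0.le d
    rw [div_le_iff₀ hfac] at h2
    have h3 : Real.exp d = (E ^ d) ^ 2 := by
      rw [← pow_mul, mul_comm, pow_mul, hEE, ← Real.exp_nat_mul, mul_one]
    rw [h3] at h2
    have h4 : (1 : ℝ) ≤ (E ^ d * |D|) ^ 2 := by
      rw [mul_pow, sq_abs]
      have hp : (0 : ℝ) < (d : ℝ) ^ d := by positivity
      have h5 : (d : ℝ) ^ d * 1 ≤ (d : ℝ) ^ d * ((E ^ d) ^ 2 * D ^ 2) := by
        nlinarith [mul_le_mul_of_nonneg_left hD (sq_nonneg (E ^ d))]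
      exact le_of_mul_le_mul_left h5 hp
    have h6 : 1 ≤ E ^ d * |D| := (one_le_sq_iff₀ (by positivity)).1 h4
    rw [inv_le_iff_one_le_mul₀ (abs_pos.2 hD0)]
    exact h6
  have h7 : (Real.exp 1 * d) ^ ((3 * (d : ℝ)) / 2) = (E ^ 3 * (d * Real.sqrt d)) ^ d := by
    rw [show (3 * (d : ℝ)) / 2 = (1 / 2) * ((3 * d : ℕ) : ℝ) by push_cast; ring,
      Real.rpow_mul (by positivity), Real.rpow_natCast, ← Real.sqrt_eq_rpow, pow_mul]
    congr 1
    rw [Real.sqrt_mul (by positivity), ← hEE, Real.sqrt_sq hE0.le, mul_pow]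
    congr 1
    rw [pow_succ, Real.sq_sqrt hd0.le]
  rw [h7, ← mul_pow]
  have hs : 0 < Real.sqrt d := Real.sqrt_pos.2 hd0
  calc |D|⁻¹ * (Real.exp 1 * (d + 1)) ^ d ≤ E ^ d * (Real.exp 1 * (d + 1)) ^ d := by gcongr
    _ = (E ^ 3 * (d + 1)) ^ d := by rw [← mul_pow, ← hEE]; ring
    _ ≤ _ := by
      have : E ^ 3 * (d * Real.sqrt d) * (2 / Real.sqrt d) = E ^ 3 * (2 * d) := by field_simp
      rw [this]
      gcongr
      linarith

open Matrix in
lemma qh_john_of {d n : ℕ} (v : Fin n → Fin d → ℝ) (K : Set (EuclideanSpace ℝ (Fin d)))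
    (hK : ∀ x, x ∈ K ↔ ∀ i, v i ⬝ᵥ x.ofLp ≤ 1)
    (hJ : ∀ f : EuclideanSpace ℝ (Fin d) ≃ᵃ[ℝ] EuclideanSpace ℝ (Fin d),
            f '' closedBall (0 : EuclideanSpace ℝ (Fin d)) 1 ⊆ K →
            volume (f '' closedBall (0 : EuclideanSpace ℝ (Fin d)) 1) ≤
              volume (closedBall (0 : EuclideanSpace ℝ (Fin d)) 1)) : QHJohn v := by
  intro A a hA h
  set T : EuclideanSpace ℝ (Fin d) →ₗ[ℝ] EuclideanSpace ℝ (Fin d) := Matrix.toEuclideanLin A with hT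
  have hdet : LinearMap.det T = A.det := by
    rw [hT, Matrix.toEuclideanLin, Matrix.toLpLin_eq_toLin, LinearMap.det_toLin]
  have hT0 : LinearMap.det T ≠ 0 := by rwa [hdet]
  set f : EuclideanSpace ℝ (Fin d) ≃ᵃ[ℝ] EuclideanSpace ℝ (Fin d) :=
    (T.equivOfDetNeZero hT0).toAffineEquiv.trans (AffineEquiv.constVAdd ℝ _ (WithLp.toLp 2 a))
    with hf
  have hfx : ∀ x, f x = WithLp.toLp 2 a + T x := fun x => rfl
  have himg : f '' closedBall (0 : EuclideanSpace ℝ (Fin d)) 1 =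
      (fun y => WithLp.toLp 2 a + y) '' (T '' closedBall (0 : EuclideanSpace ℝ (Fin d)) 1) := by
    rw [image_image]; rfl
  have hvol := hJ f ?_
  · rw [himg, image_add_left, measure_preimage_add, Measure.addHaar_image_linearMap, hdet] at hvol
    have hpos : volume (closedBall (0 : EuclideanSpace ℝ (Fin d)) 1) ≠ 0 :=
      (measure_closedBall_pos _ _ one_pos).ne'
    have hfin : volume (closedBall (0 : EuclideanSpace ℝ (Fin d)) 1) ≠ ⊤ :=
      measure_closedBall_lt_top.ne
    rw [← ENNReal.ofReal_le_one]
    exact (ENNReal.mul_le_mul_iff_left hpos hfin).1 (by rwa [one_mul])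
  · rintro _ ⟨x, hx, rfl⟩
    rw [hK]
    intro i
    have := h i x.ofLp (by
      rw [mem_closedBall_zero_iff, EuclideanSpace.norm_eq, Real.sqrt_le_one] at hx
      simpa [dotProduct, sq] using hx)
    rw [hfx, add_comm]
    exact this

open Matrix in
lemma qh_core {d n : ℕ} (hd : 2 ≤ d) (v : Fin n → Fin d → ℝ) (hv : ∀ i, v i ⬝ᵥ v i ≤ 1)
    (hJ : QHJohn v) : ∃ (σ : Finset (Fin n)) (V : Matrix (Fin d) (Fin d) ℝ),
      σ.card ≤ 2 * d ∧ (d.factorial : ℝ) ≤ (d : ℝ) ^ d * V.det ^ 2 ∧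
      ∀ x : Fin d → ℝ, (∀ i ∈ σ, v i ⬝ᵥ x ≤ 1) →
        (∀ j, -(v j ⬝ᵥ x) ≤ 2 * (d : ℝ) ^ 2) ∧
        ((∀ i, (V *ᵥ x) i ≤ 1) ∧ -((d : ℝ) ^ 2) ≤ ∑ i, (V *ᵥ x) i) := by
  have hb := qh_bound hd v hv hJ
  have hd' : (2 : ℝ) ≤ d := by exact_mod_cast hd
  have hd2 : (0 : ℝ) < (d : ℝ) ^ 2 := by positivity
  obtain ⟨f, hdet, hβ⟩ := qh_maxdet hd v hb hJ
  set z : Fin d → ℝ := -(((d : ℝ) ^ 2)⁻¹ • ∑ i, v (f i)) with hz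
  have hzx : ∀ x : Fin d → ℝ, z ⬝ᵥ x = ((d : ℝ) ^ 2)⁻¹ * ∑ i, -(v (f i) ⬝ᵥ x) := by
    intro x
    rw [hz, neg_dotProduct, smul_dotProduct, sum_dotProduct, Finset.sum_neg_distrib, smul_eq_mul,
      mul_neg]
  obtain ⟨μ, hμ0, hμ1, hμz⟩ := qh_hull ⟨f ⟨0, by omega⟩⟩ v hb z (fun x hx => by
    rw [hzx, inv_mul_le_iff₀ hd2, mul_one]
    calc ∑ i, -(v (f i) ⬝ᵥ x) ≤ ∑ i : Fin d, (d : ℝ) := by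
          refine Finset.sum_le_sum fun i _ => ?_
          have := qh_cs (-x) (v (f i)) d (by linarith) (by simpa using hb x hx) (hv _)
          rwa [neg_dotProduct, dotProduct_comm] at this
      _ = (d : ℝ) ^ 2 := by simp [sq])
  obtain ⟨τ, ν, hτ, hν0, hν1, hνz⟩ := qh_carath v z Finset.univ μ hμ0 hμ1 hμz
  refine ⟨Finset.univ.image f ∪ τ, Matrix.of fun i => v (f i), ?_, hdet, fun x hx => ?_⟩
  · have h1 := Finset.card_union_le (Finset.univ.image f) τ
    have h2 : (Finset.univ.image f).card ≤ d := by
      simpa using Finset.card_image_le (s := (Finset.univ : Finset (Fin d))) (f := f)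
    omega
  have h1 : ∀ i, v (f i) ⬝ᵥ x ≤ 1 := fun i => hx _ (by simp)
  have h2 : z ⬝ᵥ x ≤ 1 := by
    rw [hνz, sum_dotProduct]
    refine le_trans (Finset.sum_le_sum fun i hi => ?_) hν1
    rw [smul_dotProduct, smul_eq_mul]
    have := hx i (by simp [hi])
    nlinarith [hν0 i]
  rw [hzx, inv_mul_le_iff₀ hd2, mul_one, Finset.sum_neg_distrib] at h2
  have hVx : ∀ i, ((Matrix.of fun i => v (f i)) *ᵥ x) i = v (f i) ⬝ᵥ x := fun i => rfl
  refine ⟨fun j => ?_, fun i => h1 i, ?_⟩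
  · obtain ⟨β, hβ1, hβv⟩ := hβ j
    rw [hβv, sum_dotProduct, ← Finset.sum_neg_distrib]
    have h3 : ∀ i : Fin d, -((β i • v (f i)) ⬝ᵥ x) ≤ 2 - v (f i) ⬝ᵥ x := by
      intro i
      rw [smul_dotProduct, smul_eq_mul]
      have ha := abs_le.1 (hβ1 i)
      nlinarith [mul_nonneg (sub_nonneg.2 ha.2) (sub_nonneg.2 (h1 i))]
    refine (Finset.sum_le_sum fun i _ => h3 i).trans ?_
    rw [Finset.sum_sub_distrib]
    simp only [Finset.sum_const, Finset.card_univ, Fintype.card_fin, nsmul_eq_mul]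
    nlinarith
  · simp only [hVx]
    linarith

/-- There is an absolute constant `c > 0` with the following property.
Let `d ≥ 2` and let `K ⊆ ℝ^d` be a convex polytope in John's position, written as
the intersection of `n` closed halfspaces `K i = {x | ⟪u i, x⟫ ≤ b i}`. Then there
is `σ` with `|σ| ≤ 2d` such that `K_σ ⊆ -2d² • K` and
`vol(K_σ) ≤ (c·d)^(3d/2) · vol(K)`. -/
theorem quantitative_helly_john_polytope :
    ∃ c : ℝ, 0 < c ∧
      ∀ (d n : ℕ), 2 ≤ d →
        ∀ (K : Set (EuclideanSpace ℝ (Fin d)))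
          (Khalf : Fin n → Set (EuclideanSpace ℝ (Fin d)))
          (u : Fin n → EuclideanSpace ℝ (Fin d)) (b : Fin n → ℝ),
          (∀ i, u i ≠ 0) →
          (∀ i, Khalf i = {x : EuclideanSpace ℝ (Fin d) | ⟪u i, x⟫ ≤ b i}) →
          K = ⋂ i, Khalf i →
          IsCompact K → (interior K).Nonempty →
          closedBall (0 : EuclideanSpace ℝ (Fin d)) 1 ⊆ K →
          (∀ f : EuclideanSpace ℝ (Fin d) ≃ᵃ[ℝ] EuclideanSpace ℝ (Fin d),
            f '' closedBall (0 : EuclideanSpace ℝ (Fin d)) 1 ⊆ K →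
            volume (f '' closedBall (0 : EuclideanSpace ℝ (Fin d)) 1) ≤
              volume (closedBall (0 : EuclideanSpace ℝ (Fin d)) 1)) →
          ∃ σ : Finset (Fin n), σ.card ≤ 2 * d ∧
            (⋂ i ∈ σ, Khalf i) ⊆ (-(2 * (d : ℝ) ^ 2)) • K ∧
            volume (⋂ i ∈ σ, Khalf i) ≤
              ENNReal.ofReal ((c * d) ^ ((3 * (d : ℝ)) / 2)) * volume K := by
  refine ⟨Real.exp 1, Real.exp_pos 1, ?_⟩
  intro d n hd K Khalf u b hu hhalf hK _ _ hball hJ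
  have hd' : (2 : ℝ) ≤ d := by exact_mod_cast hd
  have hub : ∀ i, ‖u i‖ ≤ b i := by
    intro i
    have hpos : 0 < ‖u i‖ := norm_pos_iff.2 (hu i)
    have hmem : (‖u i‖⁻¹ • u i) ∈ K := hball (by
      rw [mem_closedBall_zero_iff, norm_smul, norm_inv, norm_norm, inv_mul_cancel₀ hpos.ne'])
    rw [hK, mem_iInter] at hmem
    have h := hmem i
    rw [hhalf, mem_ofPred_eq, inner_smul_right, real_inner_self_eq_norm_sq] at h
    have h2 : ‖u i‖⁻¹ * ‖u i‖ ^ 2 = ‖u i‖ := by field_simp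
    linarith
  have hb0 : ∀ i, 0 < b i := fun i => (norm_pos_iff.2 (hu i)).trans_le (hub i)
  set v : Fin n → Fin d → ℝ := fun i => (b i)⁻¹ • (u i).ofLp with hv
  have hin : ∀ i (x : EuclideanSpace ℝ (Fin d)), v i ⬝ᵥ x.ofLp = (b i)⁻¹ * ⟪u i, x⟫ := by
    intro i x
    rw [EuclideanSpace.inner_eq_star_dotProduct, hv, smul_dotProduct, smul_eq_mul, star_trivial,
      dotProduct_comm]
  have hhx : ∀ i x, x ∈ Khalf i ↔ v i ⬝ᵥ x.ofLp ≤ 1 := by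
    intro i x
    rw [hhalf, mem_ofPred_eq, hin, inv_mul_le_iff₀ (hb0 i), mul_one]
  have hKx : ∀ x, x ∈ K ↔ ∀ i, v i ⬝ᵥ x.ofLp ≤ 1 := by
    intro x
    rw [hK, mem_iInter]
    exact forall_congr' fun i => hhx i x
  have hvv : ∀ i, v i ⬝ᵥ v i ≤ 1 := by
    intro i
    have h1 : v i ⬝ᵥ v i = (b i)⁻¹ * (v i ⬝ᵥ (u i).ofLp) := by
      conv_lhs => rw [hv]
      rw [dotProduct_smul, smul_eq_mul]
    rw [h1, hin, real_inner_self_eq_norm_sq, ← mul_assoc, ← sq, inv_pow,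
      inv_mul_le_iff₀ (pow_pos (hb0 i) 2), mul_one]
    exact pow_le_pow_left₀ (norm_nonneg _) (hub i) 2
  obtain ⟨σ, V, hσ, hdet, hcore⟩ := qh_core hd v hvv (qh_john_of v K hKx hJ)
  have hmem : ∀ x ∈ (⋂ i ∈ σ, Khalf i), ∀ i ∈ σ, v i ⬝ᵥ x.ofLp ≤ 1 := by
    intro x hx i hi
    exact (hhx i x).1 (mem_iInter₂.1 hx i hi)
  refine ⟨σ, hσ, fun x hx => ?_, ?_⟩
  · have h := (hcore x.ofLp (hmem x hx)).1
    have hne : (-(2 * (d : ℝ) ^ 2)) ≠ 0 := by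
      have : 0 < 2 * (d : ℝ) ^ 2 := by positivity
      linarith
    rw [mem_smul_set_iff_inv_smul_mem₀ hne, hKx]
    intro i
    rw [WithLp.ofLp_smul, dotProduct_smul, smul_eq_mul, inv_neg, neg_mul, ← mul_neg,
      inv_mul_le_iff₀ (by positivity), mul_one]
    exact h i
  · have hV0 : V.det ≠ 0 := by
      intro h0
      have hfac : (0 : ℝ) < d.factorial := by exact_mod_cast d.factorial_pos
      rw [h0] at hdet
      simp only [ne_eq, OfNat.ofNat_ne_zero, not_false_eq_true, zero_pow, mul_zero] at hdet
      linarith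
    calc volume (⋂ i ∈ σ, Khalf i)
        ≤ volume ((@WithLp.ofLp 2 (Fin d → ℝ)) ⁻¹' {x : Fin d → ℝ | (∀ i, (V.mulVec x) i ≤ 1) ∧
            -((d : ℝ) ^ 2) ≤ ∑ i, (V.mulVec x) i}) :=
          measure_mono fun x hx => (hcore x.ofLp (hmem x hx)).2
      _ = volume {x : Fin d → ℝ | (∀ i, (V.mulVec x) i ≤ 1) ∧
            -((d : ℝ) ^ 2) ≤ ∑ i, (V.mulVec x) i} := by
          exact (PiLp.volume_preserving_ofLp (Fin d)).measure_preimage_equiv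
            (f := (MeasurableEquiv.toLp 2 (Fin d → ℝ)).symm) _
      _ ≤ ENNReal.ofReal (|V.det|⁻¹ * (Real.exp 1 * (d + 1)) ^ d) := qh_vol V hV0
      _ ≤ ENNReal.ofReal (((Real.exp 1 * d) ^ ((3 * (d : ℝ)) / 2)) * (2 / Real.sqrt d) ^ d) :=
          ENNReal.ofReal_le_ofReal (qh_numeric d hd _ hdet)
      _ = ENNReal.ofReal ((Real.exp 1 * d) ^ ((3 * (d : ℝ)) / 2)) *
            ENNReal.ofReal ((2 / Real.sqrt d) ^ d) := ENNReal.ofReal_mul (by positivity)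
      _ ≤ _ := by
          gcongr
          exact (qh_ball d hd).trans (measure_mono hball)
end

section
/- Let d ≥ 2 and let Q ⊂ ℝ^d be a convex polytope satisfying (1/d)·B^d ⊆ Q ⊆ B^d. Then there exists a set of at most 2d vertices of Q whose convex hull Q' satisfies Q ⊆ −(d+2)d · Q', and in particular Q ⊆ −2d² · Q'. -/
open Set MeasureTheory Pointwise Metric

/-- A frontier point of a full-dimensional hull is a combination of at most `finrank` points. -/
lemma frontier_caratheodory {E : Type*} [NormedAddCommGroup E] [NormedSpace ℝ E]
    [FiniteDimensional ℝ E] [DecidableEq E] (S : Set E) (y : E) (hy : y ∈ convexHull ℝ S)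
    (hint : y ∉ interior (convexHull ℝ S)) :
    ∃ T : Finset E, (T : Set E) ⊆ S ∧ T.card ≤ Module.finrank ℝ E ∧
      y ∈ convexHull ℝ (T : Set E) := by
  obtain ⟨ι, _, z, w, hz, hind, hw, hw1, hwy⟩ := eq_pos_convex_span_of_mem_convexHull hy
  have hcard : Fintype.card ι ≤ Module.finrank ℝ E := by
    by_contra hc
    have h1 : Fintype.card ι ≤ Module.finrank ℝ E + 1 :=
      hind.card_le_finrank_succ.trans (Nat.add_le_add_right (Submodule.finrank_le _) 1)
    have htop := hind.affineSpan_eq_top_iff_card_eq_finrank_add_one.2 (by omega)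
    let b : AffineBasis ι ℝ E := ⟨z, hind, htop⟩
    apply hint
    apply interior_mono (convexHull_mono hz)
    have hb := b.interior_convexHull
    have : y ∈ {x | ∀ i, 0 < b.coord i x} := by
      intro i
      have hc : (Finset.univ.affineCombination ℝ b w) = y := by
        rw [Finset.affineCombination_eq_linear_combination _ _ _ hw1]
        exact hwy
      rw [← hc, b.coord_apply_combination_of_mem (Finset.mem_univ i) hw1]
      exact hw i
    rw [← hb] at this
    exact this
  refine ⟨Finset.univ.image z, by simpa using hz, Finset.card_image_le.trans (by simpa using hcard), ?_⟩
  rw [← hwy]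
  refine (convex_convexHull ℝ _).sum_mem (fun i _ => (hw i).le) hw1 (fun i _ => ?_)
  exact subset_convexHull ℝ _ (by simp)

/-- A volume-maximal choice of points yields a basis with bounded coordinates. -/
lemma max_det_basis (d : ℕ) (S : Set (EuclideanSpace ℝ (Fin d))) (hS : S.Finite)
    (hspan : Submodule.span ℝ S = ⊤) :
    ∃ b : Module.Basis (Fin d) ℝ (EuclideanSpace ℝ (Fin d)), (∀ i, b i ∈ S) ∧
      ∀ x ∈ S, ∀ i, |b.coord i x| ≤ 1 := by
  classical
  let e := (EuclideanSpace.basisFun (Fin d) ℝ).toBasis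
  obtain ⟨f, hfS, hfspan, hfind⟩ := Submodule.exists_fun_fin_finrank_span_eq ℝ S
  have hfr : Module.finrank ℝ (Submodule.span ℝ S) = d := by
    rw [hspan]; simp
  replace hfspan := hfspan.trans hspan
  obtain ⟨g, hgS, hgspan, hgind⟩ : ∃ g : Fin d → EuclideanSpace ℝ (Fin d), (∀ i, g i ∈ S) ∧
      Submodule.span ℝ (range g) = ⊤ ∧ LinearIndependent ℝ g := by
    generalize Module.finrank ℝ (Submodule.span ℝ S) = m at f hfr
    subst hfr
    exact ⟨f, hfS, hfspan, hfind⟩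
  have hgdet : e.det g ≠ 0 := ((Module.Basis.is_basis_iff_det e).1 ⟨hgind, hgspan⟩).ne_zero
  have hfin : {v : Fin d → EuclideanSpace ℝ (Fin d) | ∀ i, v i ∈ S}.Finite :=
    Set.Finite.pi' (fun _ => hS)
  obtain ⟨v, hvS, hvmax⟩ := Set.exists_max_image _ (fun v => |e.det v|) hfin ⟨g, hgS⟩
  have hvdet : e.det v ≠ 0 := by
    have := hvmax g hgS
    intro h0
    simp only [h0, abs_zero] at this
    exact hgdet (abs_nonpos_iff.1 this)
  obtain ⟨hli, hsp⟩ := (Module.Basis.is_basis_iff_det e).2 (isUnit_iff_ne_zero.2 hvdet)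
  refine ⟨Module.Basis.mk hli hsp.ge, fun i => by simpa using hvS i, fun x hx i => ?_⟩
  have h := congrArg (fun l => l x) (Module.Basis.det_smul_mk_coord_eq_det_update e hli hsp.ge i)
  simp only [LinearMap.smul_apply, smul_eq_mul, MultilinearMap.toLinearMap_apply] at h
  have hm : |e.det (Function.update v i x)| ≤ |e.det v| := by
    apply hvmax
    intro j
    by_cases hj : j = i
    · subst hj; simpa using hx
    · simpa [hj] using hvS j
  have h2 : |e.det v| * |(Module.Basis.mk hli hsp.ge).coord i x| ≤ |e.det v| * 1 := by
    rw [← abs_mul, h, mul_one]; exact hm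
  exact le_of_mul_le_mul_left h2 (abs_pos.2 hvdet)

/-- If `Q ⊆ ℝ^d` (`d ≥ 2`) is a convex polytope with
`(1/d) • B^d ⊆ Q ⊆ B^d`, then there are at most `2d` vertices of `Q` whose convex
hull `Q'` satisfies `Q ⊆ -(d+2)d • Q'`, and in particular `Q ⊆ -2d² • Q'`. -/
theorem sparse_approx_sandwiched_polytope (d : ℕ) (hd : 2 ≤ d)
    (Q : Set (EuclideanSpace ℝ (Fin d)))
    (hQpoly : ∃ V : Finset (EuclideanSpace ℝ (Fin d)), Q = convexHull ℝ (V : Set (EuclideanSpace ℝ (Fin d))))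
    (hlow : ((1 : ℝ) / d) • closedBall (0 : EuclideanSpace ℝ (Fin d)) 1 ⊆ Q)
    (hup : Q ⊆ closedBall (0 : EuclideanSpace ℝ (Fin d)) 1) :
    ∃ W : Finset (EuclideanSpace ℝ (Fin d)),
      (W : Set (EuclideanSpace ℝ (Fin d))) ⊆ Set.extremePoints ℝ Q ∧
      W.card ≤ 2 * d ∧
      Q ⊆ (-(((d : ℝ) + 2) * d)) • convexHull ℝ (W : Set (EuclideanSpace ℝ (Fin d))) ∧
      Q ⊆ (-(2 * (d : ℝ) ^ 2)) • convexHull ℝ (W : Set (EuclideanSpace ℝ (Fin d))) := by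
  classical
  obtain ⟨V, hV⟩ := hQpoly
  have hd0 : (0 : ℝ) < d := by positivity
  have hd2 : (2 : ℝ) ≤ d := by exact_mod_cast hd
  have hQconv : Convex ℝ Q := hV ▸ convex_convexHull ℝ _
  have hQcomp : IsCompact Q := hV ▸ V.finite_toSet.isCompact_convexHull ℝ
  set S := Set.extremePoints ℝ Q with hSdef
  have hSfin : S.Finite := V.finite_toSet.subset (by
    rw [hSdef, hV]; exact extremePoints_convexHull_subset)
  have hSQ : convexHull ℝ S = Q := by
    rw [← (hSfin.isClosed_convexHull ℝ).closure_eq]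
    exact closure_convexHull_extremePoints hQcomp hQconv
  have hball : ∀ x : EuclideanSpace ℝ (Fin d), ‖x‖ ≤ 1 → ((1 : ℝ) / d) • x ∈ Q := fun x hx =>
    hlow (Set.smul_mem_smul_set (by simpa using hx))
  have hnhds : Q ∈ nhds (0 : EuclideanSpace ℝ (Fin d)) := by
    refine Filter.mem_of_superset (Metric.closedBall_mem_nhds _ (show (0 : ℝ) < 1 / d by positivity)) ?_
    intro x hx
    have := hball ((d : ℝ) • x) (by
      rw [norm_smul, Real.norm_of_nonneg hd0.le]
      rw [mem_closedBall_zero_iff] at hx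
      calc (d : ℝ) * ‖x‖ ≤ d * (1 / d) := by gcongr
        _ = 1 := by field_simp)
    rwa [smul_smul, one_div_mul_cancel hd0.ne', one_smul] at this
  have hspan : Submodule.span ℝ S = ⊤ := by
    rw [Submodule.eq_top_iff_forall_basis_mem (EuclideanSpace.basisFun (Fin d) ℝ).toBasis]
    intro i
    have h1 : convexHull ℝ S ⊆ Submodule.span ℝ S :=
      convexHull_min Submodule.subset_span (Submodule.convex _)
    have h2 := h1 (hSQ.symm ▸ hball (EuclideanSpace.basisFun (Fin d) ℝ i) (by simp))
    have h3 := Submodule.smul_mem _ (d : ℝ) h2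
    rw [smul_smul, mul_one_div_cancel hd0.ne', one_smul] at h3
    simpa using h3
  obtain ⟨b, hbS, hb1⟩ := max_det_basis d S hSfin hspan
  have hbQ : ∀ x ∈ Q, ∀ i, |b.coord i x| ≤ 1 := by
    intro x hx i
    have : convexHull ℝ S ⊆ (b.coord i) ⁻¹' (Set.Icc (-1) 1) :=
      convexHull_min (fun y hy => abs_le.1 (hb1 y hy i))
        ((convex_Icc (-1 : ℝ) 1).linear_preimage (b.coord i))
    exact abs_le.2 (this (hSQ.symm ▸ hx))
  have hbn : ∀ i, ‖b i‖ ≤ 1 := fun i => by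
    have := hup (extremePoints_subset (hbS i))
    simpa using this
  set σ := ∑ i, b i with hσ
  set p := -(((d : ℝ) ^ 2)⁻¹ • σ) with hp
  have hpQ : p ∈ Q := by
    have h := hball (-((d : ℝ)⁻¹ • σ)) (by
      rw [norm_neg, norm_smul, norm_inv, Real.norm_of_nonneg hd0.le, inv_mul_le_iff₀ hd0]
      refine (norm_sum_le _ _).trans ((Finset.sum_le_sum (fun i _ => hbn i)).trans ?_)
      simp)
    rw [smul_neg, smul_smul] at h
    rw [hp]
    convert h using 3
    field_simp
  have hσ0 : σ ≠ 0 := by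
    intro h0
    have := congrArg (b.coord ⟨0, by omega⟩) h0
    simp [hσ, Finsupp.single_apply] at this
  have hp0 : p ≠ 0 := by
    rw [hp, neg_ne_zero]
    exact smul_ne_zero (by positivity) hσ0
  set g := gauge Q p with hg
  have hg1 : g ≤ 1 := gauge_le_one_of_mem hpQ
  have hg0 : 0 < g :=
    (gauge_pos (absorbent_nhds_zero hnhds) (hQcomp.isVonNBounded ℝ)).2 hp0
  set y := g⁻¹ • p with hy
  have hyg : gauge Q y = 1 := by
    rw [hy, gauge_smul_of_nonneg (inv_nonneg.2 hg0.le), smul_eq_mul]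
    exact inv_mul_cancel₀ hg0.ne'
  have hyf := (gauge_eq_one_iff_mem_frontier hQconv hnhds).1 hyg
  have hyQ : y ∈ Q := hQcomp.isClosed.frontier_subset hyf
  obtain ⟨T, hTS, hTc, hyT⟩ := frontier_caratheodory S y (hSQ.symm ▸ hyQ) (hSQ.symm ▸ hyf.2)
  rw [finrank_euclideanSpace_fin] at hTc
  set W := Finset.univ.image b ∪ T with hW
  set K := convexHull ℝ (W : Set (EuclideanSpace ℝ (Fin d))) with hK
  have hKc : Convex ℝ K := convex_convexHull ℝ _
  have hbK : ∀ i, b i ∈ K := fun i => subset_convexHull ℝ _ (by simp [hW])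
  have hyK : y ∈ K := convexHull_mono (by simp [hW]) hyT
  have hcK : (d : ℝ)⁻¹ • σ ∈ K := by
    rw [hσ, Finset.smul_sum]
    exact hKc.sum_mem (fun _ _ => by positivity) (by simp [hd0.ne']) (fun i _ => hbK i)
  have hpy : p = g • y := by rw [hy, smul_smul, mul_inv_cancel₀ hg0.ne', one_smul]
  have h0K : (0 : EuclideanSpace ℝ (Fin d)) ∈ K := by
    have h := hKc hyK hcK (a := d * g / (d * g + 1)) (b := 1 / (d * g + 1))
      (by positivity) (by positivity) (by field_simp)
    convert h using 1
    have e1 : (d * g / (d * g + 1)) • y = (d / (d * g + 1)) • p := by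
      rw [hy, smul_smul]; congr 1; field_simp
    rw [e1, hp, smul_neg, smul_smul, smul_smul, ← neg_smul, ← add_smul]
    symm
    convert zero_smul ℝ σ using 2
    field_simp
    ring
  have hpK : p ∈ K := hpy ▸ hKc.smul_mem_of_zero_mem h0K hyK ⟨hg0.le, hg1⟩
  have main : ∀ x ∈ Q, (-(((d : ℝ) + 2) * d))⁻¹ • x ∈ K := by
    intro x hx
    have hs : ∑ i, (d : ℝ)⁻¹ • (((1 - b.coord i x) / 2) • b i) ∈ K := by
      refine hKc.sum_mem (fun _ _ => by positivity) (by simp [hd0.ne']) (fun i _ => ?_)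
      have := abs_le.1 (hbQ x hx i)
      exact hKc.smul_mem_of_zero_mem h0K (hbK i) ⟨by linarith, by linarith⟩
    have h := hKc hs hpK (a := 2 / (d + 2)) (b := d / (d + 2))
      (by positivity) (by positivity) (by field_simp; ring)
    convert h using 1
    have hx' : x = ∑ i, b.coord i x • b i := by
      simpa using (b.sum_repr x).symm
    have e2 : ∑ i, (d : ℝ)⁻¹ • (((1 - b.coord i x) / 2) • b i) = (2 * (d : ℝ))⁻¹ • (σ - x) := by
      conv_rhs => rw [hx', hσ, ← Finset.sum_sub_distrib, Finset.smul_sum]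
      refine Finset.sum_congr rfl fun i _ => ?_
      have : b i - b.coord i x • b i = (1 - b.coord i x) • b i := by rw [sub_smul, one_smul]
      rw [this, smul_smul, smul_smul]
      congr 1
      field_simp
    rw [e2, hp]
    match_scalars <;> field_simp <;> ring
  refine ⟨W, ?_, ?_, ?_, ?_⟩
  · intro z hz
    simp only [hW, Finset.coe_union, Finset.coe_image, Finset.coe_univ, Set.image_univ] at hz
    rcases hz with ⟨i, rfl⟩ | hz
    · exact hbS i
    · exact hTS hz
  · refine (Finset.card_union_le _ _).trans ?_
    have : (Finset.univ.image b).card ≤ d := Finset.card_image_le.trans (by simp)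
    omega
  · intro x hx
    rw [Set.mem_smul_set_iff_inv_smul_mem₀ (neg_ne_zero.2 (by positivity))]
    exact main x hx
  · intro x hx
    rw [Set.mem_smul_set_iff_inv_smul_mem₀ (neg_ne_zero.2 (by positivity))]
    have h := hKc.smul_mem_of_zero_mem h0K (main x hx) (t := (d + 2) / (2 * d))
      ⟨by positivity, by rw [div_le_one (by positivity)]; linarith⟩
    convert h using 1
    rw [smul_smul]
    congr 1
    field_simp
end
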